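/- Let n ≥ 5 and let u be a positive C⁴ function on ℝⁿ \ {0} satisfying the biharmonic equation Δ²u = u^((n+4)/(n−4)) on ℝⁿ \ {0}, and suppose the singularity of u at the origin is non-removable, i.e. there is no positive C⁴ function U on all of ℝⁿ with Δ²U = U^((n+4)/(n−4)) on ℝⁿ and U = u on ℝⁿ \ {0}. Then there exist L ∈ ℝ and a solution v ∈ C⁴(ℝ) of the ODE v'''' − A·v'' − f(v) = 0 which is either the constant a₀ or a periodic solution whose minimal value lies in (0, a₀), such that u(x) = |x|^(−(n−4)/2) · v(ln|x| + L) for all x ∈ ℝⁿ \ {0}. -/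

import Mathlib

open Real Filter

namespace Paper

/-- The coefficient `A = (n(n-4)+8)/2`. -/
noncomputable def A (n : ℕ) : ℝ := ((n : ℝ) * ((n : ℝ) - 4) + 8) / 2

/-- The coefficient `B = n²(n-4)²/16`. -/
noncomputable def B (n : ℕ) : ℝ := (n : ℝ) ^ 2 * ((n : ℝ) - 4) ^ 2 / 16

/-- The exponent `p = (n+4)/(n-4)`. -/
noncomputable def p (n : ℕ) : ℝ := ((n : ℝ) + 4) / ((n : ℝ) - 4)

/-- The nonlinearity `f(v) = |v|^(p-1) v - B v`. -/
noncomputable def f (n : ℕ) (v : ℝ) : ℝ := |v| ^ (p n - 1) * v - B n * v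

/-- The constant `a₀ = (n(n-4)/4)^((n-4)/4)`. -/
noncomputable def a₀ (n : ℕ) : ℝ := ((n : ℝ) * ((n : ℝ) - 4) / 4) ^ (((n : ℝ) - 4) / 4)

/-- The constant `c_n = ((n-4)(n-2)n(n+2))^((n-4)/8)`. -/
noncomputable def c (n : ℕ) : ℝ :=
  (((n : ℝ) - 4) * ((n : ℝ) - 2) * (n : ℝ) * ((n : ℝ) + 2)) ^ (((n : ℝ) - 4) / 8)

/-- The potential `F(v) = |v|^(p+1)/(p+1) - (B/2) v²`. -/
noncomputable def F (n : ℕ) (s : ℝ) : ℝ := |s| ^ (p n + 1) / (p n + 1) - B n / 2 * s ^ 2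

/-- The energy `E_v(t) = -v''' v' + v''²/2 + (A/2) v'² + F(v)`. -/
noncomputable def E (n : ℕ) (v : ℝ → ℝ) (t : ℝ) : ℝ :=
  -(iteratedDeriv 3 v t) * deriv v t + 1 / 2 * (iteratedDeriv 2 v t) ^ 2
    + A n / 2 * (deriv v t) ^ 2 + F n (v t)

end Paper

namespace Paper

/-- The Laplacian of `u : ℝⁿ → ℝ` at `x`, as the sum of the second derivatives of `u` along
the coordinate directions. -/
noncomputable def lap (n : ℕ) (u : EuclideanSpace ℝ (Fin n) → ℝ)
    (x : EuclideanSpace ℝ (Fin n)) : ℝ :=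
  ∑ i : Fin n,
    iteratedDeriv 2 (fun s : ℝ => u (x + s • EuclideanSpace.single i (1 : ℝ))) 0

/-- The bi-Laplacian `Δ² = Δ ∘ Δ`. -/
noncomputable def biLap (n : ℕ) (u : EuclideanSpace ℝ (Fin n) → ℝ)
    (x : EuclideanSpace ℝ (Fin n)) : ℝ :=
  lap n (lap n u) x

end Paper

namespace BiharmonicCritical

open MeasureTheory Topology Set Paper
open scoped ContDiff ENNReal

/-- Euclidean space of dimension `n`. -/
abbrev Rn (n : ℕ) := EuclideanSpace ℝ (Fin n)

/-- The coordinate vectors. -/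
noncomputable abbrev basisVec {n : ℕ} (i : Fin n) : Rn n := EuclideanSpace.single i (1 : ℝ)

section Laplacian

variable {n : ℕ} {u v : Rn n → ℝ} {x : Rn n}

lemma lap_congr (h : u =ᶠ[𝓝 x] v) : lap n u x = lap n v x := by
  unfold lap
  refine Finset.sum_congr rfl fun i _ => ?_
  apply Filter.EventuallyEq.iteratedDeriv_eq
  have hc : Tendsto (fun s : ℝ => x + s • basisVec i) (𝓝 0) (𝓝 x) := by
    have : Continuous (fun s : ℝ => x + s • basisVec i) := by fun_prop
    simpa using this.tendsto 0
  exact hc.eventually h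

lemma lap_eventuallyEq (h : u =ᶠ[𝓝 x] v) : lap n u =ᶠ[𝓝 x] lap n v := by
  filter_upwards [h.eventuallyEq_nhds] with y hy using lap_congr hy

lemma biLap_congr (h : u =ᶠ[𝓝 x] v) : biLap n u x = biLap n v x :=
  lap_congr (lap_eventuallyEq h)

lemma lap_comp_smul (c : ℝ) (u : Rn n → ℝ) (x : Rn n) :
    lap n (fun y => u (c • y)) x = c ^ 2 * lap n u (c • x) := by
  unfold lap
  rw [Finset.mul_sum]
  refine Finset.sum_congr rfl fun i _ => ?_
  set g : ℝ → ℝ := fun s => u (c • x + s • basisVec i) with hg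
  have h1 : (fun s : ℝ => u (c • (x + s • EuclideanSpace.single i (1 : ℝ))))
      = fun s => g (c * s) := by
    funext s
    simp only [hg, smul_add, smul_smul]
  have h2 : deriv (fun s => g (c * s)) = fun s => c • deriv g (c * s) := by
    funext s
    exact deriv_comp_mul_left c g s
  rw [h1, iteratedDeriv_succ, iteratedDeriv_one, h2, iteratedDeriv_succ, iteratedDeriv_one]
  have h3 : deriv (fun s => c • deriv g (c * s)) 0 = c • deriv (fun s => deriv g (c * s)) 0 := by
    simp only [smul_eq_mul]
    exact deriv_const_mul_field c
  rw [h3, deriv_comp_mul_left c (deriv g) 0]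
  simp only [smul_eq_mul, mul_zero]
  ring

lemma lap_const_mul (c : ℝ) (u : Rn n → ℝ) (x : Rn n) :
    lap n (fun y => c * u y) x = c * lap n u x := by
  unfold lap
  rw [Finset.mul_sum]
  refine Finset.sum_congr rfl fun i _ => ?_
  rw [iteratedDeriv_succ, iteratedDeriv_one, iteratedDeriv_succ, iteratedDeriv_one]
  have : deriv (fun s : ℝ => c * u (x + s • EuclideanSpace.single i (1 : ℝ)))
      = fun s => c * deriv (fun s : ℝ => u (x + s • EuclideanSpace.single i (1 : ℝ))) s := by
    funext s
    exact deriv_const_mul_field c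
  rw [this, deriv_const_mul_field]

lemma biLap_const_mul (c : ℝ) (u : Rn n → ℝ) (x : Rn n) :
    biLap n (fun y => c * u y) x = c * biLap n u x := by
  unfold biLap
  rw [← lap_const_mul]
  congr 1
  funext y
  exact lap_const_mul c u y

lemma biLap_comp_smul (c : ℝ) (u : Rn n → ℝ) (x : Rn n) :
    biLap n (fun y => u (c • y)) x = c ^ 4 * biLap n u (c • x) := by
  unfold biLap
  have : lap n (fun y => u (c • y)) = fun y => c ^ 2 * lap n u (c • y) := by
    funext y
    exact lap_comp_smul c u y
  rw [this, lap_const_mul, lap_comp_smul c (lap n u)]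
  ring

lemma lap_eq_sum_fderiv (hu : ContDiffAt ℝ 2 u x) :
    lap n u x = ∑ i : Fin n,
      fderiv ℝ (fun y => fderiv ℝ u y (basisVec i)) x (basisVec i) := by
  unfold lap
  refine Finset.sum_congr rfl fun i _ => ?_
  rw [iteratedDeriv_succ, iteratedDeriv_one]
  have hline : ∀ s : ℝ, HasDerivAt (fun s : ℝ => x + s • basisVec i) (basisVec i) s := by
    intro s
    simpa using ((hasDerivAt_id s).smul_const (basisVec i)).const_add x
  have hc : Tendsto (fun s : ℝ => x + s • basisVec i) (𝓝 0) (𝓝 x) := by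
    have : Continuous (fun s : ℝ => x + s • basisVec i) := by fun_prop
    simpa using this.tendsto 0
  have hev : ∀ᶠ y in 𝓝 x, DifferentiableAt ℝ u y := by
    filter_upwards [hu.eventually (by simp)] with y hy
    exact hy.differentiableAt (by norm_num)
  have h1 : deriv (fun s : ℝ => u (x + s • EuclideanSpace.single i (1 : ℝ)))
      =ᶠ[𝓝 0] fun s => fderiv ℝ u (x + s • basisVec i) (basisVec i) := by
    filter_upwards [hc.eventually hev] with s hs
    exact (hs.hasFDerivAt.comp_hasDerivAt s (hline s)).deriv
  rw [h1.deriv_eq]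
  have hd : DifferentiableAt ℝ (fun y => fderiv ℝ u y (basisVec i)) x := by
    have : ContDiffAt ℝ 1 (fderiv ℝ u) x := hu.fderiv_right (by norm_num)
    exact ((this.clm_apply contDiffAt_const).differentiableAt (by norm_num))
  have hx : x = x + (0 : ℝ) • basisVec i := by simp
  have hd' := hd.hasFDerivAt
  have h2 := HasFDerivAt.comp_hasDerivAt (f := fun s : ℝ => x + s • basisVec i)
    (l := fun y => fderiv ℝ u y (basisVec i)) 0 (by rw [← hx]; exact hd') (hline 0)
  exact h2.deriv

lemma contDiffAt_lap_param {G : Type*} [NormedAddCommGroup G] [NormedSpace ℝ G]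
    {H : G × Rn n → ℝ} {q : G × Rn n} (m : ℕ) (hH : ContDiffAt ℝ ((m + 2 : ℕ) : WithTop ℕ∞) H q) :
    ContDiffAt ℝ m (fun q : G × Rn n => lap n (fun w => H (q.1, w)) q.2) q := by
  have hslice : ∀ (g : G) (w : Rn n) (K : G × Rn n → ℝ) (i : Fin n),
      DifferentiableAt ℝ K (g, w) →
      fderiv ℝ (fun w => K (g, w)) w (basisVec i) = fderiv ℝ K (g, w) (0, basisVec i) := by
    intro g w K i hK
    have h1 : HasFDerivAt (fun w : Rn n => (g, w)) (ContinuousLinearMap.inr ℝ G (Rn n)) w :=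
      hasFDerivAt_prodMk_right g w
    have h2 := (HasFDerivAt.comp w (hK.hasFDerivAt) h1).fderiv
    have h3 : fderiv ℝ (fun w => K (g, w)) w
      = (fderiv ℝ K (g, w)).comp (ContinuousLinearMap.inr ℝ G (Rn n)) := h2
    rw [h3]
    simp
  have hev : ∀ᶠ r in 𝓝 q, ContDiffAt ℝ ((m + 2 : ℕ) : WithTop ℕ∞) H r :=
    hH.eventually (by generalize m + 2 = k; simp)
  have h1 : (fun q : G × Rn n => lap n (fun w => H (q.1, w)) q.2) =ᶠ[𝓝 q]
      fun r => ∑ i : Fin n,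
        fderiv ℝ (fun r => fderiv ℝ H r (0, basisVec i)) r (0, basisVec i) := by
    filter_upwards [hev.eventually_nhds] with r hr
    have hr0 := hr.self_of_nhds
    have hsl : ContDiffAt ℝ 2 (fun w => H (r.1, w)) r.2 := by
      have h0 : ContDiffAt ℝ 2 (fun w : Rn n => (r.1, w)) r.2 := by fun_prop
      have h1 : ContDiffAt ℝ 2 H (r.1, r.2) := hr0.of_le (by
        have : ((2 : ℕ) : WithTop ℕ∞) ≤ ((m + 2 : ℕ) : WithTop ℕ∞) := by
          exact_mod_cast Nat.le_add_left 2 m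
        exact_mod_cast this)
      exact ContDiffAt.comp r.2 h1 h0
    rw [lap_eq_sum_fderiv hsl]
    refine Finset.sum_congr rfl fun i _ => ?_
    have hcont : Tendsto (fun w : Rn n => (r.1, w)) (𝓝 r.2) (𝓝 r) :=
      (Continuous.prodMk_right r.1).tendsto r.2
    have h2 : (fun w => fderiv ℝ (fun w => H (r.1, w)) w (basisVec i)) =ᶠ[𝓝 r.2]
        fun w => (fun r => fderiv ℝ H r (0, basisVec i)) (r.1, w) := by
      filter_upwards [hcont.eventually hr] with w hw
      exact hslice _ _ _ _ (hw.differentiableAt (by simp))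
    rw [h2.fderiv_eq]
    apply hslice r.1 r.2 (fun r => fderiv ℝ H r (0, basisVec i)) i
    have : ContDiffAt ℝ 1 (fderiv ℝ H) r := hr0.fderiv_right (by
      have : ((1 + 1 : ℕ) : WithTop ℕ∞) ≤ ((m + 2 : ℕ) : WithTop ℕ∞) := by
        exact_mod_cast Nat.le_add_left 2 m
      exact_mod_cast this)
    exact (this.clm_apply contDiffAt_const).differentiableAt (by norm_num)
  refine ContDiffAt.congr_of_eventuallyEq ?_ h1
  refine ContDiffAt.sum fun i _ => ?_
  have a1 : ContDiffAt ℝ ((m + 1 : ℕ) : WithTop ℕ∞) (fderiv ℝ H) q :=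
    hH.fderiv_right (by push_cast; rw [add_assoc]; norm_num)
  have a2 : ContDiffAt ℝ ((m + 1 : ℕ) : WithTop ℕ∞) (fun r => fderiv ℝ H r (0, basisVec i)) q :=
    a1.clm_apply contDiffAt_const
  have a3 : ContDiffAt ℝ m (fderiv ℝ (fun r => fderiv ℝ H r ((0 : G), basisVec i))) q :=
    a2.fderiv_right (by push_cast; exact le_rfl)
  exact a3.clm_apply contDiffAt_const

lemma contDiffAt_lap (m : ℕ) (hu : ContDiffAt ℝ ((m + 2 : ℕ) : WithTop ℕ∞) u x) :
    ContDiffAt ℝ m (lap n u) x := by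
  have h := contDiffAt_lap_param (G := ℝ) (H := fun q => u q.2) (q := (0, x)) m
    (ContDiffAt.comp (0, x) hu contDiffAt_snd)
  exact ContDiffAt.comp x (g := fun q : ℝ × Rn n => lap n (fun w => u w) q.2)
    (f := fun w => ((0 : ℝ), w)) h (by fun_prop)

lemma contDiffAt_biLap_param {G : Type*} [NormedAddCommGroup G] [NormedSpace ℝ G]
    {H : G × Rn n → ℝ} {q : G × Rn n} (m : ℕ) (hH : ContDiffAt ℝ ((m + 4 : ℕ) : WithTop ℕ∞) H q) :
    ContDiffAt ℝ m (fun q : G × Rn n => biLap n (fun w => H (q.1, w)) q.2) q :=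
  contDiffAt_lap_param (H := fun q : G × Rn n => lap n (fun w => H (q.1, w)) q.2) m
    (contDiffAt_lap_param (m + 2) hH)

lemma contDiffAt_biLap (m : ℕ) (hu : ContDiffAt ℝ ((m + 4 : ℕ) : WithTop ℕ∞) u x) :
    ContDiffAt ℝ m (biLap n u) x :=
  contDiffAt_lap m (contDiffAt_lap (m + 2) hu)

/-- The Laplacian of a function of the squared distance to a point. -/
lemma lap_comp_normSq {h h' : ℝ → ℝ} {h'' : ℝ} {c : Rn n}
    (hd : ∀ᶠ q in 𝓝 (‖x - c‖ ^ 2), HasDerivAt h (h' q) q)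
    (hd' : HasDerivAt h' h'' (‖x - c‖ ^ 2)) :
    lap n (fun y => h (‖y - c‖ ^ 2)) x
      = 4 * ‖x - c‖ ^ 2 * h'' + 2 * n * h' (‖x - c‖ ^ 2) := by
  have hsq : ∀ (i : Fin n) (s : ℝ), ‖x + s • basisVec i - c‖ ^ 2
      = ‖x - c‖ ^ 2 + 2 * (x - c) i * s + s ^ 2 := by
    intro i s
    have : x + s • basisVec i - c = (x - c) + s • basisVec i := by abel
    rw [this, norm_add_sq_real, inner_smul_right, norm_smul]
    simp only [basisVec, EuclideanSpace.inner_single_right, PiLp.norm_single]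
    simp
    ring
  have key : ∀ i : Fin n,
      iteratedDeriv 2 (fun s : ℝ => h (‖x + s • EuclideanSpace.single i (1 : ℝ) - c‖ ^ 2)) 0
        = 4 * ((x - c) i) ^ 2 * h'' + 2 * h' (‖x - c‖ ^ 2) := by
    intro i
    rw [iteratedDeriv_succ, iteratedDeriv_one]
    set Q : ℝ → ℝ := fun s => ‖x - c‖ ^ 2 + 2 * (x - c) i * s + s ^ 2 with hQ
    have hQd : ∀ s, HasDerivAt Q (2 * (x - c) i + 2 * s) s := by
      intro s
      have h1 := (((hasDerivAt_id s).const_mul (2 * (x - c) i)).const_add (‖x - c‖ ^ 2)).add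
        (hasDerivAt_pow 2 s)
      exact h1.congr_deriv (by norm_num)
    have hQ0 : Q 0 = ‖x - c‖ ^ 2 := by simp [hQ]
    have hQt : Tendsto Q (𝓝 0) (𝓝 (‖x - c‖ ^ 2)) := by
      rw [← hQ0]; exact (hQd 0).continuousAt
    have e1 : (fun s : ℝ => h (‖x + s • EuclideanSpace.single i (1 : ℝ) - c‖ ^ 2))
        = fun s => h (Q s) := by
      funext s
      exact congrArg h (hsq i s)
    rw [e1]
    have e2 : deriv (fun s => h (Q s)) =ᶠ[𝓝 0] fun s => h' (Q s) * (2 * (x - c) i + 2 * s) := by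
      filter_upwards [hQt.eventually hd] with s hs
      exact (hs.comp s (hQd s)).deriv
    rw [e2.deriv_eq]
    have h3 : HasDerivAt (fun s => h' (Q s)) (h'' * (2 * (x - c) i + 2 * 0)) 0 := by
      have : HasDerivAt h' h'' (Q 0) := by rw [hQ0]; exact hd'
      exact this.comp 0 (hQd 0)
    have h4 : HasDerivAt (fun s : ℝ => 2 * (x - c) i + 2 * s) 2 0 := by
      simpa using ((hasDerivAt_id (0 : ℝ)).const_mul 2).const_add (2 * (x - c) i)
    have h5 := (h3.mul h4).deriv
    rw [hQ0] at h5
    refine Eq.trans h5 ?_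
    ring
  unfold lap
  rw [Finset.sum_congr rfl fun i _ => key i, Finset.sum_add_distrib, EuclideanSpace.norm_sq_eq,
    ← Finset.sum_mul, ← Finset.mul_sum]
  simp
  ring

end Laplacian

section TestFunctions

variable {n : ℕ}

lemma lap_eq_zero_of_eventuallyEq {φ : Rn n → ℝ} {x : Rn n} (h : φ =ᶠ[𝓝 x] fun _ => 0) :
    lap n φ x = 0 := by
  rw [lap_congr h]
  simp [lap]

lemma biLap_eq_zero_of_eventuallyEq {φ : Rn n → ℝ} {x : Rn n} (h : φ =ᶠ[𝓝 x] fun _ => 0) :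
    biLap n φ x = 0 := by
  refine lap_eq_zero_of_eventuallyEq ?_
  filter_upwards [h.eventuallyEq_nhds] with y hy using lap_eq_zero_of_eventuallyEq hy

lemma hasCompactSupport_lap {φ : Rn n → ℝ} (h : HasCompactSupport φ) :
    HasCompactSupport (lap n φ) := by
  refine h.mono' fun x hx => ?_
  by_contra hn
  exact hx (lap_eq_zero_of_eventuallyEq (notMem_tsupport_iff_eventuallyEq.1 hn))

lemma contDiff_lap {φ : Rn n → ℝ} (m : ℕ) (h : ContDiff ℝ ((m + 2 : ℕ) : WithTop ℕ∞) φ) :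
    ContDiff ℝ m (lap n φ) :=
  contDiff_iff_contDiffAt.2 fun _ => contDiffAt_lap m h.contDiffAt

lemma continuous_biLap {φ : Rn n → ℝ} (h : ContDiff ℝ 4 φ) : Continuous (biLap n φ) :=
  (contDiff_lap 0 (contDiff_lap 2 (by exact_mod_cast h))).continuous

/-- Green's second identity, one of the functions having compact support. -/
lemma integral_mul_lap {f g : Rn n → ℝ} (hf : ContDiff ℝ 2 f) (hg : ContDiff ℝ 2 g)
    (hc : HasCompactSupport g) :
    ∫ x, f x * lap n g x = ∫ x, lap n f x * g x := by
  have d1 : ∀ {h : Rn n → ℝ} (_ : ContDiff ℝ 2 h) (i : Fin n),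
      ContDiff ℝ 1 (fun y => fderiv ℝ h y (basisVec i)) := fun hh i =>
    (hh.fderiv_right (by norm_num)).clm_apply contDiff_const
  have d2 : ∀ {h : Rn n → ℝ} (_ : ContDiff ℝ 2 h) (i : Fin n),
      Continuous (fun x => fderiv ℝ (fun y => fderiv ℝ h y (basisVec i)) x (basisVec i)) :=
    fun hh i => ((d1 hh i).continuous_fderiv (by norm_num)).clm_apply continuous_const
  have c1 : ∀ i : Fin n, HasCompactSupport (fun y => fderiv ℝ g y (basisVec i)) := fun i =>
    hc.fderiv_apply ℝ _
  have c2 : ∀ i : Fin n, HasCompactSupport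
      (fun x => fderiv ℝ (fun y => fderiv ℝ g y (basisVec i)) x (basisVec i)) := fun i =>
    (c1 i).fderiv_apply ℝ _
  have key : ∀ i : Fin n,
      ∫ x, f x * fderiv ℝ (fun y => fderiv ℝ g y (basisVec i)) x (basisVec i)
        = ∫ x, fderiv ℝ (fun y => fderiv ℝ f y (basisVec i)) x (basisVec i) * g x := by
    intro i
    have e1 := integral_mul_fderiv_eq_neg_fderiv_mul_of_integrable (μ := volume) (f := f)
      (g := fun y => fderiv ℝ g y (basisVec i)) (v := basisVec i)
      (((d1 hf i).continuous.mul (d1 hg i).continuous).integrable_of_hasCompactSupport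
        (c1 i).mul_left)
      ((hf.continuous.mul (d2 hg i)).integrable_of_hasCompactSupport (c2 i).mul_left)
      ((hf.continuous.mul (d1 hg i).continuous).integrable_of_hasCompactSupport (c1 i).mul_left)
      (fun x _ => hf.differentiable (by norm_num) x)
      (fun x _ => (d1 hg i).differentiable (by norm_num) x)
    have e2 := integral_mul_fderiv_eq_neg_fderiv_mul_of_integrable (μ := volume)
      (f := fun y => fderiv ℝ f y (basisVec i)) (g := g) (v := basisVec i)
      (((d2 hf i).mul hg.continuous).integrable_of_hasCompactSupport hc.mul_left)
      (((d1 hf i).continuous.mul (d1 hg i).continuous).integrable_of_hasCompactSupport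
        (c1 i).mul_left)
      (((d1 hf i).continuous.mul hg.continuous).integrable_of_hasCompactSupport hc.mul_left)
      (fun x _ => (d1 hf i).differentiable (by norm_num) x)
      (fun x _ => hg.differentiable (by norm_num) x)
    rw [e1, e2, neg_neg]
  have l1 : ∀ x, f x * lap n g x
      = ∑ i : Fin n, f x * fderiv ℝ (fun y => fderiv ℝ g y (basisVec i)) x (basisVec i) := by
    intro x
    rw [lap_eq_sum_fderiv hg.contDiffAt, Finset.mul_sum]
  have l2 : ∀ x, lap n f x * g x
      = ∑ i : Fin n, fderiv ℝ (fun y => fderiv ℝ f y (basisVec i)) x (basisVec i) * g x := by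
    intro x
    rw [lap_eq_sum_fderiv hf.contDiffAt, Finset.sum_mul]
  simp_rw [l1, l2]
  rw [integral_finsetSum, integral_finsetSum]
  · exact Finset.sum_congr rfl fun i _ => key i
  · intro i _
    exact ((d2 hf i).mul hg.continuous).integrable_of_hasCompactSupport hc.mul_left
  · intro i _
    exact (hf.continuous.mul (d2 hg i)).integrable_of_hasCompactSupport (c2 i).mul_left

lemma integral_mul_biLap {f g : Rn n → ℝ} (hf : ContDiff ℝ 4 f) (hg : ContDiff ℝ 4 g)
    (hc : HasCompactSupport g) :
    ∫ x, f x * biLap n g x = ∫ x, biLap n f x * g x := by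
  have hlf : ContDiff ℝ 2 (lap n f) := contDiff_lap 2 (by exact_mod_cast hf)
  have hlg : ContDiff ℝ 2 (lap n g) := contDiff_lap 2 (by exact_mod_cast hg)
  have h1 := integral_mul_lap (hf.of_le (by norm_num)) hlg (hasCompactSupport_lap hc)
  have h2 := integral_mul_lap hlf (hg.of_le (by norm_num)) hc
  exact h1.trans h2

/-- A radial cutoff vanishing on the unit ball and equal to one off the ball of radius two. -/
noncomputable def cut (y : Rn n) : ℝ := Real.smoothTransition ((‖y‖ ^ 2 - 1) / 3)

lemma contDiff_cut {m : ℕ∞} : ContDiff ℝ m (cut (n := n)) :=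
  Real.smoothTransition.contDiff.comp (((contDiff_norm_sq ℝ).sub contDiff_const).div_const 3)

lemma cut_eq_zero {y : Rn n} (h : ‖y‖ ≤ 1) : cut y = 0 :=
  Real.smoothTransition.zero_of_nonpos (by nlinarith [norm_nonneg y])

lemma cut_eq_one {y : Rn n} (h : 2 ≤ ‖y‖) : cut y = 1 :=
  Real.smoothTransition.one_of_one_le (by nlinarith [norm_nonneg y])

lemma cut_nonneg (y : Rn n) : 0 ≤ cut y := Real.smoothTransition.nonneg _

lemma cut_le_one (y : Rn n) : cut y ≤ 1 := Real.smoothTransition.le_one _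

lemma cut_mono {y z : Rn n} (h : ‖y‖ ≤ ‖z‖) : cut y ≤ cut z := by
  refine Real.smoothTransition.monotone ?_
  have : ‖y‖ ^ 2 ≤ ‖z‖ ^ 2 := pow_le_pow_left₀ (norm_nonneg y) h 2
  linarith

lemma continuous_mul_of_vanish {u g : Rn n → ℝ} (hu : ContinuousOn u {x | x ≠ 0})
    (hg : Continuous g) {ε : ℝ} (hε : 0 < ε) (h0 : ∀ y, ‖y‖ < ε → g y = 0) :
    Continuous (fun y => u y * g y) := by
  rw [continuous_iff_continuousAt]
  intro y
  by_cases hy : y = 0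
  · subst hy
    have : (fun y => u y * g y) =ᶠ[𝓝 (0 : Rn n)] fun _ => 0 := by
      filter_upwards [Metric.ball_mem_nhds (0 : Rn n) hε] with y hy
      rw [h0 y (by simpa using hy), mul_zero]
    exact continuousAt_const.congr this.symm
  · exact (hu.continuousAt (isOpen_ne.mem_nhds hy)).mul hg.continuousAt

lemma contDiff_mul_of_vanish {u g : Rn n → ℝ} (hu : ContDiffOn ℝ 4 u {x | x ≠ 0})
    (hg : ContDiff ℝ 4 g) {ε : ℝ} (hε : 0 < ε) (h0 : ∀ y, ‖y‖ < ε → g y = 0) :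
    ContDiff ℝ 4 (fun y => u y * g y) := by
  rw [contDiff_iff_contDiffAt]
  intro y
  by_cases hy : y = 0
  · subst hy
    have : (fun y => u y * g y) =ᶠ[𝓝 (0 : Rn n)] fun _ => 0 := by
      filter_upwards [Metric.ball_mem_nhds (0 : Rn n) hε] with y hy
      rw [h0 y (by simpa using hy), mul_zero]
    exact contDiffAt_const.congr_of_eventuallyEq this
  · exact (hu.contDiffAt (isOpen_ne.mem_nhds hy)).mul hg.contDiffAt

/-- Integration by parts against test functions supported away from the origin. -/
lemma integral_mul_biLap_of_vanish {u φ : Rn n → ℝ} (hu : ContDiffOn ℝ 4 u {x | x ≠ 0})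
    (hφ : ContDiff ℝ 4 φ) (hc : HasCompactSupport φ) {ε : ℝ} (hε : 0 < ε)
    (h0 : ∀ y, ‖y‖ < ε → φ y = 0) :
    ∫ y, u y * biLap n φ y = ∫ y, biLap n u y * φ y := by
  set ψ : Rn n → ℝ := fun y => cut ((4 / ε) • y) with hψ
  have hnorm : ∀ y : Rn n, ‖(4 / ε) • y‖ = 4 / ε * ‖y‖ := fun y => by
    rw [norm_smul, Real.norm_of_nonneg (by positivity)]
  have hψc : ContDiff ℝ 4 ψ := (contDiff_cut (m := 4)).comp (contDiff_const_smul _)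
  have hψ1 : ∀ y, ε / 2 ≤ ‖y‖ → ψ y = 1 := fun y hy => cut_eq_one (by
    rw [hnorm, div_mul_eq_mul_div, le_div_iff₀ hε]; linarith)
  have hψ0 : ∀ y, ‖y‖ < ε / 4 → ψ y = 0 := fun y hy => cut_eq_zero (by
    rw [hnorm, div_mul_eq_mul_div, div_le_iff₀ hε]; linarith)
  have hw := contDiff_mul_of_vanish hu hψc (by positivity : 0 < ε / 4) hψ0
  have h := integral_mul_biLap hw hφ hc
  have e1 : ∀ y, u y * biLap n φ y = u y * ψ y * biLap n φ y := by
    intro y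
    by_cases hy : ‖y‖ < ε
    · rw [biLap_eq_zero_of_eventuallyEq]
      · simp
      · filter_upwards [(isOpen_lt continuous_norm continuous_const).mem_nhds hy] with z hz
          using h0 z hz
    · rw [hψ1 y (by linarith), mul_one]
  have e2 : ∀ y, biLap n u y * φ y = biLap n (fun y => u y * ψ y) y * φ y := by
    intro y
    by_cases hy : ‖y‖ < ε
    · rw [h0 y hy]; simp
    · congr 1
      refine biLap_congr ?_
      filter_upwards [(isOpen_lt continuous_const continuous_norm).mem_nhds
        (show ε / 2 < ‖y‖ by linarith)] with z hz
      rw [hψ1 z (le_of_lt hz), mul_one]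
  simp_rw [e1, e2]
  exact h

lemma exists_fderiv_pow_mul {η S : Rn n → ℝ} (hη : ContDiff ℝ ∞ η) (hS : ContDiff ℝ ∞ S)
    (k : ℕ) (e : Rn n) : ∃ T : Rn n → ℝ, ContDiff ℝ ∞ T ∧
      ∀ y, fderiv ℝ (fun y => η y ^ (k + 1) * S y) y e = η y ^ k * T y := by
  refine ⟨fun y => (k + 1) * fderiv ℝ η y e * S y + η y * fderiv ℝ S y e, ?_, fun y => ?_⟩
  · have h1 : ContDiff ℝ ∞ (fun y => fderiv ℝ η y e) :=
      (hη.fderiv_right (by simp)).clm_apply contDiff_const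
    have h2 : ContDiff ℝ ∞ (fun y => fderiv ℝ S y e) :=
      (hS.fderiv_right (by simp)).clm_apply contDiff_const
    exact ((contDiff_const.mul h1).mul hS).add (hη.mul h2)
  · have a1 := ((hη.differentiable (by simp) y).hasFDerivAt.pow (k + 1)).mul
      (hS.differentiable (by simp) y).hasFDerivAt
    have a2 : fderiv ℝ (fun y => η y ^ (k + 1) * S y) y = _ := a1.fderiv
    rw [a2]
    simp
    ring

lemma exists_lap_pow_mul {η S : Rn n → ℝ} (hη : ContDiff ℝ ∞ η) (hS : ContDiff ℝ ∞ S)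
    (k : ℕ) : ∃ T : Rn n → ℝ, ContDiff ℝ ∞ T ∧
      lap n (fun y => η y ^ (k + 2) * S y) = fun y => η y ^ k * T y := by
  choose T1 hT1 h1 using fun i : Fin n => exists_fderiv_pow_mul hη hS (k + 1) (basisVec i)
  choose T2 hT2 h2 using fun i : Fin n => exists_fderiv_pow_mul hη (hT1 i) k (basisVec i)
  refine ⟨fun y => ∑ i, T2 i y, ContDiff.sum fun i _ => hT2 i, ?_⟩
  funext y
  have hc : ContDiff ℝ ∞ (fun y => η y ^ (k + 2) * S y) := (hη.pow _).mul hS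
  rw [lap_eq_sum_fderiv (hc.contDiffAt.of_le (WithTop.coe_le_coe.2 (le_top : (2 : ℕ∞) ≤ ⊤))),
      Finset.mul_sum]
  refine Finset.sum_congr rfl fun i _ => ?_
  rw [← h2 i y]
  congr 2
  funext z
  exact h1 i z

lemma exists_biLap_pow {η : Rn n → ℝ} (hη : ContDiff ℝ ∞ η) (k : ℕ) :
    ∃ T : Rn n → ℝ, ContDiff ℝ ∞ T ∧
      biLap n (fun y => η y ^ (k + 4)) = fun y => η y ^ k * T y := by
  obtain ⟨T1, hT1, h1⟩ := exists_lap_pow_mul hη (contDiff_const (c := (1 : ℝ))) (k + 2)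
  obtain ⟨T2, hT2, h2⟩ := exists_lap_pow_mul hη hT1 k
  refine ⟨T2, hT2, ?_⟩
  simp only [mul_one] at h1
  unfold biLap
  rw [h1, h2]

end TestFunctions

/-- A positive classical solution of the critical biharmonic equation off the origin. -/
structure PuncturedSolution (n : ℕ) (u : Rn n → ℝ) : Prop where
  five_le : 5 ≤ n
  contDiffOn : ContDiffOn ℝ 4 u {x | x ≠ 0}
  pos : ∀ x, x ≠ 0 → 0 < u x
  eq : ∀ x, x ≠ 0 → biLap n u x = u x ^ (((n : ℝ) + 4) / ((n : ℝ) - 4))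

lemma exponent_sub_pos {n : ℕ} (hn : 5 ≤ n) : (1 : ℝ) ≤ n - 4 := by
  have : (5 : ℝ) ≤ n := by exact_mod_cast hn
  linarith

namespace PuncturedSolution

variable {n : ℕ} {u : Rn n → ℝ}

lemma continuousOn (hu : PuncturedSolution n u) : ContinuousOn u {x | x ≠ 0} :=
  hu.contDiffOn.continuousOn

lemma exponent_pos (hu : PuncturedSolution n u) : 0 < ((n : ℝ) + 4) / ((n : ℝ) - 4) := by
  have := exponent_sub_pos hu.five_le
  positivity

lemma continuousOn_rpow (hu : PuncturedSolution n u) :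
    ContinuousOn (fun x => u x ^ (((n : ℝ) + 4) / ((n : ℝ) - 4))) {x | x ≠ 0} :=
  hu.continuousOn.rpow_const fun _ _ => Or.inr hu.exponent_pos.le

/-- The equation tested against a function vanishing near the origin. -/
lemma integral_eq (hu : PuncturedSolution n u) {φ : Rn n → ℝ}
    (hφ : ContDiff ℝ 4 φ) (hc : HasCompactSupport φ) {ε : ℝ} (hε : 0 < ε)
    (h0 : ∀ y, ‖y‖ < ε → φ y = 0) :
    ∫ y, u y ^ (((n : ℝ) + 4) / ((n : ℝ) - 4)) * φ y = ∫ y, u y * biLap n φ y := by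
  rw [integral_mul_biLap_of_vanish hu.contDiffOn hφ hc hε h0]
  refine integral_congr_ae (Eventually.of_forall fun y => ?_)
  by_cases hy : y = 0
  · simp [h0 y (by simpa [hy] using hε)]
  · simp only [hu.eq y hy]

end PuncturedSolution

section Annulus

variable {n : ℕ} {u : Rn n → ℝ}

/-- A bump function adapted to the annulus `1 ≤ ‖y‖ ≤ 2`. -/
noncomputable def annBump (y : Rn n) : ℝ := cut ((2 : ℝ) • y) * (1 - cut ((1 / 2 : ℝ) • y))

lemma contDiff_annBump {m : ℕ∞} : ContDiff ℝ m (annBump (n := n)) :=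
  (contDiff_cut.comp (contDiff_const_smul (2 : ℝ))).mul
    (contDiff_const.sub (contDiff_cut.comp (contDiff_const_smul (1 / 2 : ℝ))))

lemma annBump_nonneg (y : Rn n) : 0 ≤ annBump y :=
  mul_nonneg (cut_nonneg _) (by linarith [cut_le_one ((1 / 2 : ℝ) • y)])

lemma annBump_le_one (y : Rn n) : annBump y ≤ 1 := by
  have h1 := cut_le_one ((2 : ℝ) • y)
  have h2 := cut_nonneg ((1 / 2 : ℝ) • y)
  have h3 := cut_nonneg ((2 : ℝ) • y)
  unfold annBump
  nlinarith

lemma annBump_eq_zero_of_le {y : Rn n} (h : ‖y‖ ≤ 1 / 2) : annBump y = 0 := by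
  have : cut ((2 : ℝ) • y) = 0 := cut_eq_zero (by rw [norm_smul]; norm_num; linarith)
  simp [annBump, this]

lemma annBump_eq_zero_of_ge {y : Rn n} (h : 4 ≤ ‖y‖) : annBump y = 0 := by
  have : cut ((1 / 2 : ℝ) • y) = 1 := cut_eq_one (by rw [norm_smul]; norm_num; linarith)
  simp only [annBump, this, sub_self, mul_zero]

lemma annBump_eq_one {y : Rn n} (h1 : 1 ≤ ‖y‖) (h2 : ‖y‖ ≤ 2) : annBump y = 1 := by
  have h3 : cut ((2 : ℝ) • y) = 1 := cut_eq_one (by rw [norm_smul]; norm_num; linarith)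
  have h4 : cut ((1 / 2 : ℝ) • y) = 0 := cut_eq_zero (by rw [norm_smul]; norm_num; linarith)
  simp only [annBump, h3, h4, sub_zero, mul_one]

lemma hasCompactSupport_annBump_smul {r : ℝ} (hr : 0 < r) :
    HasCompactSupport (fun y : Rn n => annBump (r⁻¹ • y)) := by
  refine HasCompactSupport.of_support_subset_isCompact (isCompact_closedBall 0 (4 * r)) ?_
  intro y hy
  rw [mem_closedBall_zero_iff]
  by_contra h
  refine hy (annBump_eq_zero_of_ge ?_)
  rw [norm_smul, norm_inv, Real.norm_of_nonneg hr.le, inv_mul_eq_div, le_div_iff₀ hr]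
  linarith

lemma annBump_smul_eq_zero {r : ℝ} (hr : 0 < r) {y : Rn n} (h : ‖y‖ < r / 2) :
    annBump (r⁻¹ • y) = 0 := by
  refine annBump_eq_zero_of_le ?_
  rw [norm_smul, norm_inv, Real.norm_of_nonneg hr.le, inv_mul_eq_div, div_le_iff₀ hr]
  linarith

/-- The bi-Laplacian of a high power of the bump function is controlled by a lower power. -/
lemma exists_abs_biLap_annBump_le (m : ℕ) : ∃ K : ℝ, 0 < K ∧ ∀ y : Rn n,
    |biLap n (fun y => annBump y ^ (m + 8)) y| ≤ K * annBump y ^ m := by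
  obtain ⟨T, hT, h⟩ := exists_biLap_pow (n := n) contDiff_annBump (m + 4)
  obtain ⟨K, hK⟩ := (isCompact_closedBall (0 : Rn n) 4).exists_bound_of_continuousOn
    hT.continuous.continuousOn
  refine ⟨max K 1, by positivity, fun y => ?_⟩
  have h' : biLap n (fun y => annBump y ^ (m + 8)) y = annBump y ^ (m + 4) * T y := congrFun h y
  rw [h', abs_mul, abs_of_nonneg (pow_nonneg (annBump_nonneg y) _)]
  by_cases hy : ‖y‖ ≤ 4
  · have h1 : |T y| ≤ max K 1 := (hK y (by simpa using hy)).trans (le_max_left _ _)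
    have h2 : annBump y ^ (m + 4) ≤ annBump y ^ m :=
      pow_le_pow_of_le_one (annBump_nonneg y) (annBump_le_one y) (by omega)
    calc annBump y ^ (m + 4) * |T y| ≤ annBump y ^ m * max K 1 :=
          mul_le_mul h2 h1 (abs_nonneg _) (pow_nonneg (annBump_nonneg y) _)
      _ = _ := mul_comm _ _
  · rw [annBump_eq_zero_of_ge (not_le.1 hy).le, zero_pow (by omega), zero_mul]
    positivity

/-- An elementary form of Young's inequality. -/
lemma le_add_rpow_mul {M s q : ℝ} (hM : 0 < M) (hs : 0 ≤ s) (hq : 1 ≤ q) :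
    s ≤ M + M ^ (1 - q) * s ^ q := by
  rcases le_total s M with h | h
  · have : 0 ≤ M ^ (1 - q) * s ^ q := by positivity
    linarith
  · have hs0 : 0 < s := hM.trans_le h
    have h1 : s ^ (1 - q) ≤ M ^ (1 - q) := Real.rpow_le_rpow_of_nonpos hM h (by linarith)
    have h2 : s ^ (1 - q) * s ^ q = s := by rw [← Real.rpow_add hs0]; simp
    have h3 : s ^ (1 - q) * s ^ q ≤ M ^ (1 - q) * s ^ q :=
      mul_le_mul_of_nonneg_right h1 (by positivity)
    linarith

theorem PuncturedSolution.exists_annulus_bound (hu : PuncturedSolution n u) :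
    ∃ C : ℝ, 0 < C ∧ ∀ r : ℝ, 0 < r →
      ∫⁻ y in {y : Rn n | r ≤ ‖y‖ ∧ ‖y‖ ≤ 2 * r}, ENNReal.ofReal (u y)
        ≤ ENNReal.ofReal (C * r ^ (((n : ℝ) + 4) / 2)) := by
  obtain ⟨m, hm⟩ : ∃ m, n = m + 4 := ⟨n - 4, by have := hu.five_le; omega⟩
  have hmn : (n : ℝ) - 4 = m := by rw [hm]; push_cast; ring
  have hm1 : (1 : ℝ) ≤ m := hmn ▸ exponent_sub_pos hu.five_le
  set q : ℝ := ((n : ℝ) + 4) / ((n : ℝ) - 4) with hq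
  have hq' : q = 1 + 8 / m := by
    rw [hq, hmn, show (n : ℝ) = m + 4 by linarith]; field_simp; ring
  have hmq : (m : ℝ) * q = (m + 8 : ℕ) := by rw [hq']; push_cast; field_simp
  have hq1 : 1 ≤ q := by rw [hq']; have : 0 ≤ 8 / (m : ℝ) := by positivity
                         linarith
  obtain ⟨K, hK, hKb⟩ := exists_abs_biLap_annBump_le (n := n) m
  set V : ℝ := (volume (Metric.ball (0 : Rn n) 1)).toReal with hV
  have hV0 : 0 < V := ENNReal.toReal_pos (Metric.measure_ball_pos _ _ one_pos).ne'
    measure_ball_lt_top.ne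
  refine ⟨2 * (2 * K) ^ ((m : ℝ) / 8) * (4 ^ n * V), by positivity, fun r hr => ?_⟩
  set η : Rn n → ℝ := fun y => annBump (r⁻¹ • y) with hη
  have hη4 : ∀ k : ℕ, ContDiff ℝ 4 (fun y => η y ^ k) := fun k =>
    ((contDiff_annBump (m := 4)).comp (contDiff_const_smul r⁻¹)).pow k
  have hcs : ∀ k : ℕ, HasCompactSupport (fun y => η y ^ (k + 1)) := fun k =>
    (hasCompactSupport_annBump_smul hr).comp_left (g := fun s : ℝ => s ^ (k + 1)) (by simp)
  have hz : ∀ k : ℕ, ∀ y, ‖y‖ < r / 2 → η y ^ (k + 1) = 0 := fun k y hy => by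
    simp [hη, annBump_smul_eq_zero hr hy]
  obtain ⟨j, rfl⟩ : ∃ j, m = j + 1 := ⟨m - 1, by
    have : 1 ≤ m := by exact_mod_cast hm1
    omega⟩
  set s : Rn n → ℝ := fun y => u y * η y ^ (j + 1) with hs
  have hs0 : ∀ y, 0 ≤ s y := fun y => by
    by_cases hy : y = 0
    · simp [hs, hη, hy, annBump_eq_zero_of_le]
    · exact mul_nonneg (hu.pos y hy).le (pow_nonneg (annBump_nonneg _) _)
  have hsq : ∀ y, s y ^ q = u y ^ q * η y ^ (j + 1 + 8) := fun y => by
    by_cases hy : y = 0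
    · simp [hs, hη, hy, annBump_eq_zero_of_le, hu.exponent_pos.ne', hq]
    · have h0 : 0 ≤ η y := annBump_nonneg _
      rw [hs, Real.mul_rpow (hu.pos y hy).le (pow_nonneg h0 _), ← Real.rpow_natCast,
        ← Real.rpow_mul h0, hmq, Real.rpow_natCast]
  have hsc : Continuous s :=
    continuous_mul_of_vanish hu.continuousOn (hη4 _).continuous (half_pos hr) (hz j)
  have hscs : HasCompactSupport s := (hcs j).mul_left
  have hsi : Integrable s := hsc.integrable_of_hasCompactSupport hscs
  have hsqi : Integrable (fun y => s y ^ q) := by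
    refine (hsc.rpow_const fun _ => Or.inr (by linarith)).integrable_of_hasCompactSupport ?_
    exact hscs.comp_left (g := fun t : ℝ => t ^ q) (Real.zero_rpow (by linarith))
  have hbl : ∀ y, |biLap n (fun y => η y ^ (j + 1 + 8)) y| ≤ K * r⁻¹ ^ 4 * η y ^ (j + 1) := by
    intro y
    have := biLap_comp_smul r⁻¹ (fun y : Rn n => annBump y ^ (j + 1 + 8)) y
    rw [hη, this, abs_mul, abs_of_nonneg (by positivity), mul_comm K, mul_assoc]
    exact mul_le_mul_of_nonneg_left (hKb _) (by positivity)
  have hY : ∫ y, s y ^ q ≤ K * r⁻¹ ^ 4 * ∫ y, s y := by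
    have h1 := hu.integral_eq (hη4 (j + 1 + 8)) (hcs (j + 8)) (half_pos hr) (hz (j + 8))
    simp_rw [hsq]
    rw [h1, ← integral_const_mul]
    refine (Real.le_norm_self _).trans (norm_integral_le_of_norm_le (hsi.const_mul (K * r⁻¹ ^ 4))
      (Eventually.of_forall fun y => ?_))
    by_cases hy : y = 0
    · have h3 : η y ^ (j + 1) = 0 := hz j y (by simpa [hy] using hr)
      have h2 := hbl y
      rw [h3, mul_zero] at h2
      rw [abs_nonpos_iff.1 h2]
      simpa using mul_nonneg (by positivity) (hs0 y)
    · rw [Real.norm_eq_abs, abs_mul, abs_of_pos (hu.pos y hy)]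
      calc u y * _ ≤ u y * (K * r⁻¹ ^ 4 * η y ^ (j + 1)) :=
            mul_le_mul_of_nonneg_left (hbl y) (hu.pos y hy).le
        _ = K * r⁻¹ ^ 4 * s y := by rw [hs]; ring
  set M : ℝ := (2 * K * r⁻¹ ^ 4) ^ (((j + 1 : ℕ) : ℝ) / 8) with hM
  have hM0 : 0 < M := by positivity
  have hMq : M ^ (1 - q) * (K * r⁻¹ ^ 4) = 1 / 2 := by
    rw [hM, ← Real.rpow_mul (by positivity), hq', show ((j + 1 : ℕ) : ℝ) / 8
      * (1 - (1 + 8 / ((j + 1 : ℕ) : ℝ))) = -1 by field_simp; ring, Real.rpow_neg_one]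
    field_simp
  have hMr : M = (2 * K) ^ (((j + 1 : ℕ) : ℝ) / 8) * r ^ (-((j + 1 : ℕ) : ℝ) / 2) := by
    rw [hM, Real.mul_rpow (by positivity) (by positivity), ← Real.rpow_natCast,
      ← Real.rpow_mul (by positivity), Real.inv_rpow hr.le, ← Real.rpow_neg hr.le]
    congr 2
    push_cast
    ring
  have hX : ∫ y, s y ≤ 2 * M * ((4 * r) ^ n * V) := by
    have h1 : ∫ y, s y ≤ ∫ y, ((Metric.closedBall (0 : Rn n) (4 * r)).indicator (fun _ => M) y
        + M ^ (1 - q) * s y ^ q) := by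
      refine integral_mono hsi ?_ fun y => ?_
      · exact (IntegrableOn.integrable_indicator (integrableOn_const measure_closedBall_lt_top.ne)
          Metric.isClosed_closedBall.measurableSet).add (hsqi.const_mul _)
      · by_cases hy : y ∈ Metric.closedBall (0 : Rn n) (4 * r)
        · simp only [indicator_of_mem hy]
          exact le_add_rpow_mul hM0 (hs0 y) hq1
        · have : s y = 0 := by
            have : η y = 0 := by
              refine annBump_eq_zero_of_ge ?_
              rw [norm_smul, norm_inv, Real.norm_of_nonneg hr.le, inv_mul_eq_div, le_div_iff₀ hr]
              rw [mem_closedBall_zero_iff] at hy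
              linarith
            simp [hs, this]
          simp only [indicator_of_notMem hy, this, zero_add]
          positivity
    rw [integral_add (IntegrableOn.integrable_indicator
      (integrableOn_const measure_closedBall_lt_top.ne)
          Metric.isClosed_closedBall.measurableSet) (hsqi.const_mul _), integral_const_mul,
      integral_indicator Metric.isClosed_closedBall.measurableSet, setIntegral_const] at h1
    have h2 : volume.real (Metric.closedBall (0 : Rn n) (4 * r)) = (4 * r) ^ n * V := by
      rw [Measure.real, Measure.addHaar_closedBall _ _ (by positivity), ENNReal.toReal_mul,
        ENNReal.toReal_ofReal (by positivity), finrank_euclideanSpace, Fintype.card_fin]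
    rw [h2, smul_eq_mul] at h1
    have h3 := mul_le_mul_of_nonneg_left hY (Real.rpow_nonneg hM0.le (1 - q))
    rw [← mul_assoc, hMq] at h3
    linarith
  have hmeas : MeasurableSet {y : Rn n | r ≤ ‖y‖ ∧ ‖y‖ ≤ 2 * r} :=
    (measurableSet_le measurable_const measurable_norm).inter
      (measurableSet_le measurable_norm measurable_const)
  calc ∫⁻ y in {y : Rn n | r ≤ ‖y‖ ∧ ‖y‖ ≤ 2 * r}, ENNReal.ofReal (u y)
      ≤ ∫⁻ y in {y : Rn n | r ≤ ‖y‖ ∧ ‖y‖ ≤ 2 * r}, ENNReal.ofReal (s y) := by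
        refine setLIntegral_mono' hmeas fun y hy => ?_
        have : η y = 1 := by
          refine annBump_eq_one ?_ ?_ <;>
          rw [norm_smul, norm_inv, Real.norm_of_nonneg hr.le, inv_mul_eq_div]
          · rw [le_div_iff₀ hr]; linarith [hy.1]
          · rw [div_le_iff₀ hr]; linarith [hy.2]
        simp [hs, this]
    _ ≤ ∫⁻ y, ENNReal.ofReal (s y) := setLIntegral_le_lintegral _ _
    _ = ENNReal.ofReal (∫ y, s y) :=
        (ofReal_integral_eq_lintegral_ofReal hsi (Eventually.of_forall hs0)).symm
    _ ≤ _ := by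
        refine ENNReal.ofReal_le_ofReal (hX.trans (le_of_eq ?_))
        rw [hMr, mul_pow, ← Real.rpow_natCast r n,
          show ((n : ℝ) + 4) / 2 = -((j + 1 : ℕ) : ℝ) / 2 + n by rw [← hmn]; ring,
          Real.rpow_add hr]
        ring

end Annulus

section Bubble

variable {n : ℕ}

lemma lap_bubble {ρ : ℝ} (hρ : 0 < ρ) (x : Rn n) (β : ℝ) (y : Rn n) :
    lap n (fun y => (ρ ^ 2 + ‖y - x‖ ^ 2) ^ β) y
      = β * (4 * β - 4 + 2 * n) * (ρ ^ 2 + ‖y - x‖ ^ 2) ^ (β - 1)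
        - 4 * β * (β - 1) * ρ ^ 2 * (ρ ^ 2 + ‖y - x‖ ^ 2) ^ (β - 2) := by
  have hd : ∀ (γ q : ℝ), 0 < ρ ^ 2 + q → HasDerivAt (fun q : ℝ => (ρ ^ 2 + q) ^ γ)
      (γ * (ρ ^ 2 + q) ^ (γ - 1)) q := fun γ q hq => by
    have := (((hasDerivAt_id q).const_add (ρ ^ 2)).rpow_const (p := γ) (Or.inl hq.ne'))
    exact this.congr_deriv (by simp)
  have hQ : 0 < ρ ^ 2 + ‖y - x‖ ^ 2 := by positivity
  rw [lap_comp_normSq (h := fun q => (ρ ^ 2 + q) ^ β) (h' := fun q => β * (ρ ^ 2 + q) ^ (β - 1))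
    (h'' := β * ((β - 1) * (ρ ^ 2 + ‖y - x‖ ^ 2) ^ (β - 1 - 1))) ?_ ?_]
  · have e1 : (ρ ^ 2 + ‖y - x‖ ^ 2) ^ (β - 1)
        = (ρ ^ 2 + ‖y - x‖ ^ 2) ^ (β - 2) * (ρ ^ 2 + ‖y - x‖ ^ 2) := by
      rw [← Real.rpow_add_one hQ.ne']; congr 1; ring
    rw [show β - 1 - 1 = β - 2 by ring, e1]
    ring
  · have : ∀ᶠ q in 𝓝 (‖y - x‖ ^ 2), 0 < ρ ^ 2 + q :=
      (continuous_const.add continuous_id).continuousAt.eventually (lt_mem_nhds hQ)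
    filter_upwards [this] with q hq using hd β q hq
  · exact (hd (β - 1) _ hQ).const_mul β

lemma contDiff_bubble {ρ : ℝ} (hρ : 0 < ρ) (x : Rn n) (β : ℝ) {m : ℕ∞} :
    ContDiff ℝ m (fun y : Rn n => (ρ ^ 2 + ‖y - x‖ ^ 2) ^ β) := by
  refine ContDiff.rpow_const_of_ne ?_ fun y => by positivity
  exact contDiff_const.add ((contDiff_id.sub contDiff_const).norm_sq ℝ)

lemma lap_linear_bubble {ρ : ℝ} (hρ : 0 < ρ) (x : Rn n) (a b β γ : ℝ) (y : Rn n) :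
    lap n (fun y => a * (ρ ^ 2 + ‖y - x‖ ^ 2) ^ β - b * (ρ ^ 2 + ‖y - x‖ ^ 2) ^ γ) y
      = a * lap n (fun y => (ρ ^ 2 + ‖y - x‖ ^ 2) ^ β) y
        - b * lap n (fun y => (ρ ^ 2 + ‖y - x‖ ^ 2) ^ γ) y := by
  unfold lap
  rw [Finset.mul_sum, Finset.mul_sum, ← Finset.sum_sub_distrib]
  refine Finset.sum_congr rfl fun i _ => ?_
  have hc : ∀ β : ℝ, ContDiff ℝ 2 (fun s : ℝ => (ρ ^ 2
      + ‖y + s • (EuclideanSpace.single i (1 : ℝ) : Rn n) - x‖ ^ 2) ^ β) := fun β =>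
    (contDiff_bubble hρ x β (m := 2)).comp
      (contDiff_const.add (contDiff_id.smul contDiff_const))
  have := iteratedDeriv_fun_sub (n := 2) (x := (0 : ℝ))
    (contDiff_const.mul (hc β) (f := fun _ => a)).contDiffAt
    (contDiff_const.mul (hc γ) (f := fun _ => b)).contDiffAt
  rw [this, iteratedDeriv_const_mul_field, iteratedDeriv_const_mul_field]

lemma biLap_bubble {ρ : ℝ} (hρ : 0 < ρ) (x y : Rn n) :
    biLap n (fun y => (ρ ^ 2 + ‖y - x‖ ^ 2) ^ (-((n : ℝ) - 4) / 2)) y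
      = (((n : ℝ) - 4) * ((n : ℝ) - 2) * n * ((n : ℝ) + 2)) * ρ ^ 4
        * (ρ ^ 2 + ‖y - x‖ ^ 2) ^ (-((n : ℝ) + 4) / 2) := by
  unfold biLap
  set β : ℝ := -((n : ℝ) - 4) / 2 with hβ
  have hn : (n : ℝ) = 4 - 2 * β := by rw [hβ]; ring
  have h1 : lap n (fun y => (ρ ^ 2 + ‖y - x‖ ^ 2) ^ β) = fun y =>
      β * (4 * β - 4 + 2 * n) * (ρ ^ 2 + ‖y - x‖ ^ 2) ^ (β - 1)
        - 4 * β * (β - 1) * ρ ^ 2 * (ρ ^ 2 + ‖y - x‖ ^ 2) ^ (β - 2) :=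
    funext fun y => lap_bubble hρ x β y
  rw [h1, lap_linear_bubble hρ, lap_bubble hρ, lap_bubble hρ, hn,
    show β - 1 - 2 = β - 3 by ring, show β - 2 - 1 = β - 3 by ring,
    show β - 2 - 2 = -(4 - 2 * β + 4) / 2 by ring]
  ring

end Bubble

section Weighted

variable {n : ℕ} {u : Rn n → ℝ}

lemma PuncturedSolution.nontrivial (hu : PuncturedSolution n u) : Nontrivial (Rn n) := by
  have : Nonempty (Fin n) := ⟨⟨0, by have := hu.five_le; omega⟩⟩
  infer_instance

lemma PuncturedSolution.ae_ne (hu : PuncturedSolution n u) : ∀ᵐ y : Rn n, y ≠ 0 := by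
  have := hu.nontrivial
  exact compl_mem_ae_iff.2 (measure_singleton 0)

theorem PuncturedSolution.lintegral_weight_lt_top (hu : PuncturedSolution n u) :
    ∫⁻ y, ENNReal.ofReal (u y * (1 + ‖y‖ ^ 2) ^ (-((n : ℝ) + 4) / 2)) < ⊤ := by
  obtain ⟨C, hC, hb⟩ := hu.exists_annulus_bound
  have hn : (1 : ℝ) ≤ n - 4 := exponent_sub_pos hu.five_le
  set ann : ℤ → Set (Rn n) := fun k => {y | (2 : ℝ) ^ k ≤ ‖y‖ ∧ ‖y‖ ≤ 2 * (2 : ℝ) ^ k} with hann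
  have hmeas : ∀ k, MeasurableSet (ann k) := fun k =>
    (measurableSet_le measurable_const measurable_norm).inter
      (measurableSet_le measurable_norm measurable_const)
  have hcov : ({0}ᶜ : Set (Rn n)) ⊆ ⋃ k, ann k := by
    intro y hy
    obtain ⟨k, hk1, hk2⟩ := exists_mem_Ico_zpow (norm_pos_iff.2 hy) (one_lt_two (α := ℝ))
    refine mem_iUnion.2 ⟨k, hk1, ?_⟩
    rw [zpow_add_one₀ two_ne_zero] at hk2
    linarith
  have := hu.nontrivial
  have hterm : ∀ k : ℤ, ∫⁻ y in ann k,
      ENNReal.ofReal (u y * (1 + ‖y‖ ^ 2) ^ (-((n : ℝ) + 4) / 2))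
      ≤ ENNReal.ofReal (C * (1 / 2) ^ k.natAbs) := by
    intro k
    set r : ℝ := (2 : ℝ) ^ k with hr
    have hr0 : 0 < r := by positivity
    set w : ℝ := (1 + r ^ 2) ^ (-((n : ℝ) + 4) / 2) with hw
    have hw0 : 0 < w := by positivity
    calc _ ≤ ∫⁻ y in ann k, ENNReal.ofReal w * ENNReal.ofReal (u y) := by
          refine setLIntegral_mono' (hmeas k) fun y hy => ?_
          have hy0 : y ≠ 0 := norm_pos_iff.1 (hr0.trans_le hy.1)
          rw [← ENNReal.ofReal_mul hw0.le, mul_comm w]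
          refine ENNReal.ofReal_le_ofReal (mul_le_mul_of_nonneg_left ?_ (hu.pos y hy0).le)
          refine Real.rpow_le_rpow_of_nonpos (by positivity) ?_ (by linarith)
          have := pow_le_pow_left₀ hr0.le hy.1 2
          linarith
      _ = ENNReal.ofReal w * ∫⁻ y in ann k, ENNReal.ofReal (u y) :=
          lintegral_const_mul' _ _ ENNReal.ofReal_ne_top
      _ ≤ ENNReal.ofReal w * ENNReal.ofReal (C * r ^ (((n : ℝ) + 4) / 2)) :=
          mul_le_mul_right (hb r hr0) _
      _ = ENNReal.ofReal (w * (C * r ^ (((n : ℝ) + 4) / 2))) :=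
          (ENNReal.ofReal_mul hw0.le).symm
      _ ≤ _ := by
          refine ENNReal.ofReal_le_ofReal ?_
          have key : w * r ^ (((n : ℝ) + 4) / 2) ≤ (1 / 2) ^ k.natAbs := by
            have e : w * r ^ (((n : ℝ) + 4) / 2) = (r / (1 + r ^ 2)) ^ (((n : ℝ) + 4) / 2) := by
              rw [Real.div_rpow hr0.le (by positivity), hw,
                show -((n : ℝ) + 4) / 2 = -(((n : ℝ) + 4) / 2) by ring,
                Real.rpow_neg (by positivity)]
              field_simp
            have h1 : r / (1 + r ^ 2) ≤ (1 / 2) ^ k.natAbs := by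
              rw [div_le_iff₀ (by positivity)]
              rcases k.natAbs_eq with h | h
              · have : r = 2 ^ k.natAbs := by rw [hr]; nth_rw 1 [h]; exact zpow_natCast _ _
                rw [this, one_div, inv_pow]
                have h2 : (0 : ℝ) < 2 ^ k.natAbs := by positivity
                field_simp
                nlinarith
              · have : r = (1 / 2) ^ k.natAbs := by
                  rw [hr]; nth_rw 1 [h]; rw [zpow_neg, zpow_natCast, one_div, inv_pow]
                rw [← this]
                nlinarith [sq_nonneg r]
            have h2 : r / (1 + r ^ 2) ≤ 1 := h1.trans (pow_le_one₀ (by norm_num) (by norm_num))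
            rw [e]
            calc (r / (1 + r ^ 2)) ^ (((n : ℝ) + 4) / 2) ≤ (r / (1 + r ^ 2)) ^ (1 : ℝ) :=
                  Real.rpow_le_rpow_of_exponent_ge (by positivity) h2 (by linarith)
              _ ≤ _ := by rwa [Real.rpow_one]
          calc w * (C * r ^ (((n : ℝ) + 4) / 2)) = C * (w * r ^ (((n : ℝ) + 4) / 2)) := by ring
            _ ≤ _ := mul_le_mul_of_nonneg_left key hC.le
  have hsum : Summable fun k : ℤ => C * (1 / 2 : ℝ) ^ k.natAbs := by
    refine Summable.mul_left _ ?_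
    refine Summable.of_nat_of_neg ?_ ?_ <;>
    simpa using summable_geometric_of_lt_one (r := (1 / 2 : ℝ)) (by norm_num) (by norm_num)
  calc _ = ∫⁻ y in ({0}ᶜ : Set (Rn n)),
      ENNReal.ofReal (u y * (1 + ‖y‖ ^ 2) ^ (-((n : ℝ) + 4) / 2)) := by
        rw [Measure.restrict_eq_self_of_ae_mem]
        exact compl_mem_ae_iff.2 (measure_singleton 0)
    _ ≤ ∫⁻ y in ⋃ k, ann k, ENNReal.ofReal (u y * (1 + ‖y‖ ^ 2) ^ (-((n : ℝ) + 4) / 2)) :=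
        lintegral_mono_set hcov
    _ ≤ ∑' k, ∫⁻ y in ann k, ENNReal.ofReal (u y * (1 + ‖y‖ ^ 2) ^ (-((n : ℝ) + 4) / 2)) :=
        lintegral_iUnion_le _ _
    _ ≤ ∑' k : ℤ, ENNReal.ofReal (C * (1 / 2) ^ k.natAbs) := ENNReal.tsum_le_tsum hterm
    _ = ENNReal.ofReal (∑' k : ℤ, C * (1 / 2 : ℝ) ^ k.natAbs) :=
        (ENNReal.ofReal_tsum_of_nonneg (fun k => by positivity) hsum).symm
    _ < ⊤ := ENNReal.ofReal_lt_top

lemma bubble_le_weight {ρ : ℝ} (hρ : 0 < ρ) (x y : Rn n) :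
    (ρ ^ 2 + ‖y - x‖ ^ 2) ^ (-((n : ℝ) + 4) / 2)
      ≤ (2 + (1 + 2 * ‖x‖ ^ 2) / ρ ^ 2) ^ (((n : ℝ) + 4) / 2)
        * (1 + ‖y‖ ^ 2) ^ (-((n : ℝ) + 4) / 2) := by
  set c : ℝ := 2 + (1 + 2 * ‖x‖ ^ 2) / ρ ^ 2 with hc
  have hc0 : 0 < c := by positivity
  have h1 : 1 + ‖y‖ ^ 2 ≤ c * (ρ ^ 2 + ‖y - x‖ ^ 2) := by
    have h2 : ‖y‖ ≤ ‖x‖ + ‖y - x‖ := by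
      have := norm_add_le x (y - x)
      simpa using this
    have h3 : (1 + 2 * ‖x‖ ^ 2) / ρ ^ 2 * ρ ^ 2 = 1 + 2 * ‖x‖ ^ 2 := by field_simp
    have h4 : 0 ≤ (1 + 2 * ‖x‖ ^ 2) / ρ ^ 2 * ‖y - x‖ ^ 2 := by positivity
    have h5 : ‖y‖ ^ 2 ≤ (‖x‖ + ‖y - x‖) ^ 2 := pow_le_pow_left₀ (norm_nonneg y) h2 2
    rw [hc]
    nlinarith [sq_nonneg (‖x‖ - ‖y - x‖), sq_nonneg ρ]
  have h6 : (0 : ℝ) ≤ ((n : ℝ) + 4) / 2 := by positivity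
  rw [show -((n : ℝ) + 4) / 2 = -(((n : ℝ) + 4) / 2) by ring, Real.rpow_neg (by positivity),
    Real.rpow_neg (by positivity), ← div_eq_mul_inv, ← one_div,
    div_le_div_iff₀ (by positivity) (by positivity), one_mul,
        ← Real.mul_rpow hc0.le (by positivity)]
  exact Real.rpow_le_rpow (by positivity) h1 h6

lemma PuncturedSolution.ae_pos (hu : PuncturedSolution n u) : ∀ᵐ y, 0 < u y := by
  filter_upwards [hu.ae_ne] with y hy using hu.pos y hy

lemma PuncturedSolution.aestronglyMeasurable (hu : PuncturedSolution n u) :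
    AEStronglyMeasurable u := by
  have := hu.nontrivial
  have h := hu.continuousOn.aestronglyMeasurable (μ := volume)
      (isOpen_ne (x := (0 : Rn n))).measurableSet
  rwa [Measure.restrict_eq_self_of_ae_mem] at h
  exact compl_mem_ae_iff.2 (measure_singleton 0)

lemma PuncturedSolution.integrable_bubble (hu : PuncturedSolution n u) {ρ : ℝ} (hρ : 0 < ρ)
    (x : Rn n) : Integrable fun y => u y * (ρ ^ 2 + ‖y - x‖ ^ 2) ^ (-((n : ℝ) + 4) / 2) := by
  have hw : Integrable fun y => u y * (1 + ‖y‖ ^ 2) ^ (-((n : ℝ) + 4) / 2) := by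
    have hm : AEStronglyMeasurable fun y => u y * (1 + ‖y‖ ^ 2) ^ (-((n : ℝ) + 4) / 2) := by
      refine hu.aestronglyMeasurable.mul (Continuous.aestronglyMeasurable ?_)
      exact (continuous_const.add (continuous_norm.pow 2)).rpow_const
        fun y => Or.inl (show (1 : ℝ) + ‖y‖ ^ 2 ≠ 0 by positivity)
    refine ⟨hm, ?_⟩
    rw [hasFiniteIntegral_iff_ofReal]
    · exact hu.lintegral_weight_lt_top
    · filter_upwards [hu.ae_pos] with y hy using mul_nonneg hy.le (by positivity)
  refine (hw.const_mul ((2 + (1 + 2 * ‖x‖ ^ 2) / ρ ^ 2) ^ (((n : ℝ) + 4) / 2))).mono' ?_ ?_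
  · exact hu.aestronglyMeasurable.mul
      (contDiff_bubble hρ x _ (m := 0)).continuous.aestronglyMeasurable
  · filter_upwards [hu.ae_pos] with y hy
    rw [Real.norm_of_nonneg (mul_nonneg hy.le (by positivity)), mul_left_comm]
    exact mul_le_mul_of_nonneg_left (bubble_le_weight hρ x y) hy.le

end Weighted

section Truncation

variable {n : ℕ} {u : Rn n → ℝ}

/-- The function `g` cut off near the origin and near infinity. -/
noncomputable def truncated (g : Rn n → ℝ) (k : ℝ) (y : Rn n) : ℝ :=
  cut (k • y) * (1 - cut (k⁻¹ • y)) * g y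

variable {g : Rn n → ℝ} {k : ℝ}

lemma contDiff_truncated {m : ℕ∞} (hg : ContDiff ℝ m g) : ContDiff ℝ m (truncated g k) :=
  ((contDiff_cut.comp (contDiff_const_smul k)).mul
    (contDiff_const.sub (contDiff_cut.comp (contDiff_const_smul k⁻¹)))).mul hg

lemma norm_smul_pos (hk : 0 < k) (y : Rn n) : ‖k • y‖ = k * ‖y‖ := by
  rw [norm_smul, Real.norm_of_nonneg hk.le]

lemma norm_inv_smul_pos (hk : 0 < k) (y : Rn n) : ‖k⁻¹ • y‖ = ‖y‖ / k := by
  rw [norm_smul_pos (inv_pos.2 hk), inv_mul_eq_div]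

lemma truncated_eq_zero_of_le (hk : 0 < k) {y : Rn n} (hy : ‖y‖ ≤ 1 / k) :
    truncated g k y = 0 := by
  have : cut (k • y) = 0 := cut_eq_zero (by
    rw [norm_smul_pos hk]; rwa [le_div_iff₀ hk, mul_comm] at hy)
  simp only [truncated, this, zero_mul]

lemma truncated_eq_zero_of_ge (hk : 0 < k) {y : Rn n} (hy : 2 * k ≤ ‖y‖) :
    truncated g k y = 0 := by
  have : cut (k⁻¹ • y) = 1 := cut_eq_one (by
    rw [norm_inv_smul_pos hk]; rwa [le_div_iff₀ hk])
  simp only [truncated, this, sub_self, mul_zero, zero_mul]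

lemma truncated_of_le (hk : 0 < k) {y : Rn n} (hy : ‖y‖ ≤ k) :
    truncated g k y = cut (k • y) * g y := by
  have : cut (k⁻¹ • y) = 0 := cut_eq_zero (by
    rw [norm_inv_smul_pos hk]; rwa [div_le_one hk])
  simp only [truncated, this, sub_zero, mul_one]

lemma truncated_of_ge (hk : 0 < k) {y : Rn n} (hy : 2 / k ≤ ‖y‖) :
    truncated g k y = (1 - cut (k⁻¹ • y)) * g y := by
  have : cut (k • y) = 1 := cut_eq_one (by
    rw [norm_smul_pos hk]; rwa [div_le_iff₀ hk, mul_comm] at hy)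
  simp only [truncated, this, one_mul]

lemma hasCompactSupport_truncated (hk : 0 < k) : HasCompactSupport (truncated g k) := by
  refine HasCompactSupport.of_support_subset_isCompact (isCompact_closedBall 0 (2 * k)) ?_
  intro y hy
  rw [mem_closedBall_zero_iff]
  by_contra h
  exact hy (truncated_eq_zero_of_ge hk (not_le.1 h).le)

lemma eventually_norm_lt {y : Rn n} {a : ℝ} (h : ‖y‖ < a) : ∀ᶠ z : Rn n in 𝓝 y, ‖z‖ < a :=
  continuous_norm.continuousAt.eventually (gt_mem_nhds h)

lemma eventually_lt_norm {y : Rn n} {a : ℝ} (h : a < ‖y‖) : ∀ᶠ z : Rn n in 𝓝 y, a < ‖z‖ :=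
  continuous_norm.continuousAt.eventually (lt_mem_nhds h)

lemma isCompact_annulus (a b : ℝ) : IsCompact {y : Rn n | a ≤ ‖y‖ ∧ ‖y‖ ≤ b} := by
  refine (isCompact_closedBall (0 : Rn n) b).of_isClosed_subset ?_ fun y hy => by
    simpa using hy.2
  exact (isClosed_le continuous_const continuous_norm).inter
    (isClosed_le continuous_norm continuous_const)

lemma exists_biLap_truncated_inner {ρ : ℝ} (hρ : 0 < ρ) (x : Rn n) (γ : ℝ) :
    ∃ C : ℝ, 0 ≤ C ∧ ∀ k : ℝ, 2 ≤ k → ∀ y : Rn n, 1 / k ≤ ‖y‖ → ‖y‖ ≤ 2 / k →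
      |biLap n (truncated (fun y => (ρ ^ 2 + ‖y - x‖ ^ 2) ^ γ) k) y| ≤ C * k ^ 4 := by
  set H : ℝ × Rn n → ℝ := fun q => cut q.2 * (ρ ^ 2 + ‖q.1 • q.2 - x‖ ^ 2) ^ γ with hH
  have hHc : ContDiff ℝ 4 H := by
    refine ((contDiff_cut (m := 4)).comp contDiff_snd).mul
      (ContDiff.rpow_const_of_ne ?_ fun y => by positivity)
    exact contDiff_const.add (((contDiff_fst.smul contDiff_snd).sub contDiff_const).norm_sq ℝ)
  have hcont : Continuous fun q : ℝ × Rn n => biLap n (fun w => H (q.1, w)) q.2 :=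
    continuous_iff_continuousAt.2 fun q =>
      (contDiffAt_biLap_param (m := 0) (by exact_mod_cast hHc.contDiffAt)).continuousAt
  obtain ⟨C, hC⟩ := ((isCompact_Icc (a := (0 : ℝ)) (b := 1)).prod
    (isCompact_annulus (n := n) 1 2)).exists_bound_of_continuousOn hcont.continuousOn
  refine ⟨|C|, abs_nonneg C, fun k hk y hy1 hy2 => ?_⟩
  have hk0 : 0 < k := by linarith
  have hyk : ‖y‖ < k := hy2.trans_lt (by rw [div_lt_iff₀ hk0]; nlinarith)
  have heq : truncated (fun y => (ρ ^ 2 + ‖y - x‖ ^ 2) ^ γ) k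
      =ᶠ[𝓝 y] fun y => (fun w => H (k⁻¹, w)) (k • y) := by
    filter_upwards [eventually_norm_lt hyk] with z hz
    rw [truncated_of_le hk0 hz.le]
    simp only [hH, smul_smul, inv_mul_cancel₀ hk0.ne', one_smul]
  rw [biLap_congr heq, biLap_comp_smul k (fun w => H (k⁻¹, w)), abs_mul,
    abs_of_nonneg (by positivity), mul_comm]
  refine mul_le_mul_of_nonneg_right ?_ (by positivity)
  refine (hC (k⁻¹, k • y) ⟨⟨by positivity, inv_le_one_of_one_le₀ (by linarith)⟩, ?_, ?_⟩).trans
      (le_abs_self C)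
  · rw [norm_smul_pos hk0]; rwa [div_le_iff₀ hk0, mul_comm] at hy1
  · rw [norm_smul_pos hk0]; rwa [le_div_iff₀ hk0, mul_comm] at hy2

lemma exists_biLap_truncated_outer {ρ : ℝ} (hρ : 0 < ρ) (x : Rn n) (γ : ℝ) :
    ∃ C : ℝ, 0 ≤ C ∧ ∀ k : ℝ, 2 ≤ k → ∀ y : Rn n, k ≤ ‖y‖ → ‖y‖ ≤ 2 * k →
      |biLap n (truncated (fun y => (ρ ^ 2 + ‖y - x‖ ^ 2) ^ γ) k) y|
        ≤ C * (k ^ 2) ^ γ * k⁻¹ ^ 4 := by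
  set H : ℝ × Rn n → ℝ :=
    fun q => (1 - cut q.2) * (q.1 ^ 2 * ρ ^ 2 + ‖q.2 - q.1 • x‖ ^ 2) ^ γ with hH
  set K : Set (ℝ × Rn n) := Icc (0 : ℝ) 1 ×ˢ {y : Rn n | 1 ≤ ‖y‖ ∧ ‖y‖ ≤ 2} with hK
  have hHc : ∀ q ∈ K, ContDiffAt ℝ 4 H q := by
    rintro ⟨s, z⟩ ⟨-, hz⟩
    refine (contDiff_const.sub ((contDiff_cut (m := 4)).comp contDiff_snd)).contDiffAt.mul
      (ContDiffAt.rpow_const_of_ne ?_ ?_)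
    · exact (((contDiff_fst.pow 2).mul contDiff_const).add
        ((contDiff_snd.sub (contDiff_fst.smul contDiff_const)).norm_sq ℝ)).contDiffAt
    · by_cases hs : s = 0
      · have : 0 < ‖z‖ := by linarith [hz.1]
        simp only [hs, zero_smul, sub_zero]
        positivity
      · positivity
  have hcont : ContinuousOn (fun q : ℝ × Rn n => biLap n (fun w => H (q.1, w)) q.2) K :=
    fun q hq => (contDiffAt_biLap_param (m := 0)
      (by exact_mod_cast hHc q hq)).continuousAt.continuousWithinAt
  obtain ⟨C, hC⟩ := (isCompact_Icc.prod
    (isCompact_annulus (n := n) 1 2)).exists_bound_of_continuousOn hcont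
  refine ⟨|C|, abs_nonneg C, fun k hk y hy1 hy2 => ?_⟩
  have hk0 : 0 < k := by linarith
  have hyk : 2 / k < ‖y‖ := lt_of_lt_of_le (by rw [div_lt_iff₀ hk0]; nlinarith) hy1
  have heq : truncated (fun y => (ρ ^ 2 + ‖y - x‖ ^ 2) ^ γ) k
      =ᶠ[𝓝 y] fun y => (k ^ 2) ^ γ * (fun y => (fun w => H (k⁻¹, w)) (k⁻¹ • y)) y := by
    filter_upwards [eventually_lt_norm hyk] with z hz
    rw [truncated_of_ge hk0 hz.le]
    have e : ρ ^ 2 + ‖z - x‖ ^ 2 = k ^ 2 * (k⁻¹ ^ 2 * ρ ^ 2 + ‖k⁻¹ • z - k⁻¹ • x‖ ^ 2) := by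
      rw [← smul_sub, norm_smul, norm_inv, Real.norm_of_nonneg hk0.le]
      field_simp
    simp only [hH]
    rw [e, Real.mul_rpow (by positivity) (by positivity)]
    ring
  rw [biLap_congr heq, biLap_const_mul, biLap_comp_smul k⁻¹ (fun w => H (k⁻¹, w)), abs_mul,
    abs_mul, abs_of_nonneg (by positivity), abs_of_nonneg (by positivity),
    show |C| * (k ^ 2) ^ γ * k⁻¹ ^ 4 = (k ^ 2) ^ γ * (k⁻¹ ^ 4 * |C|) by ring]
  refine mul_le_mul_of_nonneg_left (mul_le_mul_of_nonneg_left ?_ (by positivity)) (by positivity)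
  refine (hC (k⁻¹, k⁻¹ • y) ⟨⟨by positivity, inv_le_one_of_one_le₀ (by linarith)⟩, ?_, ?_⟩).trans
      (le_abs_self C)
  · rw [norm_inv_smul_pos hk0]; rwa [le_div_iff₀ hk0, one_mul]
  · rw [norm_inv_smul_pos hk0]; rwa [div_le_iff₀ hk0]

lemma measurableSet_annulus (a b : ℝ) : MeasurableSet {y : Rn n | a ≤ ‖y‖ ∧ ‖y‖ ≤ b} :=
  (isCompact_annulus a b).isClosed.measurableSet

lemma PuncturedSolution.integrableOn_annulus (hu : PuncturedSolution n u) {a : ℝ} (ha : 0 < a)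
    (b : ℝ) : IntegrableOn u {y : Rn n | a ≤ ‖y‖ ∧ ‖y‖ ≤ b} :=
  (hu.continuousOn.mono fun _ hy => norm_pos_iff.1 (ha.trans_le hy.1)).integrableOn_compact
    (isCompact_annulus a b)

lemma PuncturedSolution.exists_setIntegral_annulus_le (hu : PuncturedSolution n u) :
    ∃ C : ℝ, 0 < C ∧ ∀ r : ℝ, 0 < r →
      ∫ y in {y : Rn n | r ≤ ‖y‖ ∧ ‖y‖ ≤ 2 * r}, u y ≤ C * r ^ (((n : ℝ) + 4) / 2) := by
  obtain ⟨C, hC, hb⟩ := hu.exists_annulus_bound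
  refine ⟨C, hC, fun r hr => ?_⟩
  rw [integral_eq_lintegral_of_nonneg_ae]
  · exact ENNReal.toReal_le_of_le_ofReal (by positivity) (hb r hr)
  · filter_upwards [ae_restrict_of_ae hu.ae_pos] with y hy using hy.le
  · exact hu.aestronglyMeasurable.restrict

/-- The equation tested against the bubbles. -/
theorem PuncturedSolution.lintegral_bubble (hu : PuncturedSolution n u) {ρ : ℝ} (hρ : 0 < ρ)
    (x : Rn n) :
    ∫⁻ y, ENNReal.ofReal (u y ^ (((n : ℝ) + 4) / ((n : ℝ) - 4))
        * (ρ ^ 2 + ‖y - x‖ ^ 2) ^ (-((n : ℝ) - 4) / 2))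
      = ENNReal.ofReal ((((n : ℝ) - 4) * ((n : ℝ) - 2) * n * ((n : ℝ) + 2)) * ρ ^ 4
        * ∫ y, u y * (ρ ^ 2 + ‖y - x‖ ^ 2) ^ (-((n : ℝ) + 4) / 2)) := by
  set γ : ℝ := -((n : ℝ) - 4) / 2 with hγ
  set q : ℝ := ((n : ℝ) + 4) / ((n : ℝ) - 4) with hq
  set g : Rn n → ℝ := fun y => (ρ ^ 2 + ‖y - x‖ ^ 2) ^ γ with hg
  have hn : (1 : ℝ) ≤ n - 4 := exponent_sub_pos hu.five_le
  have hg4 : ContDiff ℝ 4 g := contDiff_bubble hρ x γ (m := 4)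
  have hg0 : ∀ y, 0 < g y := fun y => by positivity
  obtain ⟨C1, hC1', hC1⟩ := exists_biLap_truncated_inner hρ x γ
  obtain ⟨C2, hC2', hC2⟩ := exists_biLap_truncated_outer hρ x γ
  obtain ⟨C, hC, hCu⟩ := hu.exists_setIntegral_annulus_le
  set J : ℝ := ∫ y, u y * biLap n g y with hJ
  have hbl : ∀ y, biLap n g y = (((n : ℝ) - 4) * ((n : ℝ) - 2) * n * ((n : ℝ) + 2)) * ρ ^ 4
        * (ρ ^ 2 + ‖y - x‖ ^ 2) ^ (-((n : ℝ) + 4) / 2) := biLap_bubble hρ x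
  have hJ' : J = (((n : ℝ) - 4) * ((n : ℝ) - 2) * n * ((n : ℝ) + 2)) * ρ ^ 4
        * ∫ y, u y * (ρ ^ 2 + ‖y - x‖ ^ 2) ^ (-((n : ℝ) + 4) / 2) := by
    rw [hJ, ← integral_const_mul]
    congr 1
    funext y
    rw [hbl y]
    ring
  have hJi : Integrable fun y => u y * biLap n g y := by
    refine ((hu.integrable_bubble hρ x).const_mul
      ((((n : ℝ) - 4) * ((n : ℝ) - 2) * n * ((n : ℝ) + 2)) * ρ ^ 4)).congr ?_
    exact Eventually.of_forall fun y => by simp only [hbl y]; ring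
  rw [← hJ']
  have hk2 : ∀ j : ℕ, (2 : ℝ) ≤ j + 2 := fun j => by have : (0 : ℝ) ≤ j := j.cast_nonneg
                                                     linarith
  set φ : ℕ → Rn n → ℝ := fun j => truncated g (j + 2) with hφ
  set S : ℕ → Set (Rn n) := fun j => {y | 2 / ((j : ℝ) + 2) < ‖y‖ ∧ ‖y‖ < j + 2} with hS
  have hSm : ∀ j, MeasurableSet (S j) := fun j =>
    (measurableSet_lt measurable_const measurable_norm).inter
      (measurableSet_lt measurable_norm measurable_const)
  have hφi : ∀ j, Integrable fun y => u y * biLap n (φ j) y := fun j => by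
    have hk0 : (0 : ℝ) < j + 2 := by linarith [hk2 j]
    refine Continuous.integrable_of_hasCompactSupport ?_ ?_
    · refine continuous_mul_of_vanish hu.continuousOn
        (continuous_biLap (contDiff_truncated hg4)) (ε := 1 / (j + 2)) (by positivity) ?_
      intro y hy
      refine biLap_eq_zero_of_eventuallyEq ?_
      filter_upwards [eventually_norm_lt hy] with z hz using truncated_eq_zero_of_le hk0 hz.le
    · exact (hasCompactSupport_lap (hasCompactSupport_lap
        (hasCompactSupport_truncated hk0))).mul_left
  have hdiff : ∀ j : ℕ, |(∫ y, u y * biLap n (φ j) y) - ∫ y in S j, u y * biLap n g y|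
      ≤ (C1 + C2) * C * ((j : ℝ) + 2) ^ (-((n : ℝ) - 4) / 2) := by
    intro j
    set k : ℝ := (j : ℝ) + 2 with hk
    have hk2 : 2 ≤ k := hk2 j
    have hk0 : 0 < k := by linarith
    set A1 : Set (Rn n) := {y | 1 / k ≤ ‖y‖ ∧ ‖y‖ ≤ 2 * (1 / k)} with hA1
    set A2 : Set (Rn n) := {y | k ≤ ‖y‖ ∧ ‖y‖ ≤ 2 * k} with hA2
    set D2 : ℝ := C2 * (k ^ 2) ^ γ * k⁻¹ ^ 4 with hD2
    have hA1i := (hu.integrableOn_annulus (a := 1 / k)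
        (by positivity) (2 * (1 / k))).integrable_indicator
      (measurableSet_annulus _ _)
    have hA2i := (hu.integrableOn_annulus hk0 (2 * k)).integrable_indicator
      (measurableSet_annulus _ _)
    rw [← integral_indicator (hSm j), ← integral_sub (hφi j) (hJi.indicator (hSm j))]
    refine (Real.norm_eq_abs _).symm.trans_le <|
      (norm_integral_le_of_norm_le ((hA1i.const_mul (C1 * k ^ 4)).add (hA2i.const_mul D2))
      ?_).trans ?_
    · filter_upwards [hu.ae_pos] with y hy
      have p1 : 0 ≤ C1 * k ^ 4 * A1.indicator u y :=
        mul_nonneg (by positivity) (indicator_apply_nonneg fun _ => hy.le)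
      have p2 : 0 ≤ D2 * A2.indicator u y :=
        mul_nonneg (by positivity) (indicator_apply_nonneg fun _ => hy.le)
      change |_| ≤ C1 * k ^ 4 * A1.indicator u y + D2 * A2.indicator u y
      rcases lt_or_ge (‖y‖) (1 / k) with h1 | h1
      · have e1 : biLap n (φ j) y = 0 := by
          refine biLap_eq_zero_of_eventuallyEq ?_
          filter_upwards [eventually_norm_lt h1] with z hz using truncated_eq_zero_of_le hk0 hz.le
        have e2 : y ∉ S j := fun h => by
          have h3 : 1 / k ≤ 2 / k := by gcongr; norm_num
          linarith [h.1]
        rw [e1, indicator_of_notMem e2]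
        simpa using add_nonneg p1 p2
      rcases le_or_gt (‖y‖) (2 / k) with h2 | h2
      · have e2 : y ∉ S j := fun h => absurd h.1 (not_lt.2 h2)
        have e3 : y ∈ A1 := ⟨h1, by rwa [mul_one_div]⟩
        rw [indicator_of_notMem e2, sub_zero, abs_mul, abs_of_pos hy, indicator_of_mem e3]
        have := mul_le_mul_of_nonneg_left (hC1 k hk2 y h1 h2) hy.le
        linarith
      rcases lt_or_ge (‖y‖) k with h3 | h3
      · have e1 : biLap n (φ j) y = biLap n g y := by
          refine biLap_congr ?_
          filter_upwards [eventually_norm_lt h3, eventually_lt_norm h2] with z hz1 hz2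
          rw [hφ]
          simp only
          rw [truncated_of_le hk0 hz1.le, cut_eq_one, one_mul]
          rw [norm_smul_pos hk0]; rw [div_lt_iff₀ hk0] at hz2; linarith
        have e2 : y ∈ S j := ⟨h2, h3⟩
        rw [e1, indicator_of_mem e2, sub_self, abs_zero]
        exact add_nonneg p1 p2
      have e2 : y ∉ S j := fun h => absurd h.2 (not_lt.2 h3)
      rcases le_or_gt (‖y‖) (2 * k) with h4 | h4
      · have e3 : y ∈ A2 := ⟨h3, h4⟩
        rw [indicator_of_notMem e2, sub_zero, abs_mul, abs_of_pos hy, indicator_of_mem e3]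
        have := mul_le_mul_of_nonneg_left (hC2 k hk2 y h3 h4) hy.le
        linarith
      · have e1 : biLap n (φ j) y = 0 := by
          refine biLap_eq_zero_of_eventuallyEq ?_
          filter_upwards [eventually_lt_norm h4] with z hz using truncated_eq_zero_of_ge hk0 hz.le
        rw [e1, indicator_of_notMem e2]
        simpa using add_nonneg p1 p2
    · have i1 : ∫ y in A1, u y ≤ C * (1 / k) ^ (((n : ℝ) + 4) / 2) := hCu (1 / k) (by positivity)
      have i2 : ∫ y in A2, u y ≤ C * k ^ (((n : ℝ) + 4) / 2) := hCu k hk0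
      have e1 : k ^ 4 * (1 / k) ^ (((n : ℝ) + 4) / 2) = k ^ γ := by
        rw [one_div, Real.inv_rpow hk0.le, ← Real.rpow_neg hk0.le, ← Real.rpow_natCast,
          ← Real.rpow_add hk0, hγ]
        congr 1
        push_cast
        ring
      have e2 : (k ^ 2) ^ γ * k⁻¹ ^ 4 * k ^ (((n : ℝ) + 4) / 2) = k ^ γ := by
        rw [← Real.rpow_natCast k 2, ← Real.rpow_mul hk0.le, inv_pow, ← Real.rpow_natCast k 4,
          ← Real.rpow_neg hk0.le, ← Real.rpow_add hk0, ← Real.rpow_add hk0, hγ]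
        congr 1
        push_cast
        ring
      have e3 : ∫ y, ((fun y => C1 * k ^ 4 * A1.indicator u y) + fun y => D2 * A2.indicator u y) y
          = C1 * k ^ 4 * (∫ y in A1, u y) + D2 * ∫ y in A2, u y := by
        rw [integral_add' (hA1i.const_mul _) (hA2i.const_mul _), integral_const_mul,
          integral_const_mul, integral_indicator (measurableSet_annulus _ _),
          integral_indicator (measurableSet_annulus _ _)]
      rw [e3]
      calc C1 * k ^ 4 * (∫ y in A1, u y) + D2 * ∫ y in A2, u y
          ≤ C1 * k ^ 4 * (C * (1 / k) ^ (((n : ℝ) + 4) / 2))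
            + D2 * (C * k ^ (((n : ℝ) + 4) / 2)) := by gcongr
        _ = C1 * C * (k ^ 4 * (1 / k) ^ (((n : ℝ) + 4) / 2))
            + C2 * C * ((k ^ 2) ^ γ * k⁻¹ ^ 4 * k ^ (((n : ℝ) + 4) / 2)) := by rw [hD2]; ring
        _ = (C1 + C2) * C * k ^ γ := by rw [e1, e2]; ring
  have hkt : Tendsto (fun j : ℕ => (j : ℝ) + 2) atTop atTop :=
    tendsto_atTop_add_const_right _ _ tendsto_natCast_atTop_atTop
  have hev : ∀ y : Rn n, y ≠ 0 → ∀ᶠ j : ℕ in atTop, 2 / ((j : ℝ) + 2) < ‖y‖ ∧ ‖y‖ < j + 2 := by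
    intro y hy
    have hy' := norm_pos_iff.2 hy
    filter_upwards [hkt.eventually_gt_atTop (‖y‖), hkt.eventually_gt_atTop (2 / ‖y‖)] with j h1 h2
    refine ⟨?_, h1⟩
    rw [div_lt_iff₀ hy'] at h2
    rw [div_lt_iff₀ (hy'.trans h1)]
    linarith
  have hSlim : Tendsto (fun j => ∫ y in S j, u y * biLap n g y) atTop (𝓝 J) := by
    simp_rw [← integral_indicator (hSm _)]
    refine tendsto_integral_of_dominated_convergence (fun y => ‖u y * biLap n g y‖)
      (fun j => (hJi.indicator (hSm j)).aestronglyMeasurable) hJi.norm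
      (fun j => Eventually.of_forall fun y => norm_indicator_le_norm_self _ _) ?_
    filter_upwards [hu.ae_ne] with y hy
    refine tendsto_const_nhds.congr' ?_
    filter_upwards [hev y hy] with j hj
    exact (indicator_of_mem (s := S j) hj fun y => u y * biLap n g y).symm
  have hI : Tendsto (fun j => ∫ y, u y * biLap n (φ j) y) atTop (𝓝 J) := by
    have h0 : Tendsto (fun j : ℕ => (C1 + C2) * C * ((j : ℝ) + 2) ^ (-((n : ℝ) - 4) / 2))
        atTop (𝓝 0) := by
      have := (tendsto_rpow_neg_atTop (y := ((n : ℝ) - 4) / 2) (by linarith)).comp hkt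
      rw [← neg_div] at this
      simpa only [Function.comp_def, mul_zero] using this.const_mul ((C1 + C2) * C)
    have h1 := squeeze_zero_norm (fun j => (Real.norm_eq_abs _).trans_le (hdiff j)) h0
    simpa using h1.add hSlim
  have hφ0 : ∀ j y, 0 ≤ φ j y := fun j y =>
    mul_nonneg (mul_nonneg (cut_nonneg _) (by linarith [cut_le_one (((j : ℝ) + 2)⁻¹ • y)]))
      (hg0 y).le
  have hlint : ∀ j, ∫⁻ y, ENNReal.ofReal (u y ^ q * φ j y)
      = ENNReal.ofReal (∫ y, u y * biLap n (φ j) y) := fun j => by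
    have hk0 : (0 : ℝ) < j + 2 := by linarith [hk2 j]
    have hv : ∀ y, ‖y‖ < 1 / ((j : ℝ) + 2) → φ j y = 0 := fun y hy =>
      truncated_eq_zero_of_le hk0 hy.le
    rw [← hu.integral_eq (contDiff_truncated hg4) (hasCompactSupport_truncated hk0)
      (by positivity) hv, ofReal_integral_eq_lintegral_ofReal]
    · refine Continuous.integrable_of_hasCompactSupport ?_
        (hasCompactSupport_truncated hk0).mul_left
      exact continuous_mul_of_vanish hu.continuousOn_rpow
        (contDiff_truncated hg4).continuous (by positivity) hv
    · filter_upwards [hu.ae_pos] with y hy using mul_nonneg (by positivity) (hφ0 j y)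
  have hmono : Tendsto (fun j => ∫⁻ y, ENNReal.ofReal (u y ^ q * φ j y)) atTop
      (𝓝 (∫⁻ y, ENNReal.ofReal (u y ^ q * g y))) := by
    refine lintegral_tendsto_of_tendsto_of_monotone (fun j => ?_) ?_ ?_
    · exact ((hu.aestronglyMeasurable.aemeasurable.pow_const q).mul
        (contDiff_truncated hg4).continuous.aemeasurable).ennreal_ofReal
    · filter_upwards [hu.ae_pos] with y hy
      intro i j hij
      have hij' : (i : ℝ) + 2 ≤ j + 2 := by
        have : (i : ℝ) ≤ j := by exact_mod_cast hij
        linarith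
      have hi0 : (0 : ℝ) < i + 2 := by linarith [hk2 i]
      have hj0 : (0 : ℝ) < j + 2 := by linarith [hk2 j]
      refine ENNReal.ofReal_le_ofReal (mul_le_mul_of_nonneg_left ?_ (by positivity))
      refine mul_le_mul_of_nonneg_right (mul_le_mul (cut_mono ?_) (sub_le_sub_left (cut_mono ?_) 1)
        (by linarith [cut_le_one (((i : ℝ) + 2)⁻¹ • y)]) (cut_nonneg _)) (hg0 y).le
      · rw [norm_smul_pos hi0, norm_smul_pos hj0]
        gcongr
      · rw [norm_inv_smul_pos hi0, norm_inv_smul_pos hj0]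
        gcongr
    · filter_upwards [hu.ae_ne] with y hy
      refine tendsto_const_nhds.congr' ?_
      filter_upwards [hev y hy] with j hj
      have hk0 : (0 : ℝ) < j + 2 := by linarith [hk2 j]
      rw [hφ]
      simp only
      rw [truncated_of_le hk0 hj.2.le, cut_eq_one, one_mul]
      rw [norm_smul_pos hk0]; have := hj.1; rw [div_lt_iff₀ hk0] at this; linarith
  simp_rw [hlint] at hmono
  exact tendsto_nhds_unique hmono (ENNReal.tendsto_ofReal hI)

end Truncation

section Representation

variable {n : ℕ} {u : Rn n → ℝ}

lemma integrable_unit_bubble (n : ℕ) :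
    Integrable fun z : Rn n => (1 + ‖z‖ ^ 2) ^ (-((n : ℝ) + 4) / 2) :=
  integrable_rpow_neg_one_add_norm_sq (by simp)

lemma integral_unit_bubble_pos (n : ℕ) :
    0 < ∫ z : Rn n, (1 + ‖z‖ ^ 2) ^ (-((n : ℝ) + 4) / 2) := by
  refine integral_pos_of_integrable_nonneg_nonzero (x := 0) ?_ (integrable_unit_bubble n)
    (fun z => by positivity) (by simp)
  exact (continuous_const.add (continuous_norm.pow 2)).rpow_const
    fun y => Or.inl (show (1 : ℝ) + ‖y‖ ^ 2 ≠ 0 by positivity)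

lemma integral_bubble_rescale {ρ : ℝ} (hρ : 0 < ρ) (x : Rn n) (w : Rn n → ℝ) :
    ρ ^ 4 * ∫ y, w y * (ρ ^ 2 + ‖y - x‖ ^ 2) ^ (-((n : ℝ) + 4) / 2)
      = ∫ z, w (x + ρ • z) * (1 + ‖z‖ ^ 2) ^ (-((n : ℝ) + 4) / 2) := by
  set F : Rn n → ℝ := fun y => w (x + y) * (ρ ^ 2 + ‖y‖ ^ 2) ^ (-((n : ℝ) + 4) / 2) with hF
  have h1 : ∫ y, w y * (ρ ^ 2 + ‖y - x‖ ^ 2) ^ (-((n : ℝ) + 4) / 2) = ∫ y, F y := by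
    rw [← integral_add_left_eq_self _ x]
    simp [hF]
  have h2 := Measure.integral_comp_smul_of_nonneg (μ := volume) F ρ (hR := hρ.le)
  rw [finrank_euclideanSpace, Fintype.card_fin, smul_eq_mul] at h2
  have h3 : ∀ z, w (x + ρ • z) * (1 + ‖z‖ ^ 2) ^ (-((n : ℝ) + 4) / 2)
      = ρ ^ ((n : ℝ) + 4) * F (ρ • z) := fun z => by
    simp only [hF]
    rw [norm_smul_pos hρ, show ρ ^ 2 + (ρ * ‖z‖) ^ 2 = ρ ^ 2 * (1 + ‖z‖ ^ 2) by ring,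
      Real.mul_rpow (by positivity) (by positivity), ← Real.rpow_natCast ρ 2,
      ← Real.rpow_mul hρ.le]
    have : ρ ^ ((n : ℝ) + 4) * ρ ^ (((2 : ℕ) : ℝ) * (-((n : ℝ) + 4) / 2)) = 1 := by
      rw [← Real.rpow_add hρ, show (n : ℝ) + 4 + ((2 : ℕ) : ℝ) * (-((n : ℝ) + 4) / 2) = 0 by
        push_cast; ring, Real.rpow_zero]
    linear_combination -(w (x + ρ • z) * (1 + ‖z‖ ^ 2) ^ (-((n : ℝ) + 4) / 2)) * this
  simp_rw [h3]
  rw [integral_const_mul, h2, h1, ← mul_assoc]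
  congr 1
  rw [Real.rpow_add hρ, Real.rpow_natCast, show (4 : ℝ) = (4 : ℕ) by norm_num, Real.rpow_natCast]
  field_simp

lemma tendsto_integral_bubble {w : Rn n → ℝ} {x : Rn n}
    (hw : ∀ ρ : ℝ, 0 < ρ →
      Integrable fun y => w y * (ρ ^ 2 + ‖y - x‖ ^ 2) ^ (-((n : ℝ) + 4) / 2))
    (hwm : AEStronglyMeasurable w)
    (hc : ContinuousAt w x) :
    Tendsto (fun ρ : ℝ => ρ ^ 4 * ∫ y, w y * (ρ ^ 2 + ‖y - x‖ ^ 2) ^ (-((n : ℝ) + 4) / 2))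
      (𝓝[>] 0) (𝓝 (w x * ∫ z : Rn n, (1 + ‖z‖ ^ 2) ^ (-((n : ℝ) + 4) / 2))) := by
  obtain ⟨δ, hδ, hM⟩ := Metric.continuousAt_iff.1 hc 1 one_pos
  set e : ℝ := -((n : ℝ) + 4) / 2 with he
  have he0 : e ≤ 0 := by
    have : (0 : ℝ) ≤ n := n.cast_nonneg
    rw [he]; linarith
  set b : Rn n → ℝ := fun z => (1 + ‖z‖ ^ 2) ^ e with hb
  set D : Set (Rn n) := Metric.ball x δ with hD
  have hDm : MeasurableSet D := Metric.isOpen_ball.measurableSet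
  set w₁ : Rn n → ℝ := D.indicator w with hw₁
  have hw₁b : ∀ y, |w₁ y| ≤ |w x| + 1 := fun y => by
    by_cases hy : y ∈ D
    · have h1 := hM hy
      rw [Real.dist_eq] at h1
      rw [hw₁, indicator_of_mem hy]
      have := abs_sub_abs_le_abs_sub (w y) (w x)
      linarith
    · rw [hw₁, indicator_of_notMem hy, abs_zero]
      positivity
  have hw₁i : Integrable w₁ := by
    rw [hw₁, integrable_indicator_iff hDm]
    refine Measure.integrableOn_of_bounded (M := |w x| + 1) measure_ball_lt_top.ne
      hwm ?_
    filter_upwards [ae_restrict_mem hDm] with y hy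
    have := hw₁b y
    rwa [hw₁, indicator_of_mem hy] at this
  have hmain : Tendsto (fun ρ : ℝ => ∫ z, w₁ (x + ρ • z) * b z) (𝓝[>] 0)
      (𝓝 (∫ z, w x * b z)) := by
    refine tendsto_integral_filter_of_dominated_convergence (fun z => (|w x| + 1) * b z) ?_ ?_
      ((integrable_unit_bubble n).const_mul _) ?_
    · filter_upwards [self_mem_nhdsWithin] with ρ hρ
      exact ((hw₁i.comp_add_left x).comp_smul (ne_of_gt hρ)).aestronglyMeasurable.mul
        (integrable_unit_bubble n).aestronglyMeasurable
    · refine Eventually.of_forall fun ρ => Eventually.of_forall fun z => ?_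
      have : 0 ≤ b z := by positivity
      rw [norm_mul, Real.norm_of_nonneg this]
      exact mul_le_mul_of_nonneg_right (hw₁b _) this
    · refine Eventually.of_forall fun z => Tendsto.mul_const _ ?_
      have hc₁ : ContinuousAt w₁ x := hc.congr (by
        filter_upwards [Metric.ball_mem_nhds x hδ] with y hy
        exact (indicator_of_mem (s := D) hy w).symm)
      have h1 : Tendsto (fun ρ : ℝ => x + ρ • z) (𝓝[>] 0) (𝓝 x) := by
        have : Continuous fun ρ : ℝ => x + ρ • z := by fun_prop
        simpa using (this.tendsto 0).mono_left nhdsWithin_le_nhds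
      have h2 := hc₁.tendsto.comp h1
      rwa [show w₁ x = w x from indicator_of_mem (Metric.mem_ball_self hδ) w] at h2
  have htail : Tendsto (fun ρ : ℝ => ρ ^ 4 * ∫ y in Dᶜ, w y * (ρ ^ 2 + ‖y - x‖ ^ 2) ^ e)
      (𝓝[>] 0) (𝓝 0) := by
    set K : ℝ := (1 + 1 / δ ^ 2) ^ (-e) with hK
    set I : ℝ := ∫ y, ‖w y * (1 ^ 2 + ‖y - x‖ ^ 2) ^ e‖ with hI
    have hbd : ∀ᶠ ρ : ℝ in 𝓝[>] 0,
        ‖ρ ^ 4 * ∫ y in Dᶜ, w y * (ρ ^ 2 + ‖y - x‖ ^ 2) ^ e‖ ≤ ρ ^ 4 * (K * I) := by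
      filter_upwards [self_mem_nhdsWithin] with ρ hρ
      rw [norm_mul, Real.norm_of_nonneg (by positivity)]
      refine mul_le_mul_of_nonneg_left ?_ (by positivity)
      have h1 := norm_integral_le_of_norm_le (μ := volume.restrict Dᶜ)
        (f := fun y => w y * (ρ ^ 2 + ‖y - x‖ ^ 2) ^ e)
        ((hw 1 one_pos).norm.const_mul K).restrict ?_
      · refine h1.trans ?_
        rw [integral_const_mul]
        exact mul_le_mul_of_nonneg_left (setIntegral_le_integral (hw 1 one_pos).norm
          (Eventually.of_forall fun y => norm_nonneg _)) (by positivity)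
      · filter_upwards [ae_restrict_mem hDm.compl] with y hy
        have hyδ : δ ≤ ‖y - x‖ := by
          rw [hD, mem_compl_iff, Metric.mem_ball, not_lt, dist_eq_norm] at hy
          exact hy
        rw [norm_mul, norm_mul, mul_left_comm]
        refine mul_le_mul_of_nonneg_left ?_ (norm_nonneg _)
        rw [Real.norm_of_nonneg (by positivity), Real.norm_of_nonneg (by positivity)]
        have h2 : 1 ^ 2 + ‖y - x‖ ^ 2 ≤ (1 + 1 / δ ^ 2) * (ρ ^ 2 + ‖y - x‖ ^ 2) := by
          have h3 : 1 ≤ 1 / δ ^ 2 * ‖y - x‖ ^ 2 := by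
            rw [one_div, inv_mul_eq_div, le_div_iff₀ (by positivity), one_mul]
            exact pow_le_pow_left₀ hδ.le hyδ 2
          have h4 : 0 ≤ (1 + 1 / δ ^ 2) * ρ ^ 2 := by positivity
          linarith
        have hρ' : (0 : ℝ) < ρ := hρ
        have h5 : ((1 + 1 / δ ^ 2) * (ρ ^ 2 + ‖y - x‖ ^ 2)) ^ e ≤ (1 ^ 2 + ‖y - x‖ ^ 2) ^ e :=
          Real.rpow_le_rpow_of_nonpos (by positivity) h2 he0
        rw [Real.mul_rpow (by positivity) (by positivity)] at h5
        have h6 : K * (1 + 1 / δ ^ 2) ^ e = 1 := by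
          rw [hK, ← Real.rpow_add (by positivity)]; simp
        calc (ρ ^ 2 + ‖y - x‖ ^ 2) ^ e
            = K * ((1 + 1 / δ ^ 2) ^ e * (ρ ^ 2 + ‖y - x‖ ^ 2) ^ e) := by
              rw [← mul_assoc, h6, one_mul]
          _ ≤ _ := mul_le_mul_of_nonneg_left h5 (by positivity)
    refine squeeze_zero_norm' hbd ?_
    have : Continuous fun ρ : ℝ => ρ ^ 4 * (K * I) := by fun_prop
    simpa using (this.tendsto 0).mono_left nhdsWithin_le_nhds
  rw [← integral_const_mul]
  have hsum := hmain.add htail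
  rw [add_zero] at hsum
  refine hsum.congr' ?_
  filter_upwards [self_mem_nhdsWithin] with ρ hρ
  rw [← integral_bubble_rescale hρ x w₁, ← mul_add, ← integral_add_compl hDm (hw ρ hρ),
    ← integral_indicator hDm]
  congr 3
  funext y
  simp only [hw₁, indicator_mul_left, he]

theorem PuncturedSolution.exists_representation (hu : PuncturedSolution n u) :
    ∃ c : ℝ, 0 < c ∧ ∀ w : Rn n → ℝ, w =ᵐ[volume] u → ∀ x, ContinuousAt w x →
      ∫⁻ y, ENNReal.ofReal (‖x - y‖ ^ (-((n : ℝ) - 4)) * w y ^ (((n : ℝ) + 4) / ((n : ℝ) - 4)))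
        = ENNReal.ofReal (c * w x) := by
  have hn : (1 : ℝ) ≤ n - 4 := exponent_sub_pos hu.five_le
  set κ : ℝ := (((n : ℝ) - 4) * ((n : ℝ) - 2) * n * ((n : ℝ) + 2)) with hκ
  have hκ0 : 0 < κ := by
    have h1 : (0 : ℝ) < n - 4 := by linarith
    have h2 : (0 : ℝ) < n - 2 := by linarith
    have h3 : (0 : ℝ) < n := by linarith
    positivity
  set q : ℝ := ((n : ℝ) + 4) / ((n : ℝ) - 4) with hq
  refine ⟨κ * ∫ z : Rn n, (1 + ‖z‖ ^ 2) ^ (-((n : ℝ) + 4) / 2),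
    mul_pos hκ0 (integral_unit_bubble_pos n), fun w hw x hx => ?_⟩
  set ρ : ℕ → ℝ := fun j => 1 / ((j : ℝ) + 1) with hρ
  have hρ0 : ∀ j, 0 < ρ j := fun j => by positivity
  have hρl : Tendsto ρ atTop (𝓝[>] 0) :=
    tendsto_nhdsWithin_iff.2 ⟨tendsto_one_div_add_atTop_nhds_zero_nat,
      Eventually.of_forall fun j => hρ0 j⟩
  have hrep : ∀ j, ∫⁻ y, ENNReal.ofReal (w y ^ q * (ρ j ^ 2 + ‖y - x‖ ^ 2) ^ (-((n : ℝ) - 4) / 2))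
      = ENNReal.ofReal (κ * (ρ j ^ 4 * ∫ y, w y *
        (ρ j ^ 2 + ‖y - x‖ ^ 2) ^ (-((n : ℝ) + 4) / 2))) := fun j => by
    have e : ∫ y, w y * (ρ j ^ 2 + ‖y - x‖ ^ 2) ^ (-((n : ℝ) + 4) / 2)
        = ∫ y, u y * (ρ j ^ 2 + ‖y - x‖ ^ 2) ^ (-((n : ℝ) + 4) / 2) :=
      integral_congr_ae (hw.mul (ae_eq_refl _))
    rw [← mul_assoc, e, ← hu.lintegral_bubble (hρ0 j) x]
    refine lintegral_congr_ae ?_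
    filter_upwards [hw] with y hy
    rw [hy]
  have hwm : AEStronglyMeasurable w := hu.aestronglyMeasurable.congr hw.symm
  have hr := (tendsto_integral_bubble (w := w) (x := x)
    (fun _ h => (hu.integrable_bubble h x).congr (hw.symm.mul (ae_eq_refl _))) hwm hx).comp hρl
  have hl : Tendsto (fun j => ∫⁻ y, ENNReal.ofReal (w y ^ q *
      (ρ j ^ 2 + ‖y - x‖ ^ 2) ^ (-((n : ℝ) - 4) / 2))) atTop
      (𝓝 (∫⁻ y, ENNReal.ofReal (‖x - y‖ ^ (-((n : ℝ) - 4)) * w y ^ q))) := by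
    have := hu.nontrivial
    have hne : ∀ᵐ y : Rn n, y ≠ x := compl_mem_ae_iff.2 (measure_singleton x)
    have hwp : ∀ᵐ y : Rn n, 0 < w y := by
      filter_upwards [hw, hu.ae_pos] with y h1 h2 using h1 ▸ h2
    refine lintegral_tendsto_of_tendsto_of_monotone (fun j => ?_) ?_ ?_
    · exact ((hwm.aemeasurable.pow_const q).mul
        (contDiff_bubble (hρ0 j) x _ (m := 0)).continuous.aemeasurable).ennreal_ofReal
    · filter_upwards [hwp] with y hy
      intro i j hij
      have h1 : (i : ℝ) ≤ j := by exact_mod_cast hij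
      have h2 : ρ j ≤ ρ i := by simp only [hρ]; gcongr
      have h3 := hρ0 j
      have h4 : ρ j ^ 2 ≤ ρ i ^ 2 := by gcongr
      refine ENNReal.ofReal_le_ofReal (mul_le_mul_of_nonneg_left ?_ (by positivity))
      exact Real.rpow_le_rpow_of_nonpos (by positivity) (by linarith) (by linarith)
    · filter_upwards [hne] with y hy
      have hy0 : 0 < ‖y - x‖ := norm_pos_iff.2 (sub_ne_zero.2 hy)
      refine ENNReal.tendsto_ofReal ?_
      have e : ‖x - y‖ ^ (-((n : ℝ) - 4)) = (0 ^ 2 + ‖y - x‖ ^ 2) ^ (-((n : ℝ) - 4) / 2) := by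
        rw [norm_sub_rev, zero_pow two_ne_zero, zero_add, ← Real.rpow_natCast,
          ← Real.rpow_mul hy0.le]
        congr 1
        push_cast
        ring
      rw [e, mul_comm]
      refine Tendsto.const_mul _ (Tendsto.rpow_const ?_ (Or.inl (by positivity)))
      exact ((hρl.mono_right nhdsWithin_le_nhds).pow 2).add_const _
  simp_rw [hrep] at hl
  refine tendsto_nhds_unique hl ?_
  rw [mul_assoc, mul_comm _ (w x)]
  exact ENNReal.tendsto_ofReal (hr.const_mul κ)

end Representation

section KernelBounds

/-- The radial majorant `min (R⁻⁸ s^(4-n)) (s^(-n-4))` of the weighted kernels below. -/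
noncomputable def majorant (n : ℕ) (R s : ℝ) : ℝ :=
  min (R ^ (-8 : ℝ) * s ^ (-((n : ℝ) - 4))) (s ^ (-((n : ℝ) + 4)))

lemma measurable_majorant (n : ℕ) (R : ℝ) : Measurable (majorant n R) := by
  unfold majorant
  fun_prop

lemma majorant_nonneg (n : ℕ) {R s : ℝ} (hR : 0 < R) (hs : 0 ≤ s) : 0 ≤ majorant n R s :=
  le_min (by positivity) (by positivity)

lemma majorant_scale (n : ℕ) {R s : ℝ} (hR : 0 < R) (hs : 0 ≤ s) :
    majorant n R (R * s) = R ^ (-((n : ℝ) + 4)) * majorant n 1 s := by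
  unfold majorant
  rw [mul_min_of_nonneg _ _ (by positivity), Real.mul_rpow hR.le hs, Real.mul_rpow hR.le hs,
    Real.one_rpow, one_mul, ← mul_assoc, ← Real.rpow_add hR]
  congr 3
  ring_nf

lemma lintegral_majorant_one_lt_top {n : ℕ} (hn : 5 ≤ n) :
    ∫⁻ z : Rn n, ENNReal.ofReal (majorant n 1 ‖z‖) < ⊤ := by
  have : Nontrivial (Rn n) := by
    have : Nonempty (Fin n) := ⟨⟨0, by omega⟩⟩
    infer_instance
  suffices h : Integrable fun z : Rn n => majorant n 1 ‖z‖ from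
    (hasFiniteIntegral_iff_ofReal (Eventually.of_forall fun z =>
      majorant_nonneg n one_pos (norm_nonneg z))).1 h.2
  rw [integrable_fun_norm_addHaar, ← Ioc_union_Ioi_eq_Ioi (zero_le_one (α := ℝ))]
  have hm : Measurable fun y : ℝ => y ^ (Module.finrank ℝ (Rn n) - 1) • majorant n 1 y :=
    (measurable_id.pow_const _).smul (measurable_majorant n 1)
  have e : (Module.finrank ℝ (Rn n) - 1 : ℕ) = n - 1 := by simp
  have e' : ((n - 1 : ℕ) : ℝ) = n - 1 := by push_cast [show 1 ≤ n by omega]; ring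
  refine IntegrableOn.union ?_ ?_
  · refine Measure.integrableOn_of_bounded (M := 1) (by simp) hm.aestronglyMeasurable ?_
    refine (ae_restrict_iff' measurableSet_Ioc).2 (Eventually.of_forall fun y hy => ?_)
    rw [Real.norm_of_nonneg (smul_nonneg (pow_nonneg hy.1.le _)
      (majorant_nonneg n one_pos hy.1.le)), e, smul_eq_mul]
    calc y ^ (n - 1) * majorant n 1 y ≤ y ^ (n - 1) * (y ^ (-((n : ℝ) - 4))) :=
          mul_le_mul_of_nonneg_left ((min_le_left _ _).trans (by simp))
            (pow_nonneg hy.1.le _)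
      _ = y ^ (3 : ℝ) := by
          rw [← Real.rpow_natCast, ← Real.rpow_add hy.1, e']
          congr 1
          ring
      _ ≤ 1 := Real.rpow_le_one hy.1.le hy.2 (by norm_num)
  · refine Integrable.mono' (integrableOn_Ioi_rpow_of_lt (show (-5 : ℝ) < -1 by norm_num) one_pos)
      hm.aestronglyMeasurable ?_
    refine (ae_restrict_iff' measurableSet_Ioi).2 (Eventually.of_forall fun y hy => ?_)
    have hy0 : 0 < y := one_pos.trans hy
    rw [Real.norm_of_nonneg (smul_nonneg (pow_nonneg hy0.le _)
      (majorant_nonneg n one_pos hy0.le)), e, smul_eq_mul]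
    calc y ^ (n - 1) * majorant n 1 y ≤ y ^ (n - 1) * (y ^ (-((n : ℝ) + 4))) :=
          mul_le_mul_of_nonneg_left (min_le_right _ _) (pow_nonneg hy0.le _)
      _ = y ^ (-5 : ℝ) := by
          rw [← Real.rpow_natCast, ← Real.rpow_add hy0, e']
          congr 1
          ring

lemma lintegral_majorant (n : ℕ) {R : ℝ} (hR : 0 < R) (x : Rn n) :
    ∫⁻ z : Rn n, ENNReal.ofReal (majorant n R ‖x - z‖)
      = ENNReal.ofReal (R ^ (-4 : ℝ)) * ∫⁻ z : Rn n, ENNReal.ofReal (majorant n 1 ‖z‖) := by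
  have h1 : Measurable fun z : Rn n => ENNReal.ofReal (majorant n R ‖z‖) :=
    ((measurable_majorant n R).comp measurable_norm).ennreal_ofReal
  have h2 : Measurable fun z : Rn n => ENNReal.ofReal (majorant n 1 ‖z‖) :=
    ((measurable_majorant n 1).comp measurable_norm).ennreal_ofReal
  rw [lintegral_sub_left_eq_self (fun z : Rn n => ENNReal.ofReal (majorant n R ‖z‖)) x]
  have h3 := (Measure.map_addHaar_smul (volume : Measure (Rn n)) hR.ne')
  have h4 : ∫⁻ z, ENNReal.ofReal (majorant n R ‖z‖) ∂(Measure.map (R • ·) (volume : Measure (Rn n)))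
      = ∫⁻ z : Rn n, ENNReal.ofReal (majorant n R ‖R • z‖) :=
    lintegral_map h1 (measurable_const_smul R)
  rw [h3, lintegral_smul_measure] at h4
  have h5 : ∀ z : Rn n, ENNReal.ofReal (majorant n R ‖R • z‖)
      = ENNReal.ofReal (R ^ (-((n : ℝ) + 4))) * ENNReal.ofReal (majorant n 1 ‖z‖) := fun z => by
    rw [norm_smul_pos hR, majorant_scale n hR (norm_nonneg z), ENNReal.ofReal_mul (by positivity)]
  simp_rw [h5] at h4
  rw [lintegral_const_mul _ h2] at h4
  have hRn : 0 < R ^ n := by positivity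
  have h6 : ENNReal.ofReal (R ^ n) * ENNReal.ofReal |(R ^ Module.finrank ℝ (Rn n))⁻¹| = 1 := by
    rw [← ENNReal.ofReal_mul hRn.le]
    simp [abs_of_pos hRn, hRn.ne']
  calc ∫⁻ z : Rn n, ENNReal.ofReal (majorant n R ‖z‖)
      = ENNReal.ofReal (R ^ n) * (ENNReal.ofReal |(R ^ Module.finrank ℝ (Rn n))⁻¹| •
          ∫⁻ z : Rn n, ENNReal.ofReal (majorant n R ‖z‖)) := by
        rw [smul_eq_mul, ← mul_assoc, h6, one_mul]
    _ = _ := by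
        rw [h4, ← mul_assoc, ← ENNReal.ofReal_mul hRn.le, ← Real.rpow_natCast, ← Real.rpow_add hR]
        congr 3
        ring

/-- The Riesz kernel is dominated by the majorant near its pole. -/
lemma kernel_le_majorant (n : ℕ) {η s : ℝ} (hη : 0 < η) (hs : 0 ≤ s) (hn : (0 : ℝ) < n - 4) :
    s ^ (-((n : ℝ) - 4)) ≤ η ^ (8 : ℝ) * majorant n η s + η ^ (-((n : ℝ) - 4)) := by
  have h0 : 0 ≤ η ^ (8 : ℝ) * majorant n η s :=
    mul_nonneg (by positivity) (majorant_nonneg n hη hs)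
  rcases eq_or_lt_of_le hs with rfl | hs0
  · rw [Real.zero_rpow (by linarith)]
    positivity
  rcases le_or_gt s η with h | h
  · refine le_add_of_le_of_nonneg ?_ (by positivity)
    unfold majorant
    rw [min_eq_left]
    · rw [← mul_assoc, ← Real.rpow_add hη]
      simp
    · have : s ^ (-((n : ℝ) + 4)) = s ^ (-8 : ℝ) * s ^ (-((n : ℝ) - 4)) := by
        rw [← Real.rpow_add hs0]; congr 1; ring
      rw [this]
      exact mul_le_mul_of_nonneg_right (Real.rpow_le_rpow_of_nonpos hs0 h (by norm_num))
        (by positivity)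
  · exact le_add_of_nonneg_of_le h0 (Real.rpow_le_rpow_of_nonpos hη h.le (by linarith))

/-- The weighted Riesz kernel is dominated outside a ball by two majorants. -/
lemma weighted_kernel_le (n : ℕ) {R a b : ℝ} (hR : 0 < R) (ha : 0 ≤ a) (hb : R ≤ b)
    (hn : (0 : ℝ) < n - 4) :
    a ^ (-((n : ℝ) - 4)) * b ^ (-8 : ℝ) ≤ majorant n R b + majorant n R a := by
  have hb0 : 0 < b := hR.trans_le hb
  have hmb := majorant_nonneg n hR hb0.le
  have hma := majorant_nonneg n hR ha
  rcases eq_or_lt_of_le ha with rfl | ha0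
  · rw [Real.zero_rpow (by linarith)]
    linarith
  have e : ∀ s : ℝ, 0 < s → s ^ (-((n : ℝ) + 4)) = s ^ (-((n : ℝ) - 4)) * s ^ (-8 : ℝ) :=
    fun s hs => by rw [← Real.rpow_add hs]; congr 1; ring
  have hbR : b ^ (-8 : ℝ) ≤ R ^ (-8 : ℝ) := Real.rpow_le_rpow_of_nonpos hR hb (by norm_num)
  rcases le_or_gt b a with h | h
  · refine le_add_of_le_of_nonneg ?_ hma
    have h1 : a ^ (-((n : ℝ) - 4)) ≤ b ^ (-((n : ℝ) - 4)) :=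
      Real.rpow_le_rpow_of_nonpos hb0 h (by linarith)
    refine le_min ?_ ?_
    · rw [mul_comm]
      gcongr
    · rw [e b hb0]
      gcongr
  · refine le_add_of_nonneg_of_le hmb ?_
    have h1 : b ^ (-8 : ℝ) ≤ a ^ (-8 : ℝ) := Real.rpow_le_rpow_of_nonpos ha0 h.le (by norm_num)
    refine le_min ?_ ?_
    · rw [mul_comm]
      gcongr
    · rw [e a ha0]
      gcongr

lemma exists_kernel_bounds {n : ℕ} (hn : 5 ≤ n) : ∃ J : ℝ≥0∞, J < ⊤ ∧
    (∀ R > 0, ∀ (y : Rn n) (S : Set (Rn n)), MeasurableSet S → (∀ z ∈ S, R ≤ ‖z‖) →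
      ∫⁻ z in S, ENNReal.ofReal (‖y - z‖ ^ (-((n : ℝ) - 4)) * ‖z‖ ^ (-8 : ℝ))
        ≤ ENNReal.ofReal (R ^ (-4 : ℝ)) * J) ∧
    (∀ η > 0, ∀ (y : Rn n) (S : Set (Rn n)),
      ∫⁻ z in S, ENNReal.ofReal (‖y - z‖ ^ (-((n : ℝ) - 4)))
        ≤ ENNReal.ofReal (η ^ (4 : ℝ)) * J + ENNReal.ofReal (η ^ (-((n : ℝ) - 4))) * volume S) := by
  have hn4 : (0 : ℝ) < n - 4 := one_pos.trans_le (exponent_sub_pos hn)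
  set I := ∫⁻ z : Rn n, ENNReal.ofReal (majorant n 1 ‖z‖) with hI
  have hIlt : I < ⊤ := lintegral_majorant_one_lt_top hn
  have hmeas : ∀ (R : ℝ) (y : Rn n), Measurable fun z => ENNReal.ofReal (majorant n R ‖y - z‖) :=
    fun R y => ((measurable_majorant n R).comp
      (measurable_norm.comp (measurable_const.sub measurable_id))).ennreal_ofReal
  refine ⟨I + I, ENNReal.add_lt_top.2 ⟨hIlt, hIlt⟩, fun R hR y S hSm hS => ?_, fun η hη y S => ?_⟩
  · calc ∫⁻ z in S, ENNReal.ofReal (‖y - z‖ ^ (-((n : ℝ) - 4)) * ‖z‖ ^ (-8 : ℝ))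
        ≤ ∫⁻ z in S, (ENNReal.ofReal (majorant n R ‖0 - z‖)
            + ENNReal.ofReal (majorant n R ‖y - z‖)) := by
          refine setLIntegral_mono' hSm fun z hz => ?_
          rw [zero_sub, norm_neg, ← ENNReal.ofReal_add (majorant_nonneg n hR (norm_nonneg _))
            (majorant_nonneg n hR (norm_nonneg _))]
          exact ENNReal.ofReal_le_ofReal
            (weighted_kernel_le n hR (norm_nonneg _) (hS z hz) hn4)
      _ ≤ ∫⁻ z, (ENNReal.ofReal (majorant n R ‖0 - z‖)
            + ENNReal.ofReal (majorant n R ‖y - z‖)) := setLIntegral_le_lintegral _ _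
      _ = _ := by
          rw [lintegral_add_left (hmeas R 0), lintegral_majorant n hR, lintegral_majorant n hR,
            mul_add]
  · calc ∫⁻ z in S, ENNReal.ofReal (‖y - z‖ ^ (-((n : ℝ) - 4)))
        ≤ ∫⁻ z in S, (ENNReal.ofReal (η ^ (8 : ℝ)) * ENNReal.ofReal (majorant n η ‖y - z‖)
            + ENNReal.ofReal (η ^ (-((n : ℝ) - 4)))) := by
          refine lintegral_mono fun z => ?_
          rw [← ENNReal.ofReal_mul (by positivity), ← ENNReal.ofReal_add
            (mul_nonneg (by positivity) (majorant_nonneg n hη (norm_nonneg _))) (by positivity)]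
          exact ENNReal.ofReal_le_ofReal (kernel_le_majorant n hη (norm_nonneg _) hn4)
      _ ≤ ENNReal.ofReal (η ^ (8 : ℝ)) * (∫⁻ z, ENNReal.ofReal (majorant n η ‖y - z‖))
            + ENNReal.ofReal (η ^ (-((n : ℝ) - 4))) * volume S := by
          rw [lintegral_add_right _ measurable_const, setLIntegral_const,
            lintegral_const_mul _ (hmeas η y)]
          gcongr
          exact Measure.restrict_le_self
      _ ≤ _ := by
          rw [lintegral_majorant n hη, ← mul_assoc, ← ENNReal.ofReal_mul (by positivity),
            ← Real.rpow_add hη, show (8 : ℝ) + -4 = 4 by norm_num]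
          gcongr
          exact le_self_add

/-- The weighted potential of a set of small measure in a large ball is small. -/
lemma exists_small_potential {n : ℕ} (hn : 5 ≤ n) {r : ℝ} (hr : 0 < r) {ε : ℝ≥0∞} (hε : 0 < ε) :
    ∃ (R : ℝ) (δ : ℝ≥0∞), 0 < δ ∧ ∀ S : Set (Rn n), MeasurableSet S → (∀ z ∈ S, r ≤ ‖z‖) →
      volume (S ∩ Metric.ball 0 R) ≤ δ → ∀ y : Rn n,
      ∫⁻ z in S, ENNReal.ofReal (‖y - z‖ ^ (-((n : ℝ) - 4)) * ‖z‖ ^ (-8 : ℝ)) ≤ ε := by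
  obtain ⟨J, hJ, h1, h2⟩ := exists_kernel_bounds hn
  have hε3 : ε / 3 ≠ 0 := (ENNReal.div_pos hε.ne' (by simp)).ne'
  have hlim : ∀ a : ℝ≥0∞, a < ⊤ → Tendsto (fun t : ℝ => ENNReal.ofReal (t ^ (-4 : ℝ)) * a)
      atTop (𝓝 0) := fun a ha => by
    have := ENNReal.Tendsto.mul_const (b := a)
      (ENNReal.tendsto_ofReal (tendsto_rpow_neg_atTop (show (0 : ℝ) < 4 by norm_num)))
      (Or.inr ha.ne)
    simpa using this
  obtain ⟨R, hR0, hR⟩ := ((eventually_gt_atTop (0 : ℝ)).and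
    ((hlim J hJ).eventually (eventually_lt_nhds (pos_iff_ne_zero.2 hε3)))).exists
  obtain ⟨t, ht0, ht⟩ := ((eventually_gt_atTop (0 : ℝ)).and
    ((hlim (ENNReal.ofReal (r ^ (-8 : ℝ)) * J)
        (ENNReal.mul_lt_top ENNReal.ofReal_lt_top hJ)).eventually
      (eventually_lt_nhds (pos_iff_ne_zero.2 hε3)))).exists
  set η : ℝ := t⁻¹ with hη
  have hη0 : 0 < η := by positivity
  have hηt : η ^ (4 : ℝ) = t ^ (-4 : ℝ) := by
    rw [hη, Real.inv_rpow ht0.le, Real.rpow_neg ht0.le]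
  set K : ℝ≥0∞ := ENNReal.ofReal (r ^ (-8 : ℝ)) * ENNReal.ofReal (η ^ (-((n : ℝ) - 4))) with hK
  have hKt : K ≠ ⊤ := (ENNReal.mul_lt_top ENNReal.ofReal_lt_top ENNReal.ofReal_lt_top).ne
  refine ⟨R, ε / 3 / K, ENNReal.div_pos hε3 hKt, fun S hSm hS hvol y => ?_⟩
  have hb : MeasurableSet (Metric.ball (0 : Rn n) R) := Metric.isOpen_ball.measurableSet
  rw [← lintegral_inter_add_sdiff _ S hb]
  have h3 : ∫⁻ z in S \ Metric.ball 0 R,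
      ENNReal.ofReal (‖y - z‖ ^ (-((n : ℝ) - 4)) * ‖z‖ ^ (-8 : ℝ)) ≤ ε / 3 :=
    (h1 R hR0 y _ (MeasurableSet.diff hSm hb) fun z hz => by simpa using hz.2).trans hR.le
  have h4 : ∫⁻ z in S ∩ Metric.ball 0 R,
      ENNReal.ofReal (‖y - z‖ ^ (-((n : ℝ) - 4)) * ‖z‖ ^ (-8 : ℝ)) ≤ ε / 3 + ε / 3 := by
    calc ∫⁻ z in S ∩ Metric.ball 0 R,
          ENNReal.ofReal (‖y - z‖ ^ (-((n : ℝ) - 4)) * ‖z‖ ^ (-8 : ℝ))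
        ≤ ∫⁻ z in S ∩ Metric.ball 0 R,
          ENNReal.ofReal (r ^ (-8 : ℝ)) * ENNReal.ofReal (‖y - z‖ ^ (-((n : ℝ) - 4))) := by
          refine setLIntegral_mono' (hSm.inter hb) fun z hz => ?_
          rw [← ENNReal.ofReal_mul (by positivity), mul_comm]
          refine ENNReal.ofReal_le_ofReal (mul_le_mul_of_nonneg_right ?_ (by positivity))
          exact Real.rpow_le_rpow_of_nonpos hr (hS z hz.1) (by norm_num)
      _ = ENNReal.ofReal (r ^ (-8 : ℝ)) * ∫⁻ z in S ∩ Metric.ball 0 R,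
          ENNReal.ofReal (‖y - z‖ ^ (-((n : ℝ) - 4))) :=
          lintegral_const_mul' _ _ ENNReal.ofReal_ne_top
      _ ≤ ENNReal.ofReal (r ^ (-8 : ℝ)) * (ENNReal.ofReal (η ^ (4 : ℝ)) * J
          + ENNReal.ofReal (η ^ (-((n : ℝ) - 4))) * volume (S ∩ Metric.ball 0 R)) := by
          gcongr
          exact h2 η hη0 y _
      _ = ENNReal.ofReal (t ^ (-4 : ℝ)) * (ENNReal.ofReal (r ^ (-8 : ℝ)) * J)
          + K * volume (S ∩ Metric.ball 0 R) := by
          rw [hηt, hK]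
          ring
      _ ≤ ε / 3 + ε / 3 := by
          gcongr
          calc K * volume (S ∩ Metric.ball 0 R) ≤ K * (ε / 3 / K) := by gcongr
            _ ≤ ε / 3 := ENNReal.mul_div_le
  calc _ ≤ (ε / 3 + ε / 3) + ε / 3 := add_le_add h4 h3
    _ = ε := ENNReal.add_thirds ε

end KernelBounds

section Inversion

open EuclideanGeometry

variable {n : ℕ} {r : ℝ} {y z : Rn n}

/-- The Kelvin transform of order four with respect to the sphere of radius `r` about `0`. -/
noncomputable def kelvin (r : ℝ) (u : Rn n → ℝ) (y : Rn n) : ℝ :=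
  (r / ‖y‖) ^ ((n : ℝ) - 4) * u (inversion 0 r y)

/-- The Riesz kernel composed with an inversion in its second variable. -/
noncomputable def invKernel (r : ℝ) (y z : Rn n) : ℝ :=
  (r / ‖z‖) ^ ((n : ℝ) - 4) * ‖y - inversion 0 r z‖ ^ (-((n : ℝ) - 4))

lemma inversion_zero_eq (r : ℝ) (z : Rn n) : inversion 0 r z = (r / ‖z‖) ^ 2 • z := by
  simp [inversion]

lemma norm_inversion (r : ℝ) (z : Rn n) : ‖inversion 0 r z‖ = r ^ 2 / ‖z‖ := by
  simpa using dist_inversion_center (0 : Rn n) z r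

lemma norm_inversion_lt (hr : 0 < r) (hz : r < ‖z‖) : ‖inversion 0 r z‖ < r := by
  rw [norm_inversion, div_lt_iff₀ (hr.trans hz), sq]
  gcongr

lemma norm_inversion_sub_inversion (hy : y ≠ 0) (hz : z ≠ 0) (r : ℝ) :
    ‖inversion 0 r y - inversion 0 r z‖ = r ^ 2 / (‖y‖ * ‖z‖) * ‖y - z‖ := by
  simpa [dist_eq_norm] using dist_inversion_inversion hy hz r

lemma norm_inversion_sub (hr : 0 < r) (hy : y ≠ 0) (hz : z ≠ 0) :
    ‖inversion 0 r y - z‖ = ‖z‖ / ‖y‖ * ‖y - inversion 0 r z‖ := by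
  have h := norm_inversion_sub_inversion hy
      ((inversion_eq_center (c := (0 : Rn n)) hr.ne').not.2 hz) r
  rw [inversion_inversion _ hr.ne', norm_inversion] at h
  rw [h]
  have hy' := norm_pos_iff.2 hy
  have hz' := norm_pos_iff.2 hz
  field_simp

lemma invKernel_eq_left (hr : 0 < r) (hy : y ≠ 0) (hz : z ≠ 0) :
    (r / ‖y‖) ^ ((n : ℝ) - 4) * ‖inversion 0 r y - z‖ ^ (-((n : ℝ) - 4)) = invKernel r y z := by
  have hy' := norm_pos_iff.2 hy
  have hz' := norm_pos_iff.2 hz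
  rw [invKernel, norm_inversion_sub hr hy hz, Real.mul_rpow (by positivity) (norm_nonneg _),
    ← mul_assoc]
  congr 1
  rw [Real.rpow_neg (by positivity), ← Real.inv_rpow (by positivity),
    ← Real.mul_rpow (by positivity) (by positivity)]
  congr 1
  field_simp

lemma kernel_inversion_inversion (hr : 0 < r) (hy : y ≠ 0) (hz : z ≠ 0) :
    (r / ‖y‖) ^ ((n : ℝ) - 4) * invKernel r (inversion 0 r y) z
      = ‖y - z‖ ^ (-((n : ℝ) - 4)) := by
  have hy' := norm_pos_iff.2 hy
  have hz' := norm_pos_iff.2 hz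
  rw [invKernel, norm_inversion_sub_inversion hy hz, Real.mul_rpow (by positivity) (norm_nonneg _),
    ← mul_assoc, ← mul_assoc, Real.rpow_neg (x := r ^ 2 / (‖y‖ * ‖z‖)) (by positivity),
    ← Real.inv_rpow (by positivity), ← Real.mul_rpow (by positivity) (by positivity),
    ← Real.mul_rpow (by positivity) (by positivity)]
  rw [show r / ‖y‖ * (r / ‖z‖) * (r ^ 2 / (‖y‖ * ‖z‖))⁻¹ = 1 by field_simp, Real.one_rpow, one_mul]

lemma invKernel_lt (hr : 0 < r) (hn : (0 : ℝ) < n - 4) (hy : r < ‖y‖) (hz : r < ‖z‖)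
    (hyz : y ≠ z) : invKernel r y z < ‖y - z‖ ^ (-((n : ℝ) - 4)) := by
  have hz0 : 0 < ‖z‖ := hr.trans hz
  have hyz' : 0 < ‖y - z‖ := norm_pos_iff.2 (sub_ne_zero.2 hyz)
  have key : ‖y - z‖ < ‖z‖ / r * ‖y - inversion 0 r z‖ := by
    refine lt_of_pow_lt_pow_left₀ 2 (by positivity) ?_
    rw [mul_pow, norm_sub_sq_real, norm_sub_sq_real, norm_inversion, inversion_zero_eq,
      inner_smul_right]
    have h1 : 0 < (‖y‖ ^ 2 - r ^ 2) * (‖z‖ ^ 2 - r ^ 2) / r ^ 2 := by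
      have : r ^ 2 < ‖y‖ ^ 2 := by gcongr
      have : r ^ 2 < ‖z‖ ^ 2 := by gcongr
      exact div_pos (mul_pos (by linarith) (by linarith)) (by positivity)
    have h2 : (‖z‖ / r) ^ 2 * (‖y‖ ^ 2 - 2 * ((r / ‖z‖) ^ 2 * inner ℝ y z) + (r ^ 2 / ‖z‖) ^ 2)
        = ‖y‖ ^ 2 - 2 * inner ℝ y z + ‖z‖ ^ 2
          + (‖y‖ ^ 2 - r ^ 2) * (‖z‖ ^ 2 - r ^ 2) / r ^ 2 := by
      field_simp
      ring
    linarith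
  have e : invKernel r y z = (‖z‖ / r * ‖y - inversion 0 r z‖) ^ (-((n : ℝ) - 4)) := by
    rw [invKernel, Real.mul_rpow (by positivity) (norm_nonneg _),
      Real.rpow_neg (x := ‖z‖ / r) (by positivity), ← Real.inv_rpow (by positivity), inv_div]
  rw [e]
  exact Real.rpow_lt_rpow_of_neg hyz' key (by linarith)

lemma invKernel_nonneg (hr : 0 < r) (y z : Rn n) : 0 ≤ invKernel r y z := by
  unfold invKernel
  positivity

lemma kelvin_rpow (hr : 0 < r) (hn : (0 : ℝ) < n - 4) {u : Rn n → ℝ}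
    (hu : 0 ≤ u (inversion 0 r z)) :
    kelvin r u z ^ (((n : ℝ) + 4) / ((n : ℝ) - 4))
      = (r / ‖z‖) ^ ((n : ℝ) + 4) * u (inversion 0 r z) ^ (((n : ℝ) + 4) / ((n : ℝ) - 4)) := by
  rw [kelvin, Real.mul_rpow (by positivity) hu, ← Real.rpow_mul (by positivity),
    mul_div_cancel₀ _ hn.ne']

lemma abs_det_smul_reflection (a : ℝ) (K : Submodule ℝ (Rn n)) :
    |(a • (K.reflection : Rn n →L[ℝ] Rn n)).det| = |a ^ n| := by
  have h : (a • (K.reflection : Rn n →L[ℝ] Rn n)).det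
      = LinearMap.det (a • K.reflection.toLinearMap) := rfl
  rw [h, LinearMap.det_smul, Submodule.det_reflection, abs_mul]
  simp

lemma hasFDerivAt_inversion_zero {V : Type*} [NormedAddCommGroup V] [InnerProductSpace ℝ V]
    (r : ℝ) {z : V} (hz : z ≠ 0) :
    HasFDerivAt (inversion (0 : V) r) ((r / ‖z‖) ^ 2 •
      ((Submodule.span ℝ {z})ᗮ.reflection : V →L[ℝ] V)) z := by
  have h := hasFDerivAt_inversion (R := r) hz
  simpa only [dist_zero_right, vsub_eq_sub, sub_zero] using h

lemma lintegral_ball_inversion (hn : 0 < n) (hr : 0 < r) (F : Rn n → ℝ≥0∞) :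
    ∫⁻ z in Metric.ball 0 r, F z
      = ∫⁻ z in {z : Rn n | r < ‖z‖}, ENNReal.ofReal ((r / ‖z‖) ^ (2 * (n : ℝ)))
          * F (inversion 0 r z) := by
  have : Nontrivial (Rn n) := by
    have : Nonempty (Fin n) := ⟨⟨0, hn⟩⟩
    infer_instance
  have himg : inversion (0 : Rn n) r '' {z | r < ‖z‖} = Metric.ball 0 r \ {0} := by
    ext z
    constructor
    · rintro ⟨w, hw, rfl⟩
      refine ⟨by simpa using norm_inversion_lt hr hw, ?_⟩
      rw [mem_singleton_iff, inversion_eq_center hr.ne']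
      exact norm_pos_iff.1 (hr.trans hw)
    · rintro ⟨h1, h2⟩
      refine ⟨inversion 0 r z, ?_, inversion_inversion _ hr.ne' _⟩
      have hz : 0 < ‖z‖ := norm_pos_iff.2 h2
      have h1' : ‖z‖ < r := by simpa using h1
      rw [mem_ofPred_eq, norm_inversion, lt_div_iff₀ hz, sq]
      gcongr
  have hae : (Metric.ball (0 : Rn n) r \ {0} : Set (Rn n)) =ᵐ[volume] Metric.ball 0 r :=
    sdiff_null_ae_eq_self (measure_singleton 0)
  rw [← setLIntegral_congr hae, ← himg, lintegral_image_eq_lintegral_abs_det_fderiv_mul volume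
    (f' := fun z => (r / ‖z‖) ^ 2 • ((Submodule.span ℝ {z})ᗮ.reflection : Rn n →L[ℝ] Rn n))
    (isOpen_lt continuous_const continuous_norm).measurableSet
    (fun z hz => (hasFDerivAt_inversion_zero r (norm_pos_iff.1 (hr.trans hz))).hasFDerivWithinAt)
    (inversion_injective _ hr.ne').injOn]
  refine setLIntegral_congr_fun (isOpen_lt continuous_const continuous_norm).measurableSet
    fun z hz => ?_
  have hz0 : 0 < ‖z‖ := hr.trans hz
  congr 2
  rw [abs_det_smul_reflection, abs_of_nonneg (by positivity), ← pow_mul,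
    ← Real.rpow_natCast]
  simp

end Inversion

/-- A positive function, continuous off the at most one point of `Z`, which equals the Riesz
potential of its critical power there, up to a positive constant. -/
structure RepSolution (n : ℕ) (c : ℝ) (Z : Set (Rn n)) (u : Rn n → ℝ) : Prop where
  five_le : 5 ≤ n
  c_pos : 0 < c
  subsingleton : Z.Subsingleton
  continuousOn : ContinuousOn u Zᶜ
  pos : ∀ y ∉ Z, 0 < u y
  rep : ∀ y ∉ Z, ∫⁻ z, ENNReal.ofReal (‖y - z‖ ^ (-((n : ℝ) - 4))
    * u z ^ (((n : ℝ) + 4) / ((n : ℝ) - 4))) = ENNReal.ofReal (c * u y)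

/-- The exterior of the closed ball of radius `r` about `0`. -/
def exterior (n : ℕ) (r : ℝ) : Set (Rn n) := {z | r < ‖z‖}

/-- The set where `u` is exceeded by its Kelvin transform. -/
def excess (Z : Set (Rn n)) (u : Rn n → ℝ) (r : ℝ) : Set (Rn n) :=
  {z | r < ‖z‖ ∧ z ∉ Z ∧ u z < kelvin r u z}

namespace RepSolution

open EuclideanGeometry

variable {n : ℕ} {c r : ℝ} {Z : Set (Rn n)} {u : Rn n → ℝ}

lemma measurableSet_exterior : MeasurableSet (exterior n r) :=
  (isOpen_lt continuous_const continuous_norm).measurableSet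

lemma dim_pos (hu : RepSolution n c Z u) : (0 : ℝ) < n - 4 :=
  one_pos.trans_le (exponent_sub_pos hu.five_le)

lemma nontrivial (hu : RepSolution n c Z u) : Nontrivial (Rn n) := by
  have : Nonempty (Fin n) := ⟨⟨0, by have := hu.five_le; omega⟩⟩
  infer_instance

lemma measure_eq_zero (hu : RepSolution n c Z u) : volume Z = 0 := by
  have := hu.nontrivial
  exact hu.subsingleton.measure_zero _

lemma ae_notMem (hu : RepSolution n c Z u) : ∀ᵐ z, z ∉ Z :=
  measure_eq_zero_iff_ae_notMem.1 hu.measure_eq_zero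

lemma isOpen_compl (hu : RepSolution n c Z u) : IsOpen Zᶜ :=
  hu.subsingleton.isClosed.isOpen_compl

lemma aemeasurable (hu : RepSolution n c Z u) : AEMeasurable u := by
  have h := hu.continuousOn.aemeasurable (μ := volume) hu.isOpen_compl.measurableSet
  rwa [Measure.restrict_eq_self_of_ae_mem (s := Zᶜ) hu.ae_notMem] at h

lemma inversion_notMem (hr : 0 < r) (hZ : ∀ z ∈ Z, r < ‖z‖) {y : Rn n} (hy : r < ‖y‖) :
    inversion 0 r y ∉ Z := fun h =>
  (norm_inversion_lt hr hy).not_gt (hZ _ h)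

lemma kelvin_pos (hu : RepSolution n c Z u) (hr : 0 < r) (hZ : ∀ z ∈ Z, r < ‖z‖) {y : Rn n}
    (hy : r < ‖y‖) : 0 < kelvin r u y := by
  have h1 : 0 < ‖y‖ := hr.trans hy
  exact mul_pos (by positivity) (hu.pos _ (inversion_notMem hr hZ hy))

lemma continuousOn_kelvin (hu : RepSolution n c Z u) (hr : 0 < r) (hZ : ∀ z ∈ Z, r < ‖z‖) :
    ContinuousOn (kelvin r u) (exterior n r) := by
  have h0 : ∀ y ∈ exterior n r, ‖y‖ ≠ 0 := fun y hy => (hr.trans hy).ne'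
  refine ContinuousOn.mul ?_ ?_
  · exact (continuousOn_const.div continuous_norm.continuousOn h0).rpow_const
      fun y hy => Or.inr hu.dim_pos.le
  · refine hu.continuousOn.comp ?_ fun y hy => inversion_notMem hr hZ hy
    exact continuousOn_const.inversion continuousOn_const continuousOn_id
      fun y hy => norm_ne_zero_iff.1 (h0 y hy)

lemma isOpen_excess (hu : RepSolution n c Z u) (hr : 0 < r) (hZ : ∀ z ∈ Z, r < ‖z‖) :
    IsOpen (excess Z u r) := by
  have hopen : IsOpen (exterior n r ∩ Zᶜ) :=
    (isOpen_lt continuous_const continuous_norm).inter hu.isOpen_compl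
  have h := (((hu.continuousOn_kelvin hr hZ).mono inter_subset_left).sub
    (hu.continuousOn.mono inter_subset_right)).isOpen_inter_preimage hopen (isOpen_Ioi (a := 0))
  convert h using 1
  ext z
  simp [excess, exterior, and_assoc]

/-- The representation formula with the integral over the ball moved to its exterior. -/
lemma rep_exterior (hu : RepSolution n c Z u) (hr : 0 < r) (hZ : ∀ z ∈ Z, r < ‖z‖) {y : Rn n}
    (hy : y ∉ Z) :
    ENNReal.ofReal (c * u y) = ∫⁻ z in exterior n r,
      ENNReal.ofReal (‖y - z‖ ^ (-((n : ℝ) - 4)) * u z ^ (((n : ℝ) + 4) / ((n : ℝ) - 4))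
        + invKernel r y z * kelvin r u z ^ (((n : ℝ) + 4) / ((n : ℝ) - 4))) := by
  have := hu.nontrivial
  set q := ((n : ℝ) + 4) / ((n : ℝ) - 4) with hq
  have hm : AEMeasurable fun z => ENNReal.ofReal (‖y - z‖ ^ (-((n : ℝ) - 4)) * u z ^ q) := by
    refine AEMeasurable.ennreal_ofReal (AEMeasurable.mul ?_ (hu.aemeasurable.pow_const q))
    exact ((measurable_norm.comp (measurable_const.sub measurable_id)).pow_const _).aemeasurable
  have hb : MeasurableSet (Metric.closedBall (0 : Rn n) r) :=
      Metric.isClosed_closedBall.measurableSet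
  have hc : (Metric.closedBall (0 : Rn n) r)ᶜ = exterior n r := by
    ext z
    simp [exterior]
  have hae : (Metric.closedBall (0 : Rn n) r : Set (Rn n)) =ᵐ[volume] Metric.ball 0 r := by
    rw [← Metric.ball_union_sphere]
    exact union_ae_eq_left_of_ae_eq_empty (ae_eq_empty.2 (Measure.addHaar_sphere _ _ _))
  have hpos : ∀ᵐ z ∂volume.restrict (exterior n r), 0 < u z ∧ z ∈ exterior n r := by
    filter_upwards [ae_restrict_of_ae hu.ae_notMem, ae_restrict_mem measurableSet_exterior]
      with z h1 h2 using ⟨hu.pos z h1, h2⟩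
  rw [← hu.rep y hy, ← lintegral_add_compl _ hb, hc, setLIntegral_congr hae,
    lintegral_ball_inversion (by have := hu.five_le; omega) hr, add_comm]
  change _ + ∫⁻ z in exterior n r, _ = _
  rw [← lintegral_add_left' hm.restrict]
  refine lintegral_congr_ae ?_
  filter_upwards [hpos] with z ⟨h1, h2⟩
  have hz : 0 < ‖z‖ := hr.trans h2
  have hui := hu.pos _ (inversion_notMem hr hZ h2)
  have hk := hu.kelvin_pos hr hZ h2
  have hik := invKernel_nonneg hr y z
  rw [ENNReal.ofReal_add (by positivity) (by positivity), ← ENNReal.ofReal_mul (by positivity),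
    kelvin_rpow hr hu.dim_pos hui.le, invKernel]
  congr 2
  have e : (r / ‖z‖) ^ (2 * (n : ℝ)) = (r / ‖z‖) ^ ((n : ℝ) - 4) * (r / ‖z‖) ^ ((n : ℝ) + 4) := by
    rw [← Real.rpow_add (by positivity)]
    congr 1
    ring
  rw [e]
  ring

/-- The representation formula for the Kelvin transform. -/
lemma rep_kelvin (hu : RepSolution n c Z u) (hr : 0 < r) (hZ : ∀ z ∈ Z, r < ‖z‖) {y : Rn n}
    (hy : r < ‖y‖) :
    ENNReal.ofReal (c * kelvin r u y) = ∫⁻ z in exterior n r,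
      ENNReal.ofReal (invKernel r y z * u z ^ (((n : ℝ) + 4) / ((n : ℝ) - 4))
        + ‖y - z‖ ^ (-((n : ℝ) - 4)) * kelvin r u z ^ (((n : ℝ) + 4) / ((n : ℝ) - 4))) := by
  have hy0 : 0 < ‖y‖ := hr.trans hy
  have h := hu.rep_exterior hr hZ (inversion_notMem hr hZ hy)
  have e : c * kelvin r u y = (r / ‖y‖) ^ ((n : ℝ) - 4) * (c * u (inversion 0 r y)) := by
    rw [kelvin]; ring
  rw [e, ENNReal.ofReal_mul (by positivity), h, ← lintegral_const_mul' _ _ ENNReal.ofReal_ne_top]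
  refine setLIntegral_congr_fun measurableSet_exterior fun z hz => ?_
  have hz0 : 0 < ‖z‖ := hr.trans hz
  rw [← ENNReal.ofReal_mul (by positivity), mul_add, ← mul_assoc, ← mul_assoc,
    invKernel_eq_left hr (norm_pos_iff.1 hy0) (norm_pos_iff.1 hz0),
    kernel_inversion_inversion hr (norm_pos_iff.1 hy0) (norm_pos_iff.1 hz0)]

end RepSolution

lemma rpow_sub_rpow_le {a b q : ℝ} (ha : 0 ≤ a) (hb : 0 < b) (hq : 1 ≤ q) :
    b ^ q - a ^ q ≤ q * b ^ (q - 1) * (b - a) := by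
  have h := one_add_mul_self_le_rpow_one_add (s := a / b - 1)
    (by have := div_nonneg ha hb.le; linarith) hq
  rw [add_sub_cancel, Real.div_rpow ha hb.le, le_div_iff₀ (by positivity)] at h
  have e : b ^ q = b ^ (q - 1) * b := by
    rw [← Real.rpow_add_one hb.ne']; congr 1; ring
  have e2 : (1 + q * (a / b - 1)) * b ^ q = b ^ q - q * b ^ (q - 1) * (b - a) := by
    rw [e]
    field_simp
    ring
  linarith

namespace RepSolution

open EuclideanGeometry

variable {n : ℕ} {c r : ℝ} {Z : Set (Rn n)} {u : Rn n → ℝ}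

lemma one_le_exponent (hu : RepSolution n c Z u) : 1 ≤ ((n : ℝ) + 4) / ((n : ℝ) - 4) := by
  rw [one_le_div hu.dim_pos]
  linarith

lemma rpow_diff_le (hu : RepSolution n c Z u) (hr : 0 < r) (hZ : ∀ z ∈ Z, r < ‖z‖) {M s : ℝ}
    (hM : 0 < M) (hkM : ∀ z ∈ exterior n r, kelvin r u z ≤ M * (r / ‖z‖) ^ ((n : ℝ) - 4))
    (hs : ∀ z ∈ excess Z u r, kelvin r u z - u z ≤ s) {z : Rn n} (hz : z ∈ excess Z u r) :
    kelvin r u z ^ (((n : ℝ) + 4) / ((n : ℝ) - 4)) - u z ^ (((n : ℝ) + 4) / ((n : ℝ) - 4))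
      ≤ ((n : ℝ) + 4) / ((n : ℝ) - 4) * M ^ (((n : ℝ) + 4) / ((n : ℝ) - 4) - 1) * r ^ (8 : ℝ) * s
        * ‖z‖ ^ (-8 : ℝ) := by
  have hq := hu.one_le_exponent
  have hz0 : 0 < ‖z‖ := hr.trans hz.1
  have hk := hu.kelvin_pos hr hZ hz.1
  have hn := hu.dim_pos
  have e8 : ((n : ℝ) - 4) * (((n : ℝ) + 4) / ((n : ℝ) - 4) - 1) = 8 := by
    field_simp
    ring
  set q := ((n : ℝ) + 4) / ((n : ℝ) - 4) with hqd
  have h1 : kelvin r u z ^ (q - 1) ≤ M ^ (q - 1) * r ^ (8 : ℝ) * ‖z‖ ^ (-8 : ℝ) := by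
    calc kelvin r u z ^ (q - 1) ≤ (M * (r / ‖z‖) ^ ((n : ℝ) - 4)) ^ (q - 1) :=
          Real.rpow_le_rpow hk.le (hkM z hz.1) (by linarith)
      _ = _ := by
          rw [Real.mul_rpow hM.le (by positivity), ← Real.rpow_mul (by positivity), e8,
            Real.div_rpow hr.le hz0.le, Real.rpow_neg hz0.le]
          ring
  have h2 : 0 < kelvin r u z - u z := sub_pos.2 hz.2.2
  calc _ ≤ q * kelvin r u z ^ (q - 1) * (kelvin r u z - u z) :=
        rpow_sub_rpow_le (hu.pos z hz.2.1).le hk hq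
    _ ≤ q * (M ^ (q - 1) * r ^ (8 : ℝ) * ‖z‖ ^ (-8 : ℝ)) * s := by
        have := hs z hz
        have : 0 ≤ q := by linarith
        gcongr
    _ = _ := by ring

lemma swap_kernels_le (hu : RepSolution n c Z u) (hr : 0 < r) (hZ : ∀ z ∈ Z, r < ‖z‖) {y z : Rn n}
    (hy : r < ‖y‖) (hz : r < ‖z‖) (hyz : y ≠ z)
    (hle : kelvin r u z ≤ u z) :
    invKernel r y z * u z ^ (((n : ℝ) + 4) / ((n : ℝ) - 4))
        + ‖y - z‖ ^ (-((n : ℝ) - 4)) * kelvin r u z ^ (((n : ℝ) + 4) / ((n : ℝ) - 4))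
      ≤ ‖y - z‖ ^ (-((n : ℝ) - 4)) * u z ^ (((n : ℝ) + 4) / ((n : ℝ) - 4))
        + invKernel r y z * kelvin r u z ^ (((n : ℝ) + 4) / ((n : ℝ) - 4)) := by
  have h1 := invKernel_lt hr hu.dim_pos hy hz hyz
  have h2 := Real.rpow_le_rpow (hu.kelvin_pos hr hZ hz).le hle
    (zero_le_one.trans hu.one_le_exponent)
  nlinarith [mul_nonneg (sub_nonneg.2 h1.le) (sub_nonneg.2 h2)]

lemma excess_halving (hu : RepSolution n c Z u) (hr : 0 < r) (hZ : ∀ z ∈ Z, r < ‖z‖) {M s : ℝ}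
    (hM : 0 < M) (hkM : ∀ z ∈ exterior n r, kelvin r u z ≤ M * (r / ‖z‖) ^ ((n : ℝ) - 4))
    (hsmall : ∀ y, ENNReal.ofReal (((n : ℝ) + 4) / ((n : ℝ) - 4)
        * M ^ (((n : ℝ) + 4) / ((n : ℝ) - 4) - 1) * r ^ (8 : ℝ)) *
      ∫⁻ z in excess Z u r, ENNReal.ofReal (‖y - z‖ ^ (-((n : ℝ) - 4)) * ‖z‖ ^ (-8 : ℝ))
        ≤ ENNReal.ofReal (c / 2))
    (hs0 : 0 ≤ s) (hs : ∀ z ∈ excess Z u r, kelvin r u z - u z ≤ s) :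
    ∀ y ∈ excess Z u r, kelvin r u y - u y ≤ s / 2 := by
  intro y hy
  have := hu.nontrivial
  have hn := hu.dim_pos
  have hq := hu.one_le_exponent
  have hE := (hu.isOpen_excess hr hZ).measurableSet
  have hEsub : excess Z u r ⊆ exterior n r := fun z hz => hz.1
  have hdiff := fun z hz => hu.rpow_diff_le hr hZ hM hkM hs (z := z) hz
  have hrep := hu.rep_exterior hr hZ hy.2.1
  have hrepk := hu.rep_kelvin hr hZ hy.1
  set q := ((n : ℝ) + 4) / ((n : ℝ) - 4) with hqd
  set K := q * M ^ (q - 1) * r ^ (8 : ℝ) with hK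
  have hK0 : 0 ≤ K := by positivity
  have hsc : ENNReal.ofReal (K * s) * ∫⁻ z in excess Z u r,
      ENNReal.ofReal (‖y - z‖ ^ (-((n : ℝ) - 4)) * ‖z‖ ^ (-8 : ℝ)) ≤
          ENNReal.ofReal (c / 2 * s) := by
    rw [mul_comm K s, ENNReal.ofReal_mul hs0, mul_assoc, mul_comm (c / 2) s, ENNReal.ofReal_mul hs0]
    gcongr
    exact hsmall y
  have hm2 : Measurable ((excess Z u r).indicator fun z =>
      ENNReal.ofReal (K * s * (‖y - z‖ ^ (-((n : ℝ) - 4)) * ‖z‖ ^ (-8 : ℝ)))) := by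
    refine Measurable.indicator ?_ hE
    refine Measurable.ennreal_ofReal (Measurable.const_mul (Measurable.mul ?_ ?_) _)
    · exact (measurable_norm.comp (measurable_const.sub measurable_id)).pow_const _
    · exact measurable_norm.pow_const _
  have hne : ∀ᵐ z : Rn n, z ≠ y := compl_mem_ae_iff.2 (measure_singleton y)
  have hmain : ENNReal.ofReal (c * kelvin r u y)
      ≤ ENNReal.ofReal (c * u y) + ENNReal.ofReal (c / 2 * s) := by
    calc ENNReal.ofReal (c * kelvin r u y) ≤ ∫⁻ z in exterior n r,
          (ENNReal.ofReal (‖y - z‖ ^ (-((n : ℝ) - 4)) * u z ^ q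
            + invKernel r y z * kelvin r u z ^ q)
          + (excess Z u r).indicator (fun z =>
              ENNReal.ofReal (K * s * (‖y - z‖ ^ (-((n : ℝ) - 4)) * ‖z‖ ^ (-8 : ℝ)))) z) := by
          rw [hrepk]
          refine lintegral_mono_ae ?_
          filter_upwards [ae_restrict_of_ae hu.ae_notMem, ae_restrict_of_ae hne,
            ae_restrict_mem measurableSet_exterior] with z h1 h2 h3
          by_cases hz : z ∈ excess Z u r
          · have hz0 : 0 < ‖z‖ := hr.trans h3
            have h4 := (hu.pos z h1).le
            have h5 := (hu.kelvin_pos hr hZ h3).le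
            have h6 := invKernel_nonneg hr y z
            rw [indicator_of_mem hz, ← ENNReal.ofReal_add (by positivity) (by positivity)]
            refine ENNReal.ofReal_le_ofReal ?_
            have h7 := hdiff z hz
            have h8 : 0 ≤ ‖y - z‖ ^ (-((n : ℝ) - 4)) := by positivity
            have h9 : u z ^ q ≤ kelvin r u z ^ q :=
              Real.rpow_le_rpow h4 hz.2.2.le (by linarith)
            have h10 := mul_le_mul_of_nonneg_left h7 h8
            have h11 := mul_le_mul_of_nonneg_left h9 h6
            linarith
          · rw [indicator_of_notMem hz, add_zero]
            refine ENNReal.ofReal_le_ofReal (hu.swap_kernels_le hr hZ hy.1 h3 h2.symm ?_)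
            by_contra! h
            exact hz ⟨h3, h1, h⟩
      _ = ENNReal.ofReal (c * u y) + ∫⁻ z in excess Z u r,
            ENNReal.ofReal (K * s * (‖y - z‖ ^ (-((n : ℝ) - 4)) * ‖z‖ ^ (-8 : ℝ))) := by
          rw [lintegral_add_right _ hm2, ← hrep, lintegral_indicator hE,
            Measure.restrict_restrict_of_subset hEsub]
      _ ≤ _ := by
          gcongr
          refine le_trans (le_of_eq ?_) hsc
          rw [← lintegral_const_mul' _ _ ENNReal.ofReal_ne_top]
          refine lintegral_congr fun z => ?_
          rw [← ENNReal.ofReal_mul (by positivity)]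
  have hc := hu.c_pos
  have hup := hu.pos y hy.2.1
  rw [← ENNReal.ofReal_add (by positivity) (by positivity),
    ENNReal.ofReal_le_ofReal_iff (by positivity)] at hmain
  have : c * (kelvin r u y - u y) ≤ c * (s / 2) := by linarith
  exact le_of_mul_le_mul_left this hc

/-- If the weighted potential of the excess set is small, the excess set is empty. -/
lemma excess_eq_empty (hu : RepSolution n c Z u) (hr : 0 < r) (hZ : ∀ z ∈ Z, r < ‖z‖) {M : ℝ}
    (hM : 0 < M) (huM : ∀ z ∈ Metric.closedBall (0 : Rn n) r, u z ≤ M)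
    (hsmall : ∀ y, ENNReal.ofReal (((n : ℝ) + 4) / ((n : ℝ) - 4)
        * M ^ (((n : ℝ) + 4) / ((n : ℝ) - 4) - 1) * r ^ (8 : ℝ)) *
      ∫⁻ z in excess Z u r, ENNReal.ofReal (‖y - z‖ ^ (-((n : ℝ) - 4)) * ‖z‖ ^ (-8 : ℝ))
        ≤ ENNReal.ofReal (c / 2)) :
    excess Z u r = ∅ := by
  have hkM : ∀ z ∈ exterior n r, kelvin r u z ≤ M * (r / ‖z‖) ^ ((n : ℝ) - 4) := fun z hz => by
    rw [kelvin, mul_comm]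
    refine mul_le_mul_of_nonneg_right (huM _ ?_) (by positivity)
    simpa using (norm_inversion_lt hr hz).le
  have hpow : ∀ k : ℕ, ∀ y ∈ excess Z u r, kelvin r u y - u y ≤ M / 2 ^ k := by
    intro k
    induction k with
    | zero =>
      intro y hy
      have h1 := hkM y hy.1
      have h2 : (r / ‖y‖) ^ ((n : ℝ) - 4) ≤ 1 :=
        Real.rpow_le_one (by positivity) ((div_le_one (hr.trans hy.1)).2 (le_of_lt hy.1))
          hu.dim_pos.le
      have h3 := hu.pos y hy.2.1
      have h4 := mul_le_mul_of_nonneg_left h2 hM.le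
      simp only [pow_zero, div_one]
      linarith
    | succ k ih =>
      have := hu.excess_halving hr hZ hM hkM hsmall (by positivity) ih
      intro y hy
      rw [pow_succ, ← div_div]
      exact this y hy
  refine eq_empty_of_forall_notMem fun y hy => ?_
  have hlim : Tendsto (fun k : ℕ => M / 2 ^ k) atTop (𝓝 0) :=
    tendsto_const_nhds.div_atTop (tendsto_pow_atTop_atTop_of_one_lt one_lt_two)
  have := ge_of_tendsto' hlim fun k => hpow k y hy
  linarith [hy.2.2]

end RepSolution

namespace RepSolution

open EuclideanGeometry

variable {n : ℕ} {c r : ℝ} {Z : Set (Rn n)} {u : Rn n → ℝ}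

lemma le_of_excess_eq_empty (hE : excess Z u r = ∅) {y : Rn n} (hyZ : y ∉ Z) (hy : r < ‖y‖) :
    kelvin r u y ≤ u y := by
  by_contra! h
  exact notMem_empty y (hE ▸ (⟨hy, hyZ, h⟩ : y ∈ excess Z u r))

/-- Touching its Kelvin transform from above, a solution coincides with it. -/
lemma eq_or_lt_of_excess_eq_empty (hu : RepSolution n c Z u) (hr : 0 < r)
    (hZ : ∀ z ∈ Z, r < ‖z‖) (hE : excess Z u r = ∅) :
    (∀ y ∉ Z, r < ‖y‖ → kelvin r u y = u y) ∨ (∀ y ∉ Z, r < ‖y‖ → kelvin r u y < u y) := by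
  by_contra! h
  obtain ⟨⟨w, hwZ, hw, hwne⟩, y, hyZ, hy, hyle⟩ := h
  have := hu.nontrivial
  have heq : kelvin r u y = u y := (le_of_excess_eq_empty hE hyZ hy).antisymm hyle
  have hrep := hu.rep_exterior hr hZ hyZ
  have hrepk := hu.rep_kelvin hr hZ hy
  rw [heq] at hrepk
  have hq := hu.one_le_exponent
  have hne : ∀ᵐ z : Rn n, z ≠ y := compl_mem_ae_iff.2 (measure_singleton y)
  have hopen : IsOpen (exterior n r ∩ Zᶜ) :=
    (isOpen_lt continuous_const continuous_norm).inter hu.isOpen_compl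
  have hkm := (hu.continuousOn_kelvin hr hZ).aemeasurable (μ := volume) measurableSet_exterior
  have hG : Measurable fun z : Rn n => ‖y - z‖ ^ (-((n : ℝ) - 4)) :=
    (measurable_norm.comp (measurable_const.sub measurable_id)).pow_const _
  have hK : Measurable fun z : Rn n => invKernel r y z := by
    have h1 : Measurable fun z : Rn n => r / ‖z‖ := measurable_const.div measurable_norm
    have h2 : Measurable fun z : Rn n => inversion 0 r z := by
      simp_rw [inversion_zero_eq]
      exact (h1.pow_const 2).smul measurable_id
    exact (h1.pow_const _).mul
      ((measurable_norm.comp (measurable_const.sub h2)).pow_const _)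
  have hae := ae_eq_of_ae_le_of_lintegral_le (μ := volume.restrict (exterior n r))
    (f := fun z => ENNReal.ofReal (invKernel r y z * u z ^ (((n : ℝ) + 4) / ((n : ℝ) - 4))
        + ‖y - z‖ ^ (-((n : ℝ) - 4)) * kelvin r u z ^ (((n : ℝ) + 4) / ((n : ℝ) - 4))))
    (g := fun z => ENNReal.ofReal (‖y - z‖ ^ (-((n : ℝ) - 4)) *
        u z ^ (((n : ℝ) + 4) / ((n : ℝ) - 4))
        + invKernel r y z * kelvin r u z ^ (((n : ℝ) + 4) / ((n : ℝ) - 4)))) ?_ ?_ ?_ ?_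
  · have hae2 : u =ᵐ[volume.restrict (exterior n r ∩ Zᶜ)] kelvin r u := by
      have hae3 := ae_restrict_of_ae_restrict_of_subset
        (inter_subset_left (s := exterior n r) (t := Zᶜ)) hae
      filter_upwards [hae3, ae_restrict_of_ae hne, ae_restrict_mem hopen.measurableSet]
        with z h1 h2 ⟨h3, h4⟩
      have h5 := hu.pos z h4
      have h6 := hu.kelvin_pos hr hZ h3
      have h7 := invKernel_nonneg hr y z
      rw [ENNReal.ofReal_eq_ofReal_iff (by positivity) (by positivity)] at h1
      have h8 := invKernel_lt hr hu.dim_pos hy h3 h2.symm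
      have h9 : (‖y - z‖ ^ (-((n : ℝ) - 4)) - invKernel r y z)
          * (u z ^ (((n : ℝ) + 4) / ((n : ℝ) - 4))
            - kelvin r u z ^ (((n : ℝ) + 4) / ((n : ℝ) - 4))) = 0 := by linarith
      have h10 := (mul_eq_zero.1 h9).resolve_left (sub_ne_zero.2 h8.ne')
      exact (Real.rpow_left_inj h5.le h6.le (by linarith)).1 (sub_eq_zero.1 h10)
    have := Measure.eqOn_open_of_ae_eq hae2 hopen (hu.continuousOn.mono inter_subset_right)
      ((hu.continuousOn_kelvin hr hZ).mono inter_subset_left)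
    exact hwne (this ⟨hw, hwZ⟩).symm
  · filter_upwards [ae_restrict_of_ae hu.ae_notMem, ae_restrict_of_ae hne,
      ae_restrict_mem measurableSet_exterior] with z h1 h2 h3
    exact ENNReal.ofReal_le_ofReal (hu.swap_kernels_le hr hZ hy h3 h2.symm
      (le_of_excess_eq_empty hE h1 h3))
  · rw [← hrepk]
    exact ENNReal.ofReal_ne_top
  · exact ((hG.aemeasurable.mul (hu.aemeasurable.restrict.pow_const _)).add
      (hK.aemeasurable.mul (hkm.pow_const _))).ennreal_ofReal
  · rw [← hrep, ← hrepk]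

lemma continuousAt_kelvin_radius (hu : RepSolution n c Z u) (hr : 0 < r)
    (hZ : ∀ z ∈ Z, r < ‖z‖) {y : Rn n} (hy : r < ‖y‖) :
    ContinuousAt (fun ρ => kelvin ρ u y) r := by
  have hy0 : 0 < ‖y‖ := hr.trans hy
  refine ContinuousAt.mul ?_ ?_
  · exact (continuousAt_id.div_const _).rpow_const (Or.inr hu.dim_pos.le)
  · have h1 : ContinuousAt u (inversion 0 r y) :=
      hu.continuousOn.continuousAt (hu.isOpen_compl.mem_nhds (inversion_notMem hr hZ hy))
    exact ContinuousAt.comp (f := fun ρ : ℝ => inversion (0 : Rn n) ρ y) h1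
      (continuousAt_const.inversion continuousAt_id continuousAt_const (norm_pos_iff.1 hy0))

lemma exists_bound (hu : RepSolution n c Z u) {Λ : ℝ} (hZ : ∀ z ∈ Z, Λ < ‖z‖) :
    ∃ M, 0 < M ∧ ∀ z ∈ Metric.closedBall (0 : Rn n) Λ, u z ≤ M := by
  obtain ⟨M, hM⟩ := (isCompact_closedBall (0 : Rn n) Λ).bddAbove_image
    (hu.continuousOn.mono fun z hz h => (hZ z h).not_ge (by simpa using hz))
  exact ⟨max M 1, by positivity, fun z hz =>
    (hM (mem_image_of_mem u hz)).trans (le_max_left _ _)⟩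

/-- Moving spheres can be started. -/
lemma exists_excess_eq_empty (hu : RepSolution n c Z u) {Λ : ℝ} (hΛ : 0 < Λ)
    (hZ : ∀ z ∈ Z, Λ < ‖z‖) :
    ∃ r₀ ∈ Ioc 0 Λ, ∀ r ∈ Ioc 0 r₀, excess Z u r = ∅ := by
  obtain ⟨M, hM, huM⟩ := hu.exists_bound hZ
  obtain ⟨J, hJ, h1, -⟩ := exists_kernel_bounds hu.five_le
  have hc := hu.c_pos
  have hq := hu.one_le_exponent
  have hlim : Tendsto (fun r : ℝ => ENNReal.ofReal (((n : ℝ) + 4) / ((n : ℝ) - 4)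
      * M ^ (((n : ℝ) + 4) / ((n : ℝ) - 4) - 1) * r ^ (4 : ℝ)) * J) (𝓝 0) (𝓝 0) := by
    have h2 : ContinuousAt (fun r : ℝ => ((n : ℝ) + 4) / ((n : ℝ) - 4)
        * M ^ (((n : ℝ) + 4) / ((n : ℝ) - 4) - 1) * r ^ (4 : ℝ)) 0 :=
      continuousAt_const.mul (continuousAt_id.rpow_const (Or.inr (by norm_num)))
    have := ENNReal.Tendsto.mul_const (b := J) (ENNReal.tendsto_ofReal h2.tendsto) (Or.inr hJ.ne)
    simpa using this
  have hev := hlim.eventually (eventually_lt_nhds (ENNReal.ofReal_pos.2 (half_pos hc)))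
  obtain ⟨ε, hε, hball⟩ := Metric.eventually_nhds_iff.1 hev
  refine ⟨min Λ (ε / 2), ⟨by positivity, min_le_left _ _⟩, fun r hr => ?_⟩
  have hr0 : 0 < r := hr.1
  have hrΛ : r ≤ Λ := hr.2.trans (min_le_left _ _)
  have hrε : r < ε := (hr.2.trans (min_le_right _ _)).trans_lt (half_lt_self hε)
  have hZr : ∀ z ∈ Z, r < ‖z‖ := fun z hz => hrΛ.trans_lt (hZ z hz)
  refine hu.excess_eq_empty hr0 hZr hM
    (fun z hz => huM z (Metric.closedBall_subset_closedBall hrΛ hz)) fun y => ?_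
  calc _ ≤ ENNReal.ofReal (((n : ℝ) + 4) / ((n : ℝ) - 4)
          * M ^ (((n : ℝ) + 4) / ((n : ℝ) - 4) - 1) * r ^ (8 : ℝ)) *
        (ENNReal.ofReal (r ^ (-4 : ℝ)) * J) := by
        gcongr
        exact h1 r hr0 y _ (hu.isOpen_excess hr0 hZr).measurableSet fun z hz => hz.1.le
    _ = ENNReal.ofReal (((n : ℝ) + 4) / ((n : ℝ) - 4)
          * M ^ (((n : ℝ) + 4) / ((n : ℝ) - 4) - 1) * r ^ (4 : ℝ)) * J := by
        rw [← mul_assoc, ← ENNReal.ofReal_mul (by positivity), mul_assoc _ (r ^ (8 : ℝ)),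
          ← Real.rpow_add hr0, show (8 : ℝ) + -4 = 4 by norm_num]
    _ ≤ _ := (hball (by simpa [abs_of_pos hr0] using hrε)).le

/-- Moving spheres can be continued past a sphere where the Kelvin transform is strictly smaller. -/
lemma exists_gt_excess_eq_empty (hu : RepSolution n c Z u) {Λ s : ℝ} (hr : 0 < r) (hrs : r < s)
    (hsΛ : s ≤ Λ) (hZ : ∀ z ∈ Z, Λ < ‖z‖) (hlt : ∀ y ∉ Z, r < ‖y‖ → kelvin r u y < u y) :
    ∃ ρ ∈ Ioc r s, excess Z u ρ = ∅ := by
  obtain ⟨M, hM, huM⟩ := hu.exists_bound hZ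
  have hc := hu.c_pos
  have hq := hu.one_le_exponent
  have hΛ : 0 < Λ := by linarith
  set K := ((n : ℝ) + 4) / ((n : ℝ) - 4)
      * M ^ (((n : ℝ) + 4) / ((n : ℝ) - 4) - 1) * Λ ^ (8 : ℝ) with hK
  have hK0 : 0 < K := by positivity
  obtain ⟨R, δ, hδ, hsm⟩ := exists_small_potential hu.five_le hr
    (ε := ENNReal.ofReal (c / 2 / K)) (ENNReal.ofReal_pos.2 (by positivity))
  obtain ⟨ρ, -, hρ, hρl⟩ := exists_seq_strictAnti_tendsto' hrs
  have hρ0 : ∀ k, 0 < ρ k := fun k => hr.trans (hρ k).1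
  have hZρ : ∀ k, ∀ z ∈ Z, ρ k < ‖z‖ := fun k z hz => ((hρ k).2.le.trans hsΛ).trans_lt (hZ z hz)
  have hZr : ∀ z ∈ Z, r < ‖z‖ := fun z hz => (hrs.le.trans hsΛ).trans_lt (hZ z hz)
  have hmeas : ∀ k, MeasurableSet (excess Z u (ρ k)) :=
    fun k => (hu.isOpen_excess (hρ0 k) (hZρ k)).measurableSet
  have hlim : Tendsto (fun k => volume (excess Z u (ρ k) ∩ Metric.ball 0 R)) atTop (𝓝 0) := by
    rw [← measure_empty (μ := (volume : Measure (Rn n)))]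
    refine tendsto_measure_of_tendsto_indicator atTop
      (fun k => (hmeas k).inter Metric.isOpen_ball.measurableSet)
      (B := Metric.ball 0 R) Metric.isOpen_ball.measurableSet measure_ball_lt_top.ne
      (Eventually.of_forall fun k => inter_subset_right) fun z => ?_
    simp only [mem_empty_iff_false, iff_false]
    by_cases hzZ : z ∈ Z
    · exact Eventually.of_forall fun k h => h.1.2.1 hzZ
    rcases le_or_gt ‖z‖ r with hz | hz
    · exact Eventually.of_forall fun k h => (h.1.1.trans_le hz).not_gt (hρ k).1
    · filter_upwards [((hu.continuousAt_kelvin_radius hr hZr hz).tendsto.comp hρl).eventually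
        (eventually_lt_nhds (hlt z hzZ hz))] with k hk h
      exact h.1.2.2.not_gt hk
  obtain ⟨k, hk⟩ := (hlim.eventually (eventually_lt_nhds hδ)).exists
  refine ⟨ρ k, ⟨(hρ k).1, (hρ k).2.le⟩, hu.excess_eq_empty (hρ0 k) (hZρ k) hM (fun z hz => huM z
    (Metric.closedBall_subset_closedBall ((hρ k).2.le.trans hsΛ) hz)) fun y => ?_⟩
  calc _ ≤ ENNReal.ofReal K * ENNReal.ofReal (c / 2 / K) := by
        gcongr
        · have := hρ0 k
          rw [hK]
          gcongr
          exact (hρ k).2.le.trans hsΛ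
        · exact hsm _ (hmeas k) (fun z hz => ((hρ k).1.trans hz.1).le) hk.le y
    _ = _ := by
        rw [← ENNReal.ofReal_mul hK0.le, mul_div_cancel₀ _ hK0.ne']

theorem moving_spheres (hu : RepSolution n c Z u) {Λ : ℝ} (hZ : ∀ z ∈ Z, Λ < ‖z‖) :
    (∃ r ∈ Ioc 0 Λ, ∀ y ∉ Z, r < ‖y‖ → kelvin r u y = u y) ∨
      (∀ r ∈ Ioc 0 Λ, ∀ y ∉ Z, r < ‖y‖ → kelvin r u y ≤ u y) := by
  rcases le_or_gt Λ 0 with hΛ | hΛ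
  · exact Or.inr fun r hr => absurd (hr.1.trans_le hr.2) hΛ.not_gt
  refine or_iff_not_imp_left.2 fun hne => ?_
  obtain ⟨r₀, hr₀, hstart⟩ := hu.exists_excess_eq_empty hΛ hZ
  have hZr : ∀ r ≤ Λ, ∀ z ∈ Z, r < ‖z‖ := fun r hr z hz => hr.trans_lt (hZ z hz)
  have hIcc : Icc r₀ Λ ⊆ {r | excess Z u r = ∅} := by
    refine IsClosed.Icc_subset_of_forall_exists_gt ?_ (hstart r₀ ⟨hr₀.1, le_rfl⟩) ?_
    · refine isClosed_of_closure_subset fun r hr => ?_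
      have hrI : r ∈ Icc r₀ Λ := closure_minimal inter_subset_right isClosed_Icc hr
      have hr0 : 0 < r := hr₀.1.trans_le hrI.1
      refine ⟨eq_empty_of_forall_notMem fun y hy => ?_, hrI⟩
      have h1 := (hu.continuousAt_kelvin_radius hr0 (hZr r hrI.2) hy.1).eventually
        (eventually_gt_nhds hy.2.2)
      obtain ⟨ρ, ⟨h3, h4⟩, h5⟩ := ((mem_closure_iff_frequently.1 hr).and_eventually
        (h1.and (eventually_lt_nhds hy.1))).exists
      exact notMem_empty y (h3 ▸ (⟨h5.2, hy.2.1, h5.1⟩ : y ∈ excess Z u ρ))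
    · intro r hr s hs
      have hr0 : 0 < r := hr₀.1.trans_le hr.2.1
      have hlt : ∀ y ∉ Z, r < ‖y‖ → kelvin r u y < u y :=
        (hu.eq_or_lt_of_excess_eq_empty hr0 (hZr r hr.2.2.le) hr.1).resolve_left
          fun h => hne ⟨r, ⟨hr0, hr.2.2.le⟩, h⟩
      obtain ⟨ρ, hρ, hE⟩ := hu.exists_gt_excess_eq_empty hr0 (lt_min hs hr.2.2) (min_le_right s Λ)
        hZ hlt
      exact ⟨ρ, hE, hρ.1, hρ.2.trans (min_le_left _ _)⟩
  intro r hr y hyZ hy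
  refine le_of_excess_eq_empty ?_ hyZ hy
  rcases le_total r r₀ with h | h
  · exact hstart r ⟨hr.1, h⟩
  · exact hIcc ⟨h, hr.2⟩

end RepSolution

/-- A solution on the punctured space extends to a positive solution on the whole space. -/
def Removable (n : ℕ) (u : Rn n → ℝ) : Prop :=
  ∃ U : Rn n → ℝ, ContDiff ℝ 4 U ∧ (∀ x, 0 < U x) ∧
    (∀ x, biLap n U x = U x ^ (((n : ℝ) + 4) / ((n : ℝ) - 4))) ∧ ∀ x, x ≠ 0 → U x = u x

namespace PuncturedSolution

open EuclideanGeometry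

variable {n : ℕ} {u : Rn n → ℝ}

lemma contDiffAt (hu : PuncturedSolution n u) {x : Rn n} (hx : x ≠ 0) : ContDiffAt ℝ 4 u x :=
  hu.contDiffOn.contDiffAt (isOpen_ne.mem_nhds hx)

lemma removable_of_eventuallyEq (hu : PuncturedSolution n u) {g : Rn n → ℝ}
    (hg : ContDiffAt ℝ 4 g 0) (hg0 : 0 < g 0) (h : ∀ᶠ y in 𝓝[≠] 0, u y = g y) :
    Removable n u := by
  classical
  have := hu.nontrivial
  set U := Function.update u 0 (g 0) with hU
  have hne : ∀ x, x ≠ 0 → U x = u x := fun x hx => Function.update_of_ne hx _ _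
  have hnear : ∀ x, x ≠ 0 → U =ᶠ[𝓝 x] u := fun x hx => by
    filter_upwards [isOpen_ne.mem_nhds hx] with y hy using hne y hy
  have hU0 : U =ᶠ[𝓝 0] g := by
    filter_upwards [eventually_nhdsWithin_iff.1 h] with y hy
    rcases eq_or_ne y 0 with rfl | hy0
    · simp [hU]
    · rw [hne y hy0, hy hy0]
  have hC : ∀ x, ContDiffAt ℝ 4 U x := fun x => by
    rcases eq_or_ne x 0 with rfl | hx
    · exact hg.congr_of_eventuallyEq hU0
    · exact (hu.contDiffAt hx).congr_of_eventuallyEq (hnear x hx)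
  have heq : ∀ x, x ≠ 0 → biLap n U x = U x ^ (((n : ℝ) + 4) / ((n : ℝ) - 4)) := fun x hx => by
    rw [biLap_congr (hnear x hx), hu.eq x hx, hne x hx]
  refine ⟨U, contDiff_iff_contDiffAt.2 hC, fun x => ?_, fun x => ?_, hne⟩
  · rcases eq_or_ne x 0 with rfl | hx
    · simpa [hU] using hg0
    · rw [hne x hx]
      exact hu.pos x hx
  · rcases eq_or_ne x 0 with rfl | hx
    · have h1 : ContinuousAt (biLap n U) 0 :=
        (contDiffAt_biLap 0 (by simpa using hC 0)).continuousAt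
      have h2 : ContinuousAt (fun x => U x ^ (((n : ℝ) + 4) / ((n : ℝ) - 4))) 0 :=
        (hC 0).continuousAt.rpow_const (Or.inr hu.exponent_pos.le)
      refine tendsto_nhds_unique (l := 𝓝[≠] (0 : Rn n)) (h1.tendsto.mono_left nhdsWithin_le_nhds)
        ((h2.tendsto.mono_left nhdsWithin_le_nhds).congr' ?_)
      filter_upwards [self_mem_nhdsWithin] with y hy using (heq y hy).symm
    · exact heq x hx

/-- A solution cannot coincide near its singularity with a Kelvin transform moving that
singularity. -/
lemma removable_of_eq_kelvin (hu : PuncturedSolution n u) {x : Rn n} {r : ℝ} (hr : 0 < r)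
    (hx : x ≠ 0) (hrx : r ≠ ‖x‖)
    (h : ∀ᶠ y in 𝓝[≠] 0, u y = kelvin r (fun z => u (x + z)) (y - x)) : Removable n u := by
  have hx0 : 0 < ‖x‖ := norm_pos_iff.2 hx
  have hne : x + inversion 0 r (0 - x) ≠ 0 := by
    rw [inversion_zero_eq, zero_sub, norm_neg, smul_neg, ← sub_eq_add_neg, sub_ne_zero]
    intro he
    have h1 : ‖x‖ = (r / ‖x‖) ^ 2 * ‖x‖ := by
      conv_lhs => rw [he]
      rw [norm_smul, Real.norm_of_nonneg (by positivity)]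
    have h2 : r ^ 2 = ‖x‖ ^ 2 := by
      field_simp at h1
      linarith
    exact hrx ((pow_left_inj₀ hr.le hx0.le two_ne_zero).1 h2)
  refine hu.removable_of_eventuallyEq (g := fun y => kelvin r (fun z => u (x + z)) (y - x)) ?_ ?_ h
  · have hd : ContDiffAt ℝ 4 (fun y : Rn n => y - x) 0 := contDiffAt_id.sub contDiffAt_const
    have h0 : (0 : Rn n) - x ≠ 0 := by simpa using hx
    refine ContDiffAt.mul ?_ ?_
    · refine ContDiffAt.rpow_const_of_ne ?_ (by simpa using ⟨hr.ne', hx⟩)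
      exact contDiffAt_const.div (hd.norm ℝ h0) (by simpa using hx)
    · refine ContDiffAt.comp (f := fun y : Rn n => x + inversion (0 : Rn n) r (y - x)) 0
        (hu.contDiffAt hne) ?_
      exact contDiffAt_const.add (contDiffAt_const.inversion contDiffAt_const hd h0)
  · refine mul_pos ?_ (hu.pos _ hne)
    rw [zero_sub, norm_neg]
    positivity

lemma repSolution_translate (hu : PuncturedSolution n u) {c : ℝ} (hc : 0 < c)
    (hrep : ∀ w : Rn n → ℝ, w =ᵐ[volume] u → ∀ x, ContinuousAt w x →
      ∫⁻ y, ENNReal.ofReal (‖x - y‖ ^ (-((n : ℝ) - 4)) *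
        w y ^ (((n : ℝ) + 4) / ((n : ℝ) - 4))) = ENNReal.ofReal (c * w x))
    {w : Rn n → ℝ} (hw : w =ᵐ[volume] u) {Z : Set (Rn n)} (hZ : Z.Subsingleton)
    (hcont : ContinuousOn w Zᶜ) (hpos : ∀ y ∉ Z, 0 < w y) (x : Rn n) :
    RepSolution n c {z | x + z ∈ Z} (fun z => w (x + z)) where
  five_le := hu.five_le
  c_pos := hc
  subsingleton := fun a ha b hb => add_left_cancel (hZ ha hb)
  continuousOn := hcont.comp (continuous_const.add continuous_id).continuousOn fun y hy => hy
  pos := fun y hy => hpos _ hy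
  rep := fun y hy => by
    have h1 : ContinuousAt w (x + y) :=
      hcont.continuousAt (hZ.isClosed.isOpen_compl.mem_nhds hy)
    rw [← hrep w hw _ h1, ← lintegral_add_left_eq_self (fun z => ENNReal.ofReal
      (‖x + y - z‖ ^ (-((n : ℝ) - 4)) * w z ^ (((n : ℝ) + 4) / ((n : ℝ) - 4)))) x]
    simp only [add_sub_add_left_eq_sub]

lemma repSolution (hu : PuncturedSolution n u) : ∃ c, ∀ x : Rn n,
    RepSolution n c {z | x + z ∈ ({0} : Set (Rn n))} (fun z => u (x + z)) := by
  obtain ⟨c, hc, hrep⟩ := hu.exists_representation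
  exact ⟨c, hu.repSolution_translate hc hrep (ae_eq_refl u) subsingleton_singleton
    hu.continuousOn hu.pos⟩

/-- The moving sphere inequality for spheres not enclosing the singularity. -/
lemma kelvin_le (hu : PuncturedSolution n u) (hrem : ¬ Removable n u) {x y : Rn n} {r : ℝ}
    (hr : 0 < r) (hrx : r < ‖x‖) (hy : y ≠ 0) (hry : r < ‖y - x‖) :
    kelvin r (fun z => u (x + z)) (y - x) ≤ u y := by
  have hx : x ≠ 0 := norm_pos_iff.1 (hr.trans hrx)
  obtain ⟨c, hrep⟩ := hu.repSolution
  have hZ : ∀ z ∈ {z : Rn n | x + z ∈ ({0} : Set (Rn n))}, r < ‖z‖ := fun z hz => by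
    rw [← neg_eq_of_add_eq_zero_right hz, norm_neg]
    exact hrx
  rcases (hrep x).moving_spheres hZ with ⟨ρ, hρ, heq⟩ | hle
  · refine absurd (hu.removable_of_eq_kelvin hρ.1 hx (hρ.2.trans_lt hrx).ne ?_) hrem
    have hev : ∀ᶠ y : Rn n in 𝓝 0, ρ < ‖y - x‖ :=
      (continuous_norm.comp (continuous_id.sub continuous_const)).continuousAt.eventually
        (eventually_gt_nhds (by simpa using hρ.2.trans_lt hrx))
    filter_upwards [self_mem_nhdsWithin, nhdsWithin_le_nhds hev] with y hy0 hy1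
    have := heq (y - x) (by simpa using hy0) hy1
    rw [this]
    simp
  · have := hle r ⟨hr, le_rfl⟩ (y - x) (by simpa using hy) hry
    simpa using this

lemma le_of_norm_lt (hu : PuncturedSolution n u) (hrem : ¬ Removable n u) {y w : Rn n}
    (hy : y ≠ 0) (hyw : ‖y‖ < ‖w‖) : u w ≤ u y := by
  have hn := one_pos.trans_le (exponent_sub_pos hu.five_le)
  set d := ‖w - y‖ with hd
  have hd0 : 0 < d := by
    rw [hd, norm_pos_iff, sub_ne_zero]
    rintro rfl
    exact lt_irrefl _ hyw
  set e : Rn n := d⁻¹ • (w - y) with he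
  have he1 : ‖e‖ = 1 := by
    rw [he, norm_inv_smul_pos hd0, ← hd, div_self hd0.ne']
  have hw : w = y + d • e := by
    rw [he, smul_inv_smul₀ hd0.ne']
    abel
  have hin : 0 < 2 * inner ℝ y e + d := by
    have h1 : ‖w‖ ^ 2 = ‖y‖ ^ 2 + 2 * (d * inner ℝ y e) + d ^ 2 := by
      rw [hw, norm_add_sq_real, inner_smul_right, norm_smul_pos hd0, he1, mul_one]
    have h2 : ‖y‖ ^ 2 < ‖w‖ ^ 2 := by gcongr
    have h3 : 0 < d * (2 * inner ℝ y e + d) := by nlinarith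
    exact pos_of_mul_pos_right h3 hd0.le
  have key : ∀ R > d, (√(1 - d / R)) ^ ((n : ℝ) - 4) * u w ≤ u y := by
    intro R hR
    have hR0 : 0 < R := hd0.trans hR
    have hdR : d / R < 1 := (div_lt_one hR0).2 hR
    have hs0 : 0 < √(1 - d / R) := Real.sqrt_pos.2 (by linarith)
    have hs2 : √(1 - d / R) ^ 2 = 1 - d / R := Real.sq_sqrt (by linarith)
    have hs1 : √(1 - d / R) < 1 := by
      rw [Real.sqrt_lt' one_pos]
      have : 0 < d / R := by positivity
      linarith
    set r := R * √(1 - d / R) with hr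
    have hr0 : 0 < r := by positivity
    set x : Rn n := y + R • e with hx
    have hyx : y - x = -(R • e) := by rw [hx]; abel
    have hnyx : ‖y - x‖ = R := by rw [hyx, norm_neg, norm_smul_pos hR0, he1, mul_one]
    have hr2 : r ^ 2 = R ^ 2 - R * d := by
      rw [hr, mul_pow, hs2]
      field_simp
    have hrx : r < ‖x‖ := by
      refine lt_of_pow_lt_pow_left₀ 2 (norm_nonneg _) ?_
      rw [hr2, hx, norm_add_sq_real, inner_smul_right, norm_smul_pos hR0, he1, mul_one]
      nlinarith [mul_pos hR0 hin, sq_nonneg ‖y‖]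
    have h := hu.kelvin_le hrem hr0 hrx hy (by rw [hnyx, hr]; nlinarith)
    rw [kelvin, hnyx, inversion_zero_eq, hnyx] at h
    have e1 : r / R = √(1 - d / R) := by rw [hr]; field_simp
    have e2 : x + (r / R) ^ 2 • (y - x) = w := by
      have h1 : R - (1 - d / R) * R = d := by field_simp; ring
      have h2 : y + R • e + (1 - d / R) • -(R • e) = y + (R - (1 - d / R) * R) • e := by
        clear_value e
        module
      rw [e1, hs2, hyx, hx, h2, h1, ← hw]
    rwa [e2, e1] at h
  have hlim : Tendsto (fun R : ℝ => (√(1 - d / R)) ^ ((n : ℝ) - 4) * u w) atTop (𝓝 (u w)) := by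
    have h1 : Tendsto (fun R : ℝ => 1 - d / R) atTop (𝓝 1) := by
      simpa using (tendsto_const_nhds (x := (1 : ℝ))).sub
        (tendsto_const_nhds.div_atTop (tendsto_id (α := ℝ)))
    have h2 := ((Real.continuous_sqrt.tendsto 1).comp h1).rpow_const (p := (n : ℝ) - 4)
      (Or.inr hn.le)
    simpa using h2.mul_const (u w)
  refine le_of_tendsto hlim ?_
  filter_upwards [eventually_gt_atTop d] with R hR using key R hR

/-- A solution with non-removable singularity is radial and radially nonincreasing. -/
lemma le_of_norm_le (hu : PuncturedSolution n u) (hrem : ¬ Removable n u) {y w : Rn n}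
    (hy : y ≠ 0) (hyw : ‖y‖ ≤ ‖w‖) : u w ≤ u y := by
  have hw0 : 0 < ‖w‖ := (norm_pos_iff.2 hy).trans_le hyw
  have hw : w ≠ 0 := norm_pos_iff.1 hw0
  have hc : ContinuousAt (fun t : ℝ => u (t • w)) 1 := by
    have : ContinuousAt u ((1 : ℝ) • w) := by
      rw [one_smul]
      exact (hu.contDiffAt hw).continuousAt
    exact ContinuousAt.comp (f := fun t : ℝ => t • w) this
      (continuous_id.smul continuous_const).continuousAt
  have hl : Tendsto (fun t : ℝ => u (t • w)) (𝓝[>] 1) (𝓝 (u w)) := by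
    have := hc.tendsto
    rw [one_smul] at this
    exact this.mono_left nhdsWithin_le_nhds
  refine le_of_tendsto hl ?_
  filter_upwards [self_mem_nhdsWithin] with t ht
  have ht' : (1 : ℝ) < t := ht
  refine hu.le_of_norm_lt hrem hy (hyw.trans_lt ?_)
  rw [norm_smul_pos (by linarith)]
  nlinarith

end PuncturedSolution

/-- The Laplacian in logarithmic radial coordinates. -/
lemma lap_log_radial {n : ℕ} {g g₁ g₂ : ℝ → ℝ} (h₁ : ∀ t, HasDerivAt g (g₁ t) t)
    (h₂ : ∀ t, HasDerivAt g₁ (g₂ t) t) {x : Rn n} (hx : x ≠ 0) :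
    lap n (fun y => g (log ‖y‖)) x
      = rexp (-2 * log ‖x‖) * (g₂ (log ‖x‖) + ((n : ℝ) - 2) * g₁ (log ‖x‖)) := by
  have hx0 : 0 < ‖x‖ := norm_pos_iff.2 hx
  have hlog : ∀ y : Rn n, log (‖y‖ ^ 2) / 2 = log ‖y‖ := fun y => by
    rw [Real.log_pow]
    push_cast
    ring
  have hL : ∀ q : ℝ, 0 < q → HasDerivAt (fun q => log q / 2) (q⁻¹ / 2) q := fun q hq =>
    (Real.hasDerivAt_log hq.ne').div_const 2
  have hfun : (fun y : Rn n => g (log ‖y‖)) = fun y => g (log (‖y - 0‖ ^ 2) / 2) := by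
    funext y
    rw [sub_zero, hlog]
  have hq : 0 < ‖x - 0‖ ^ 2 := by simpa using pow_pos hx0 2
  have hd : ∀ᶠ q in 𝓝 (‖x - 0‖ ^ 2), HasDerivAt (fun q => g (log q / 2))
      (g₁ (log q / 2) * (q⁻¹ / 2)) q := by
    filter_upwards [eventually_gt_nhds hq] with q hq using (h₁ _).comp q (hL q hq)
  have hd' := ((h₂ _).comp _ (hL _ hq)).mul ((hasDerivAt_inv hq.ne').div_const 2)
  have hexp : rexp (-2 * log ‖x‖) = (‖x‖ ^ 2)⁻¹ := by
    rw [show -2 * log ‖x‖ = -(log ‖x‖ + log ‖x‖) by ring, Real.exp_neg, Real.exp_add,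
      Real.exp_log hx0, sq]
  rw [hfun, lap_comp_normSq (h := fun q => g (log q / 2)) hd hd', hexp]
  simp only [Function.comp, sub_zero, hlog]
  field_simp
  ring

lemma lap_exp_log_radial {n : ℕ} {g g₁ g₂ : ℝ → ℝ} (h₁ : ∀ t, HasDerivAt g (g₁ t) t)
    (h₂ : ∀ t, HasDerivAt g₁ (g₂ t) t) (ν : ℝ) {x : Rn n} (hx : x ≠ 0) :
    lap n (fun y => rexp (-ν * log ‖y‖) * g (log ‖y‖)) x
      = rexp (-(ν + 2) * log ‖x‖) * (g₂ (log ‖x‖) + ((n : ℝ) - 2 - 2 * ν) * g₁ (log ‖x‖)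
          + ν * (ν + 2 - n) * g (log ‖x‖)) := by
  have he : ∀ t : ℝ, HasDerivAt (fun t => rexp (-ν * t)) (rexp (-ν * t) * -ν) t := fun t => by
    simpa using ((hasDerivAt_id t).const_mul (-ν)).exp
  have e₁ : ∀ t, HasDerivAt (fun t => rexp (-ν * t) * g t)
      (rexp (-ν * t) * (g₁ t - ν * g t)) t := fun t =>
    ((he t).mul (h₁ t)).congr_deriv (by ring)
  have e₂ : ∀ t, HasDerivAt (fun t => rexp (-ν * t) * (g₁ t - ν * g t))
      (rexp (-ν * t) * (g₂ t - 2 * ν * g₁ t + ν ^ 2 * g t)) t := fun t =>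
    ((he t).mul ((h₂ t).sub ((h₁ t).const_mul ν))).congr_deriv (by
      simp only [Pi.sub_apply]
      ring)
  rw [lap_log_radial e₁ e₂ hx, show -(ν + 2) * log ‖x‖ = -2 * log ‖x‖ + -ν * log ‖x‖ by ring,
    Real.exp_add]
  ring

/-- A bounded positive solution of the profile equation with its first three derivatives. -/
structure Profile (n : ℕ) (v v₁ v₂ v₃ : ℝ → ℝ) : Prop where
  five_le : 5 ≤ n
  deriv₀ : ∀ t, HasDerivAt v (v₁ t) t
  deriv₁ : ∀ t, HasDerivAt v₁ (v₂ t) t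
  deriv₂ : ∀ t, HasDerivAt v₂ (v₃ t) t
  deriv₃ : ∀ t, HasDerivAt v₃ (A n * v₂ t + f n (v t)) t
  pos : ∀ t, 0 < v t
  bdd : ∃ M, ∀ t, v t ≤ M

namespace PuncturedSolution

variable {n : ℕ} {u : Rn n → ℝ}

lemma exists_profile_bound (hu : PuncturedSolution n u) (hrem : ¬ Removable n u) :
    ∃ M : ℝ, ∀ x : Rn n, x ≠ 0 → ‖x‖ ^ (((n : ℝ) - 4) / 2) * u x ≤ M := by
  have := hu.nontrivial
  have hn := exponent_sub_pos hu.five_le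
  obtain ⟨C, hC, hbound⟩ := hu.exists_annulus_bound
  set V := volume.real (Metric.ball (0 : Rn n) 1) with hV
  have hV0 : 0 < V := ENNReal.toReal_pos (Metric.measure_ball_pos _ _ one_pos).ne'
    measure_ball_lt_top.ne
  refine ⟨4 ^ n * C / V, fun x hx => ?_⟩
  have hx0 : 0 < ‖x‖ := norm_pos_iff.2 hx
  set r := ‖x‖ / 2 with hr
  have hr0 : 0 < r := by positivity
  have hsub : Metric.ball ((3 / 4 : ℝ) • x) (r / 2) ⊆ {y : Rn n | r ≤ ‖y‖ ∧ ‖y‖ ≤ 2 * r} := by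
    intro y hy
    have h1 : ‖y - (3 / 4 : ℝ) • x‖ < r / 2 := by simpa [dist_eq_norm] using hy
    have h2 : ‖(3 / 4 : ℝ) • x‖ = 3 / 2 * r := by rw [norm_smul_pos (by norm_num), hr]; ring
    have h3 := abs_lt.1 ((abs_norm_sub_norm_le y ((3 / 4 : ℝ) • x)).trans_lt h1)
    rw [h2] at h3
    constructor <;> linarith [h3.1, h3.2]
  have h1 : ENNReal.ofReal (u x) * volume (Metric.ball ((3 / 4 : ℝ) • x) (r / 2))
      ≤ ENNReal.ofReal (C * r ^ (((n : ℝ) + 4) / 2)) := by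
    refine le_trans ?_ (hbound r hr0)
    calc _ = ∫⁻ _ in Metric.ball ((3 / 4 : ℝ) • x) (r / 2), ENNReal.ofReal (u x) := by simp
      _ ≤ ∫⁻ y in Metric.ball ((3 / 4 : ℝ) • x) (r / 2), ENNReal.ofReal (u y) := by
        refine setLIntegral_mono' measurableSet_ball fun y hy => ENNReal.ofReal_le_ofReal ?_
        have := hsub hy
        refine hu.le_of_norm_le hrem (norm_pos_iff.1 (hr0.trans_le this.1)) ?_
        rw [show ‖x‖ = 2 * r by rw [hr]; ring]
        exact this.2
      _ ≤ _ := lintegral_mono_set hsub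
  rw [Measure.addHaar_ball _ _ (by positivity), ← ENNReal.ofReal_toReal
    (measure_ball_lt_top (μ := volume) (x := (0 : Rn n)) (r := 1)).ne,
    ← ENNReal.ofReal_mul (by positivity), ← ENNReal.ofReal_mul (hu.pos x hx).le,
    ENNReal.ofReal_le_ofReal_iff (by positivity)] at h1
  change u x * ((r / 2) ^ Module.finrank ℝ (Rn n) * V) ≤ _ at h1
  have h2 : r ^ (((n : ℝ) + 4) / 2) * r ^ (((n : ℝ) - 4) / 2) = r ^ n := by
    rw [← Real.rpow_add hr0, ← Real.rpow_natCast]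
    congr 1
    ring
  have h3 : ‖x‖ ^ (((n : ℝ) - 4) / 2) ≤ 2 ^ n * r ^ (((n : ℝ) - 4) / 2) := by
    rw [show ‖x‖ = 2 * r by rw [hr]; ring, Real.mul_rpow two_pos.le hr0.le, ← Real.rpow_natCast]
    gcongr
    · norm_num
    · linarith
  have hrm : 0 < r ^ (((n : ℝ) - 4) / 2) := by positivity
  rw [le_div_iff₀ hV0]
  rw [finrank_euclideanSpace_fin, div_pow] at h1
  have h4 : u x * (r ^ n * V) ≤ 2 ^ n * (C * r ^ (((n : ℝ) + 4) / 2)) := by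
    have : u x * (r ^ n * V) = 2 ^ n * (u x * (r ^ n / 2 ^ n * V)) := by field_simp
    rw [this]
    gcongr
  rw [← h2] at h4
  have hrp : 0 < r ^ (((n : ℝ) + 4) / 2) := by positivity
  have h5 : u x * (r ^ (((n : ℝ) - 4) / 2) * V) ≤ 2 ^ n * C := by
    refine le_of_mul_le_mul_left ?_ hrp
    linarith
  have h6 := hu.pos x hx
  calc _ ≤ 2 ^ n * r ^ (((n : ℝ) - 4) / 2) * u x * V := by gcongr
    _ = 2 ^ n * (u x * (r ^ (((n : ℝ) - 4) / 2) * V)) := by ring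
    _ ≤ 2 ^ n * (2 ^ n * C) := by gcongr
    _ = 4 ^ n * C := by
      rw [show (4 : ℝ) = 2 * 2 by norm_num, mul_pow]
      ring

/-- The radial profile in logarithmic coordinates. -/
lemma exists_profile (hu : PuncturedSolution n u) (hrem : ¬ Removable n u) :
    ∃ v : ℝ → ℝ, ContDiff ℝ 4 v ∧
      Profile n v (iteratedDeriv 1 v) (iteratedDeriv 2 v) (iteratedDeriv 3 v) ∧
      ∀ x : Rn n, x ≠ 0 → u x = ‖x‖ ^ (-(((n : ℝ) - 4) / 2)) * v (log ‖x‖) := by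
  have := hu.nontrivial
  have hn := exponent_sub_pos hu.five_le
  obtain ⟨e, he⟩ := exists_norm_eq (Rn n) zero_le_one
  have hexp : ∀ t : ℝ, rexp t • e ≠ 0 := fun t => by
    rw [← norm_pos_iff, norm_smul_pos (exp_pos t), he]
    simpa using exp_pos t
  have hnexp : ∀ t : ℝ, ‖rexp t • e‖ = rexp t := fun t => by
    rw [norm_smul_pos (exp_pos t), he, mul_one]
  obtain ⟨M, hM⟩ := hu.exists_profile_bound hrem
  set μ : ℝ := ((n : ℝ) - 4) / 2 with hμ
  set v : ℝ → ℝ := fun t => rexp (μ * t) * u (rexp t • e) with hv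
  have hrad : ∀ x : Rn n, x ≠ 0 → u x = rexp (-μ * log ‖x‖) * v (log ‖x‖) := by
    intro x hx
    have hx0 := norm_pos_iff.2 hx
    have hnx : ‖rexp (log ‖x‖) • e‖ = ‖x‖ := by rw [hnexp, Real.exp_log hx0]
    rw [hv]
    dsimp only
    rw [← mul_assoc, ← Real.exp_add, show -μ * log ‖x‖ + μ * log ‖x‖ = 0 by ring, Real.exp_zero,
      one_mul]
    exact le_antisymm (hu.le_of_norm_le hrem (hexp _) hnx.le) (hu.le_of_norm_le hrem hx hnx.ge)
  have hC : ContDiff ℝ 4 v := by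
    refine contDiff_iff_contDiffAt.2 fun t => ?_
    refine ContDiffAt.mul (by fun_prop) ?_
    exact ContDiffAt.comp (f := fun t : ℝ => rexp t • e) t (hu.contDiffAt (hexp t)) (by fun_prop)
  have hD : ∀ k : ℕ, k < 4 → ∀ t, HasDerivAt (iteratedDeriv k v) (iteratedDeriv (k + 1) v t) t := by
    intro k hk t
    rw [iteratedDeriv_succ]
    exact (hC.differentiable_iteratedDeriv k (by exact_mod_cast hk) t).hasDerivAt
  have h0 : ∀ t, HasDerivAt v (iteratedDeriv 1 v t) t := fun t => by
    simpa using hD 0 (by norm_num) t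
  have h1 := hD 1 (by norm_num)
  have h2 := hD 2 (by norm_num)
  have h3 := hD 3 (by norm_num)
  have hpos : ∀ t, 0 < v t := fun t => mul_pos (exp_pos _) (hu.pos _ (hexp t))
  refine ⟨v, hC, ⟨hu.five_le, h0, h1, h2, fun t => ?_, hpos, M, fun t => ?_⟩, fun x hx => ?_⟩
  · refine (h3 t).congr_deriv ?_
    set m := μ * (μ + 2) with hm
    have hnμ : (n : ℝ) = 2 * μ + 4 := by rw [hμ]; ring
    set z : ℝ → ℝ := fun t => iteratedDeriv 2 v t + 2 * iteratedDeriv 1 v t - m * v t with hz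
    have hlap : ∀ x : Rn n, x ≠ 0 →
        lap n u x = rexp (-(μ + 2) * log ‖x‖) * z (log ‖x‖) := by
      intro x hx
      have hev : u =ᶠ[𝓝 x] fun y => rexp (-μ * log ‖y‖) * v (log ‖y‖) := by
        filter_upwards [isOpen_ne.mem_nhds hx] with y hy using hrad y hy
      rw [lap_congr hev, lap_exp_log_radial h0 h1 μ hx, hz]
      dsimp only
      rw [hnμ, hm]
      ring
    have z1 : ∀ t, HasDerivAt z
        (iteratedDeriv 3 v t + 2 * iteratedDeriv 2 v t - m * iteratedDeriv 1 v t) t := fun t =>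
      ((h2 t).add ((h1 t).const_mul 2)).sub ((h0 t).const_mul m)
    have z2 : ∀ t, HasDerivAt
        (fun t => iteratedDeriv 3 v t + 2 * iteratedDeriv 2 v t - m * iteratedDeriv 1 v t)
        (iteratedDeriv 4 v t + 2 * iteratedDeriv 3 v t - m * iteratedDeriv 2 v t) t := fun t =>
      ((h3 t).add ((h2 t).const_mul 2)).sub ((h1 t).const_mul m)
    have hx := hexp t
    have hev : lap n u =ᶠ[𝓝 (rexp t • e)] fun y => rexp (-(μ + 2) * log ‖y‖) * z (log ‖y‖) := by
      filter_upwards [isOpen_ne.mem_nhds hx] with y hy using hlap y hy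
    have key := hu.eq _ hx
    rw [biLap, lap_congr hev, lap_exp_log_radial z1 z2 _ hx, hrad _ hx, hnexp, Real.log_exp,
      Real.mul_rpow (exp_pos _).le (hpos t).le, ← Real.exp_mul] at key
    have hexpo : -μ * t * (((n : ℝ) + 4) / ((n : ℝ) - 4)) = -(μ + 2 + 2) * t := by
      have hμ0 : μ ≠ 0 := by
        have : 0 < μ := by rw [hμ]; linarith
        exact this.ne'
      rw [hnμ]
      field_simp
      ring
    rw [hexpo] at key
    have key2 := mul_left_cancel₀ (exp_pos _).ne' key
    have hf : f n (v t) = v t ^ (((n : ℝ) + 4) / ((n : ℝ) - 4)) - B n * v t := by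
      rw [f, abs_of_pos (hpos t), ← Real.rpow_add_one (hpos t).ne', sub_add_cancel, p]
    rw [hf, ← key2, A, B, hz]
    dsimp only
    rw [hnμ, hm]
    ring
  · have := hM _ (hexp t)
    rw [hnexp, ← Real.exp_mul] at this
    rw [hv]
    dsimp only
    rwa [mul_comm μ t]
  · rw [hrad x hx, Real.rpow_def_of_pos (norm_pos_iff.2 hx), mul_comm (log ‖x‖)]

end PuncturedSolution

lemma tendsto_atTop_of_deriv_ge {y y' : ℝ → ℝ} (hy : ∀ t, HasDerivAt y (y' t) t) {ε : ℝ}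
    (hε : 0 < ε) (h : ∀ᶠ t in atTop, ε ≤ y' t) : Tendsto y atTop atTop := by
  obtain ⟨T, hT⟩ := eventually_atTop.1 h
  have hlin : Tendsto (fun t => ε * (t - T) + y T) atTop atTop :=
    tendsto_atTop_add_const_right _ _
      ((tendsto_atTop_add_const_right _ (-T) tendsto_id).const_mul_atTop hε)
  refine tendsto_atTop_mono' _ ?_ hlin
  filter_upwards [eventually_ge_atTop T] with t ht
  have hm : MonotoneOn (fun t => y t - ε * t) (Ici T) := by
    have hd : ∀ t, HasDerivAt (fun t => y t - ε * t) (y' t - ε) t := fun t =>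
      ((hy t).sub ((hasDerivAt_id t).const_mul ε)).congr_deriv (by simp)
    refine monotoneOn_of_deriv_nonneg (convex_Ici T)
      (fun t _ => (hd t).continuousAt.continuousWithinAt)
      (fun t _ => (hd t).differentiableAt.differentiableWithinAt) fun t ht => ?_
    rw [interior_Ici] at ht
    rw [(hd t).deriv]
    linarith [hT t ht.le]
  have := hm self_mem_Ici ht ht
  simp only at this
  linarith

lemma exp_mul_le_of_deriv_add_nonneg {y y' : ℝ → ℝ} (hy : ∀ t, HasDerivAt y (y' t) t) (k : ℝ)
    {a b : ℝ} (h : ∀ t ∈ Ioo a b, 0 ≤ y' t + k * y t) {t : ℝ} (ht : t ∈ Icc a b) :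
    rexp (-k * (t - a)) * y a ≤ y t := by
  have hd : ∀ t, HasDerivAt (fun t => rexp (k * (t - a)) * y t)
      (rexp (k * (t - a)) * (y' t + k * y t)) t := fun t =>
    (((((hasDerivAt_id t).sub_const a).const_mul k).exp).mul (hy t)).congr_deriv (by
      simp only [id]
      ring)
  have hm : MonotoneOn (fun t => rexp (k * (t - a)) * y t) (Icc a b) := by
    refine monotoneOn_of_deriv_nonneg (convex_Icc a b)
      (fun t _ => (hd t).continuousAt.continuousWithinAt)
      (fun t _ => (hd t).differentiableAt.differentiableWithinAt) fun t ht => ?_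
    rw [interior_Icc] at ht
    rw [(hd t).deriv]
    exact mul_nonneg (exp_pos _).le (h t ht)
  have h1 := hm (left_mem_Icc.2 (ht.1.trans ht.2)) ht ht.1
  simp only [sub_self, mul_zero, Real.exp_zero, one_mul] at h1
  calc _ ≤ rexp (-k * (t - a)) * (rexp (k * (t - a)) * y t) := by gcongr
    _ = y t := by rw [← mul_assoc, ← Real.exp_add]; simp

lemma nonneg_of_deriv_add_nonneg {y y' : ℝ → ℝ} (hy : ∀ t, HasDerivAt y (y' t) t) (k : ℝ)
    {a b : ℝ} (h : ∀ t ∈ Ioo a b, 0 ≤ y' t + k * y t) (ha : 0 ≤ y a) {t : ℝ} (ht : t ∈ Icc a b) :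
    0 ≤ y t :=
  (mul_nonneg (exp_pos _).le ha).trans (exp_mul_le_of_deriv_add_nonneg hy k h ht)

section Nonlinearity

variable {n : ℕ}

lemma one_lt_p (hn : 5 ≤ n) : 1 < p n := by
  have := exponent_sub_pos hn
  rw [p, one_lt_div (by linarith)]
  linarith

lemma continuous_f (hn : 5 ≤ n) : Continuous (f n) := by
  have h := one_lt_p hn
  refine ((continuous_abs.rpow_const fun _ => Or.inr (by linarith)).mul continuous_id).sub
    (continuous_const.mul continuous_id)

lemma f_of_pos {s : ℝ} (hs : 0 < s) : f n s = s ^ p n - B n * s := by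
  rw [f, abs_of_pos hs, ← Real.rpow_add_one hs.ne', sub_add_cancel]

lemma B_pos (hn : 5 ≤ n) : 0 < B n := by
  have := exponent_sub_pos hn
  rw [B]
  have h1 : 0 < (n : ℝ) := by linarith
  have h2 : 0 < (n : ℝ) - 4 := by linarith
  positivity

lemma A_eq : A n = ((n : ℝ) / 2) ^ 2 + (((n : ℝ) - 4) / 2) ^ 2 := by
  rw [A]
  ring

lemma B_eq : B n = ((n : ℝ) / 2) ^ 2 * (((n : ℝ) - 4) / 2) ^ 2 := by
  rw [B]
  ring

lemma a₀_pos (hn : 5 ≤ n) : 0 < a₀ n := by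
  have := exponent_sub_pos hn
  rw [a₀]
  have h1 : 0 < (n : ℝ) := by linarith
  have h2 : 0 < (n : ℝ) - 4 := by linarith
  positivity

lemma a₀_rpow (hn : 5 ≤ n) : a₀ n ^ (p n - 1) = B n := by
  have := exponent_sub_pos hn
  have h1 : 0 < (n : ℝ) := by linarith
  have h2 : 0 < (n : ℝ) - 4 := by linarith
  rw [a₀, ← Real.rpow_mul (by positivity), p,
    show ((n : ℝ) - 4) / 4 * (((n : ℝ) + 4) / ((n : ℝ) - 4) - 1) = (2 : ℕ) by
      push_cast; field_simp; ring, Real.rpow_natCast, B]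
  ring

lemma f_eq_mul (hn : 5 ≤ n) {s : ℝ} (hs : 0 < s) :
    f n s = (s ^ (p n - 1) - a₀ n ^ (p n - 1)) * s := by
  rw [f, abs_of_pos hs, a₀_rpow hn]
  ring

lemma f_a₀ (hn : 5 ≤ n) : f n (a₀ n) = 0 := by
  rw [f_eq_mul hn (a₀_pos hn), sub_self, zero_mul]

lemma f_pos (hn : 5 ≤ n) {s : ℝ} (hs : a₀ n < s) : 0 < f n s := by
  have h0 := a₀_pos hn
  have h1 := one_lt_p hn
  rw [f_eq_mul hn (h0.trans hs)]
  exact mul_pos (sub_pos.2 (Real.rpow_lt_rpow h0.le hs (by linarith))) (h0.trans hs)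

lemma f_neg (hn : 5 ≤ n) {s : ℝ} (h0 : 0 < s) (hs : s < a₀ n) : f n s < 0 := by
  have h1 := one_lt_p hn
  rw [f_eq_mul hn h0]
  exact mul_neg_of_neg_of_pos (sub_neg.2 (Real.rpow_lt_rpow h0.le hs (by linarith))) h0

end Nonlinearity

namespace Profile

variable {n : ℕ} {v v₁ v₂ v₃ w w₁ w₂ w₃ : ℝ → ℝ}

lemma const (hn : 5 ≤ n) : Profile n (fun _ => a₀ n) (fun _ => 0) (fun _ => 0) (fun _ => 0) where
  five_le := hn
  deriv₀ := fun t => hasDerivAt_const t _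
  deriv₁ := fun t => hasDerivAt_const t _
  deriv₂ := fun t => hasDerivAt_const t _
  deriv₃ := fun t => (hasDerivAt_const t _).congr_deriv (by rw [f_a₀ hn]; ring)
  pos := fun _ => a₀_pos hn
  bdd := ⟨a₀ n, fun _ => le_rfl⟩

lemma reflect (hv : Profile n v v₁ v₂ v₃) (s : ℝ) :
    Profile n (fun t => v (s - t)) (fun t => -v₁ (s - t)) (fun t => v₂ (s - t))
      (fun t => -v₃ (s - t)) := by
  have hs : ∀ t, HasDerivAt (fun t => s - t) (-1) t := fun t => by
    simpa using (hasDerivAt_id t).const_sub s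
  refine ⟨hv.five_le, fun t => ?_, fun t => ?_, fun t => ?_, fun t => ?_, fun t => hv.pos _,
    hv.bdd.imp fun M hM t => hM _⟩
  · exact ((hv.deriv₀ _).comp t (hs t)).congr_deriv (by ring)
  · exact ((hv.deriv₁ _).comp t (hs t)).neg.congr_deriv (by ring)
  · exact ((hv.deriv₂ _).comp t (hs t)).congr_deriv (by ring)
  · exact ((hv.deriv₃ _).comp t (hs t)).neg.congr_deriv (by ring)

/-- Two bounded positive profiles cannot separate along the unstable directions. -/
lemma not_separated (hv : Profile n v v₁ v₂ v₃) (hw : Profile n w w₁ w₂ w₃) (a : ℝ)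
    (h₀ : v a ≤ w a) (h₁ : 0 ≤ w₁ a - v₁ a + ((n : ℝ) - 4) / 2 * (w a - v a))
    (h₂ : 0 ≤ w₂ a - v₂ a - (((n : ℝ) - 4) / 2) ^ 2 * (w a - v a))
    (h₃ : 0 < w₃ a - v₃ a - (((n : ℝ) - 4) / 2) ^ 2 * (w₁ a - v₁ a)
      + (n : ℝ) / 2 * (w₂ a - v₂ a - (((n : ℝ) - 4) / 2) ^ 2 * (w a - v a))) : False := by
  have hn := exponent_sub_pos hv.five_le
  have hp := one_lt_p hv.five_le
  have hA := A_eq (n := n)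
  have hB := B_eq (n := n)
  have hlam0 : 0 < (n : ℝ) / 2 := by linarith
  have hmu0 : 0 < ((n : ℝ) - 4) / 2 := by linarith
  set lam := (n : ℝ) / 2
  set mu := ((n : ℝ) - 4) / 2
  set d : ℝ → ℝ := fun t => w t - v t with hd
  set χ : ℝ → ℝ := fun t => w₁ t - v₁ t + mu * (w t - v t) with hχ
  set φ : ℝ → ℝ := fun t => w₂ t - v₂ t - mu ^ 2 * (w t - v t) with hφ
  set ψ : ℝ → ℝ := fun t => w₃ t - v₃ t - mu ^ 2 * (w₁ t - v₁ t)
      + lam * (w₂ t - v₂ t - mu ^ 2 * (w t - v t)) with hψ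
  have d₀ : ∀ t, HasDerivAt d (w₁ t - v₁ t) t := fun t => (hw.deriv₀ t).sub (hv.deriv₀ t)
  have d₁ : ∀ t, HasDerivAt (fun t => w₁ t - v₁ t) (w₂ t - v₂ t) t := fun t =>
    (hw.deriv₁ t).sub (hv.deriv₁ t)
  have d₂ : ∀ t, HasDerivAt (fun t => w₂ t - v₂ t) (w₃ t - v₃ t) t := fun t =>
    (hw.deriv₂ t).sub (hv.deriv₂ t)
  have d₃ := fun t => (hw.deriv₃ t).sub (hv.deriv₃ t)
  have dχ : ∀ t, HasDerivAt χ (w₂ t - v₂ t + mu * (w₁ t - v₁ t)) t := fun t =>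
    (d₁ t).add ((d₀ t).const_mul mu)
  have dφ : ∀ t, HasDerivAt φ (w₃ t - v₃ t - mu ^ 2 * (w₁ t - v₁ t)) t := fun t =>
    (d₂ t).sub ((d₀ t).const_mul _)
  have dψ : ∀ t, HasDerivAt ψ (lam * ψ t + (w t ^ p n - v t ^ p n)) t := fun t =>
    (((d₃ t).sub ((d₁ t).const_mul (mu ^ 2))).add ((dφ t).const_mul lam)).congr_deriv (by
      rw [f_of_pos (hv.pos t), f_of_pos (hw.pos t), hA, hB, hψ]
      ring)
  have chain : ∀ b, (∀ t ∈ Ioo a b, 0 ≤ ψ t) → ∀ t ∈ Icc a b, 0 ≤ χ t ∧ 0 ≤ d t := by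
    intro b hb
    have e1 : ∀ t ∈ Icc a b, 0 ≤ φ t := fun t ht =>
      nonneg_of_deriv_add_nonneg dφ lam (fun t ht => hb t ht) h₂ ht
    have e2 : ∀ t ∈ Icc a b, 0 ≤ χ t := fun t ht =>
      nonneg_of_deriv_add_nonneg dχ (-mu) (fun t ht => by
        have := e1 t (Ioo_subset_Icc_self ht)
        simp only [hφ] at this
        simp only [hχ]
        linarith) h₁ ht
    exact fun t ht => ⟨e2 t ht, nonneg_of_deriv_add_nonneg d₀ mu
      (fun t ht => e2 t (Ioo_subset_Icc_self ht)) (sub_nonneg.2 h₀) ht⟩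
  have grow : ∀ b, (∀ t ∈ Ioo a b, 0 ≤ ψ t) → ∀ t ∈ Icc a b, ψ a ≤ ψ t := by
    intro b hb t ht
    have h1 := exp_mul_le_of_deriv_add_nonneg dψ (-lam) (a := a) (b := b) (fun s hs => by
      have h2 := (chain b hb s (Ioo_subset_Icc_self hs)).2
      have h3 := Real.rpow_le_rpow (hv.pos s).le (sub_nonneg.1 h2) (by linarith : 0 ≤ p n)
      linarith) ht
    refine le_trans ?_ h1
    refine le_mul_of_one_le_left h₃.le (Real.one_le_exp ?_)
    rw [neg_neg]
    exact mul_nonneg hlam0.le (sub_nonneg.2 ht.1)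
  have hψpos : ∀ t, a ≤ t → 0 < ψ t := by
    intro t ht
    by_contra! hneg
    have hψc : Continuous ψ := continuous_iff_continuousAt.2 fun t => (dψ t).continuousAt
    have hK : IsCompact (Icc a t ∩ ψ ⁻¹' Iic 0) :=
      isCompact_Icc.inter_right (isClosed_Iic.preimage hψc)
    obtain ⟨s, hs, hmin⟩ := hK.exists_isLeast ⟨t, ⟨ht, le_rfl⟩, hneg⟩
    have h1 : ∀ r ∈ Ioo a s, 0 ≤ ψ r := by
      intro r hr
      by_contra! h
      exact hr.2.not_ge (hmin ⟨⟨hr.1.le, hr.2.le.trans hs.1.2⟩, h.le⟩)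
    have h2 := grow s h1 s ⟨hs.1.1, le_rfl⟩
    have h3 : ψ s ≤ 0 := hs.2
    exact (h₃.trans_le h2).not_ge h3
  have hall : ∀ t, a ≤ t → ψ a ≤ ψ t ∧ 0 ≤ χ t ∧ 0 ≤ d t := fun t ht =>
    have hb : ∀ s ∈ Ioo a t, 0 ≤ ψ s := fun s hs => (hψpos s hs.1.le).le
    ⟨grow t hb t ⟨ht, le_rfl⟩, chain t hb t ⟨ht, le_rfl⟩⟩
  obtain ⟨M, hM⟩ := hw.bdd
  have hdM : ∀ t, d t ≤ M := fun t => by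
    have := hv.pos t
    have := hM t
    simp only [hd]
    linarith
  have g1 : Tendsto (fun t => φ t + lam * χ t) atTop atTop := by
    refine tendsto_atTop_of_deriv_ge (fun t => (dφ t).add ((dχ t).const_mul lam)) h₃ ?_
    filter_upwards [eventually_ge_atTop a] with t ht
    obtain ⟨k1, k2, -⟩ := hall t ht
    have k3 := mul_nonneg (mul_nonneg hlam0.le hmu0.le) k2
    simp only [hψ, hχ] at k1 k3 ⊢
    linarith
  have g2 : Tendsto (fun t => w₁ t - v₁ t + lam * d t) atTop atTop := by
    refine tendsto_atTop_of_deriv_ge (fun t => (d₁ t).add ((d₀ t).const_mul lam)) one_pos ?_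
    filter_upwards [g1.eventually_ge_atTop (1 + lam * mu * M), eventually_ge_atTop a] with t ht hta
    obtain ⟨-, -, k2⟩ := hall t hta
    have k3 := mul_le_mul_of_nonneg_left (hdM t) (mul_nonneg hlam0.le hmu0.le)
    have k4 := mul_nonneg (sq_nonneg mu) k2
    simp only [hφ, hχ, hd] at ht k3 k4 ⊢
    linarith
  have g3 : Tendsto d atTop atTop := by
    refine tendsto_atTop_of_deriv_ge d₀ one_pos ?_
    filter_upwards [g2.eventually_ge_atTop (1 + lam * M)] with t ht
    have := mul_le_mul_of_nonneg_left (hdM t) hlam0.le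
    linarith
  obtain ⟨t, ht⟩ := (g3.eventually_gt_atTop M).exists
  exact ht.not_ge (hdM t)

end Profile

namespace Profile

variable {n : ℕ} {v v₁ v₂ v₃ w w₁ w₂ w₃ : ℝ → ℝ}

lemma exists_lipschitz (hv : Profile n v v₁ v₂ v₃) (hw : Profile n w w₁ w₂ w₃) :
    ∃ K : ℝ, 0 ≤ K ∧ ∀ t, |f n (w t) - f n (v t)| ≤ K * |w t - v t| := by
  have hp := one_lt_p hv.five_le
  have hB := B_pos hv.five_le
  obtain ⟨M, hM⟩ := hv.bdd
  obtain ⟨N, hN⟩ := hw.bdd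
  set L := max M N with hL
  have hL0 : 0 < L := (hv.pos 0).trans_le ((hM 0).trans (le_max_left _ _))
  have key : ∀ a b, 0 < a → a ≤ b → b ≤ L →
      0 ≤ b ^ p n - a ^ p n ∧ b ^ p n - a ^ p n ≤ p n * L ^ (p n - 1) * (b - a) := by
    intro a b ha hab hb
    refine ⟨sub_nonneg.2 (Real.rpow_le_rpow ha.le hab (by linarith)), ?_⟩
    refine (rpow_sub_rpow_le ha.le (ha.trans_le hab) hp.le).trans ?_
    have hb0 : 0 ≤ b := (ha.trans_le hab).le
    have h1 : b ^ (p n - 1) ≤ L ^ (p n - 1) := Real.rpow_le_rpow hb0 hb (by linarith)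
    have h2 : 0 ≤ b - a := sub_nonneg.2 hab
    gcongr
  refine ⟨p n * L ^ (p n - 1) + B n, by positivity, fun t => ?_⟩
  have hva := (hM t).trans (le_max_left M N)
  have hwa := (hN t).trans (le_max_right M N)
  rw [f_of_pos (hv.pos t), f_of_pos (hw.pos t),
    show w t ^ p n - B n * w t - (v t ^ p n - B n * v t)
      = (w t ^ p n - v t ^ p n) - B n * (w t - v t) by ring, add_mul]
  refine (abs_sub _ _).trans ?_
  rw [abs_mul, abs_of_pos hB]
  gcongr
  rcases le_total (v t) (w t) with h | h
  · obtain ⟨h1, h2⟩ := key _ _ (hv.pos t) h hwa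
    rwa [abs_of_nonneg h1, abs_of_nonneg (sub_nonneg.2 h)]
  · obtain ⟨h1, h2⟩ := key _ _ (hw.pos t) h hva
    rwa [abs_sub_comm, abs_of_nonneg h1, abs_sub_comm, abs_of_nonneg (sub_nonneg.2 h)]

lemma eq_of_initial_of_le (hv : Profile n v v₁ v₂ v₃) (hw : Profile n w w₁ w₂ w₃) {a : ℝ}
    (h₀ : v a = w a) (h₁ : v₁ a = w₁ a) (h₂ : v₂ a = w₂ a) (h₃ : v₃ a = w₃ a) {t : ℝ}
    (ht : a ≤ t) : v t = w t := by
  obtain ⟨K, hK, hlip⟩ := hv.exists_lipschitz hw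
  have hA : 0 ≤ A n := by rw [A_eq]; positivity
  have d₀ := fun t => (hw.deriv₀ t).sub (hv.deriv₀ t)
  have d₁ := fun t => (hw.deriv₁ t).sub (hv.deriv₁ t)
  have d₂ := fun t => (hw.deriv₂ t).sub (hv.deriv₂ t)
  have d₃ := fun t => (hw.deriv₃ t).sub (hv.deriv₃ t)
  have dS := fun t => ((((d₀ t).pow 2).add ((d₁ t).pow 2)).add
    (((d₂ t).pow 2).add ((d₃ t).pow 2))).neg
  have h := exp_mul_le_of_deriv_add_nonneg dS (-(2 + A n + K)) (a := a) (b := t) (fun s _ => ?_)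
    ⟨ht, le_rfl⟩
  · simp only [Pi.neg_apply, Pi.add_apply, Pi.pow_apply, Pi.sub_apply, h₀, h₁, h₂, h₃] at h
    have h5 : (w t - v t) ^ 2 ≤ 0 := by
      nlinarith [sq_nonneg (w₁ t - v₁ t), sq_nonneg (w₂ t - v₂ t), sq_nonneg (w₃ t - v₃ t)]
    have h6 : w t - v t = 0 := by
      have := sq_nonneg (w t - v t)
      exact pow_eq_zero_iff two_ne_zero |>.1 (le_antisymm h5 this)
    linarith
  · simp only [Pi.neg_apply, Pi.add_apply, Pi.pow_apply, Pi.sub_apply]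
    have h1 : (f n (w s) - f n (v s)) * (w₃ s - v₃ s)
        ≤ K * ((w s - v s) ^ 2 + (w₃ s - v₃ s) ^ 2) / 2 := by
      calc _ ≤ |f n (w s) - f n (v s)| * |w₃ s - v₃ s| := by
            rw [← abs_mul]; exact le_abs_self _
        _ ≤ K * |w s - v s| * |w₃ s - v₃ s| := by gcongr; exact hlip s
        _ ≤ _ := by
          rw [← sq_abs (w s - v s), ← sq_abs (w₃ s - v₃ s)]
          nlinarith [mul_nonneg hK (sq_nonneg (|w s - v s| - |w₃ s - v₃ s|))]
    have h2 := mul_nonneg hA (sq_nonneg ((w₂ s - v₂ s) - (w₃ s - v₃ s)))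
    have h3 := mul_nonneg hA (add_nonneg (sq_nonneg (w s - v s)) (sq_nonneg (w₁ s - v₁ s)))
    have h4 := mul_nonneg hK (add_nonneg (sq_nonneg (w₂ s - v₂ s)) (sq_nonneg (w₁ s - v₁ s)))
    have h5 := sq_nonneg ((w s - v s) - (w₁ s - v₁ s))
    have h6 := sq_nonneg ((w₁ s - v₁ s) - (w₂ s - v₂ s))
    have h7 := sq_nonneg ((w₂ s - v₂ s) - (w₃ s - v₃ s))
    have h8 := sq_nonneg (w s - v s)
    have h9 := sq_nonneg (w₃ s - v₃ s)
    norm_num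
    nlinarith

lemma eq_of_initial (hv : Profile n v v₁ v₂ v₃) (hw : Profile n w w₁ w₂ w₃) {a : ℝ}
    (h₀ : v a = w a) (h₁ : v₁ a = w₁ a) (h₂ : v₂ a = w₂ a) (h₃ : v₃ a = w₃ a) (t : ℝ) :
    v t = w t := by
  rcases le_total a t with h | h
  · exact hv.eq_of_initial_of_le hw h₀ h₁ h₂ h₃ h
  · have := (hv.reflect (2 * a)).eq_of_initial_of_le (hw.reflect (2 * a)) (a := a)
      (t := 2 * a - t)
    ring_nf at this
    exact this h₀ (by rw [h₁]) h₂ (by rw [h₃]) (by linarith)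

lemma eq_of_touch_aux (hv : Profile n v v₁ v₂ v₃) (hw : Profile n w w₁ w₂ w₃) {a : ℝ}
    (h₀ : v a = w a) (h₁ : v₁ a = w₁ a) (h₂ : v₂ a ≤ w₂ a) (h₃ : v₃ a ≤ w₃ a) :
    v₂ a = w₂ a ∧ v₃ a = w₃ a := by
  have hn := exponent_sub_pos hv.five_le
  by_contra hne
  refine hv.not_separated hw a h₀.le (by simp [h₀, h₁]) (by simpa [h₀] using h₂) ?_
  simp only [h₀, h₁, sub_self, mul_zero, sub_zero]
  by_contra! hle
  have h4 : 0 ≤ (n : ℝ) / 2 * (w₂ a - v₂ a) := mul_nonneg (by linarith) (by linarith)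
  have h5 : v₃ a = w₃ a := by linarith
  have h6 : (n : ℝ) / 2 * (w₂ a - v₂ a) = 0 := by linarith
  rcases mul_eq_zero.1 h6 with h7 | h7
  · linarith
  · exact hne ⟨by linarith, h5⟩

/-- Profiles which are tangent at some point coincide. -/
lemma eq_of_touch (hv : Profile n v v₁ v₂ v₃) (hw : Profile n w w₁ w₂ w₃) {a : ℝ}
    (h₀ : v a = w a) (h₁ : v₁ a = w₁ a) (t : ℝ) : v t = w t := by
  suffices h : v₂ a = w₂ a ∧ v₃ a = w₃ a from hv.eq_of_initial hw h₀ h₁ h.1 h.2 t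
  have e : 2 * a - a = a := by ring
  rcases le_total (v₂ a) (w₂ a) with h2 | h2 <;> rcases le_total (v₃ a) (w₃ a) with h3 | h3
  · exact hv.eq_of_touch_aux hw h₀ h₁ h2 h3
  · have := (hv.reflect (2 * a)).eq_of_touch_aux (hw.reflect (2 * a)) (a := a)
    simp only [e, neg_inj, neg_le_neg_iff] at this
    exact this h₀ h₁ h2 h3
  · have := (hw.reflect (2 * a)).eq_of_touch_aux (hv.reflect (2 * a)) (a := a)
    simp only [e, neg_inj, neg_le_neg_iff] at this
    exact (this h₀.symm h₁.symm h2 h3).imp Eq.symm Eq.symm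
  · exact (hw.eq_of_touch_aux hv h₀.symm h₁.symm h2 h3).imp Eq.symm Eq.symm

lemma symmetric (hv : Profile n v v₁ v₂ v₃) {a : ℝ} (ha : v₁ a = 0) (t : ℝ) :
    v (2 * a - t) = v t := by
  refine ((hv.reflect (2 * a)).eq_of_touch hv (a := a) ?_ ?_ t) <;>
    simp [show 2 * a - a = a by ring, ha]

lemma periodic (hv : Profile n v v₁ v₂ v₃) {a b : ℝ} (ha : v₁ a = 0) (hb : v₁ b = 0) :
    Function.Periodic v (2 * (b - a)) := fun t => by
  rw [← hv.symmetric ha t, ← hv.symmetric hb]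
  ring_nf

lemma periodic_deriv {g g' : ℝ → ℝ} {L : ℝ} (hg : ∀ t, HasDerivAt g (g' t) t)
    (h : Function.Periodic g L) : Function.Periodic g' L := fun t => by
  have h1 : HasDerivAt (fun t => g (t + L)) (g' (t + L)) t := (hg (t + L)).comp_add_const t L
  have h2 : (fun t => g (t + L)) = g := funext h
  rw [h2] at h1
  exact h1.unique (hg t)

lemma eq_const_of_le (hv : Profile n v v₁ v₂ v₃) {L : ℝ} (hL : 0 < L)
    (hper : Function.Periodic v L) (hle : ∀ t, a₀ n ≤ v t) : v = fun _ => a₀ n := by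
  have p₁ := periodic_deriv hv.deriv₀ hper
  have p₂ := periodic_deriv hv.deriv₁ p₁
  have p₃ := periodic_deriv hv.deriv₂ p₂
  have hH : ∀ t, HasDerivAt (fun t => v₃ t - A n * v₁ t) (f n (v t)) t := fun t =>
    ((hv.deriv₃ t).sub ((hv.deriv₁ t).const_mul (A n))).congr_deriv (by ring)
  have hf : ∀ t, 0 ≤ f n (v t) := fun t => by
    rcases (hle t).eq_or_lt with h | h
    · rw [← h, f_a₀ hv.five_le]
    · exact (f_pos hv.five_le h).le
  have hmono : Monotone (fun t => v₃ t - A n * v₁ t) :=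
    monotone_of_deriv_nonneg (fun t => (hH t).differentiableAt) fun t => by
      rw [(hH t).deriv]; exact hf t
  funext t
  refine le_antisymm ?_ (hle t)
  by_contra! hlt
  have hfp := f_pos hv.five_le hlt
  have hev : ∀ᶠ s in 𝓝[>] t, v₃ s - A n * v₁ s = v₃ t - A n * v₁ t := by
    filter_upwards [Ioo_mem_nhdsGT (show t < t + L by linarith)] with s hs
    refine le_antisymm ?_ (hmono hs.1.le)
    have := hmono hs.2.le
    simp only [p₃ t, p₁ t] at this
    exact this
  have h1 : HasDerivWithinAt (fun t => v₃ t - A n * v₁ t) 0 (Ioi t) t :=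
    (hasDerivWithinAt_const t _ (v₃ t - A n * v₁ t)).congr_of_eventuallyEq hev rfl
  have h2 := (uniqueDiffWithinAt_Ioi t).eq_deriv _ h1 (hH t).hasDerivWithinAt
  exact hfp.ne h2

lemma classification_of_periodic (hv : Profile n v v₁ v₂ v₃) {L : ℝ} (hL : 0 < L)
    (hper : Function.Periodic v L) :
    v = (fun _ => a₀ n) ∨ ∃ a ∈ Ioo 0 (a₀ n), (∀ t, a ≤ v t) ∧ ∃ t, v t = a := by
  have hc : Continuous v := continuous_iff_continuousAt.2 fun t => (hv.deriv₀ t).continuousAt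
  obtain ⟨s, -, hs⟩ := isCompact_Icc.exists_isMinOn (nonempty_Icc.2 hL.le) hc.continuousOn
  have hmin : ∀ t, v s ≤ v t := fun t => by
    obtain ⟨r, hr, hrt⟩ := hper.exists_mem_Ico₀ hL t
    rw [hrt]
    exact hs (Ico_subset_Icc_self hr)
  rcases lt_or_ge (v s) (a₀ n) with h | h
  · exact Or.inr ⟨v s, ⟨hv.pos s, h⟩, hmin, s, rfl⟩
  · exact Or.inl (hv.eq_const_of_le hL hper fun t => h.trans (hmin t))

/-- A profile cannot approach another one monotonically with a one-signed right-hand side. -/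
lemma not_asymptotic (hv : Profile n v v₁ v₂ v₃) (hw : Profile n w w₁ w₂ w₃) {T : ℝ}
    (h₀ : ∀ t, T < t → v t < w t) (h₁ : ∀ t, T < t → w₁ t ≤ v₁ t)
    (hf : ∀ t, T < t → f n (v t) ≤ f n (w t))
    (hlim : Tendsto (fun t => w t - v t) atTop (𝓝 0)) : False := by
  have hn := exponent_sub_pos hv.five_le
  have hA : 0 < A n := by
    have : 0 < (n : ℝ) := by linarith
    rw [A_eq]
    positivity
  set y : ℝ → ℝ := fun t => w₂ t - v₂ t - A n * (w t - v t) with hy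
  have dd₀ := fun t => (hw.deriv₀ t).sub (hv.deriv₀ t)
  have dd₁ := fun t => (hw.deriv₁ t).sub (hv.deriv₁ t)
  have dy : ∀ t, HasDerivAt y (w₃ t - v₃ t - A n * (w₁ t - v₁ t)) t := fun t =>
    ((hw.deriv₂ t).sub (hv.deriv₂ t)).sub ((dd₀ t).const_mul (A n))
  have dy₁ : ∀ t, HasDerivAt (fun t => w₃ t - v₃ t - A n * (w₁ t - v₁ t))
      (f n (w t) - f n (v t)) t := fun t =>
    (((hw.deriv₃ t).sub (hv.deriv₃ t)).sub ((dd₁ t).const_mul (A n))).congr_deriv (by ring)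
  have hmono : MonotoneOn (fun t => w₃ t - v₃ t - A n * (w₁ t - v₁ t)) (Ioi T) := by
    refine monotoneOn_of_deriv_nonneg (convex_Ioi T)
      (fun t _ => (dy₁ t).continuousAt.continuousWithinAt)
      (fun t _ => (dy₁ t).differentiableAt.differentiableWithinAt) fun t ht => ?_
    rw [interior_Ioi] at ht
    rw [(dy₁ t).deriv]
    linarith [hf t ht]
  have hbdd : ¬ Tendsto (fun t => w t - v t) atTop atTop := not_tendsto_atTop_of_tendsto_nhds hlim
  have hbdd' : ¬ Tendsto (fun t => -(w t - v t)) atTop atTop :=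
    not_tendsto_atTop_of_tendsto_nhds hlim.neg
  have hy₁ : ∀ t, T < t → w₃ t - v₃ t - A n * (w₁ t - v₁ t) ≤ 0 := by
    intro t ht
    by_contra! hpos
    have g1 : Tendsto y atTop atTop := by
      refine tendsto_atTop_of_deriv_ge dy hpos ?_
      filter_upwards [eventually_ge_atTop t] with s hs using hmono ht (ht.trans_le hs) hs
    have g2 : Tendsto (fun t => w₁ t - v₁ t) atTop atTop := by
      refine tendsto_atTop_of_deriv_ge dd₁ one_pos ?_
      filter_upwards [g1.eventually_ge_atTop 1, eventually_gt_atTop T] with s hs hsT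
      have := mul_nonneg hA.le (sub_nonneg.2 (h₀ s hsT).le)
      simp only [hy] at hs
      linarith
    exact hbdd (tendsto_atTop_of_deriv_ge dd₀ one_pos (g2.eventually_ge_atTop 1))
  have hanti : AntitoneOn y (Ioi T) := by
    refine antitoneOn_of_deriv_nonpos (convex_Ioi T)
      (fun t _ => (dy t).continuousAt.continuousWithinAt)
      (fun t _ => (dy t).differentiableAt.differentiableWithinAt) fun t ht => ?_
    rw [interior_Ioi] at ht
    rw [(dy t).deriv]
    exact hy₁ t ht
  have hy₀ : ∀ t, T < t → 0 ≤ y t := by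
    intro t ht
    by_contra! hneg
    have hsmall : ∀ᶠ s in atTop, A n * (w s - v s) < -y t / 2 := by
      have := hlim.const_mul (A n)
      rw [mul_zero] at this
      exact this.eventually (eventually_lt_nhds (by linarith))
    have g1 : Tendsto (fun t => -(w₁ t - v₁ t)) atTop atTop := by
      refine tendsto_atTop_of_deriv_ge (fun t => (dd₁ t).neg) (show 0 < -y t / 2 by linarith) ?_
      filter_upwards [hsmall, eventually_ge_atTop t] with s hs hst
      have := hanti ht (ht.trans_le hst) hst
      simp only [hy] at this hs ⊢
      linarith
    exact hbdd' (tendsto_atTop_of_deriv_ge (fun t => (dd₀ t).neg) one_pos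
      (g1.eventually_ge_atTop 1))
  have hT : T < T + 1 := by linarith
  have k0 := h₀ _ hT
  have k1 := h₁ _ hT
  have k2 := hy₀ _ hT
  have k3 := hy₁ _ hT
  have hlam : 0 < (n : ℝ) / 2 := by linarith
  have hmu : 0 < ((n : ℝ) - 4) / 2 := by linarith
  simp only [hy, A_eq] at k2 k3
  set lam := (n : ℝ) / 2
  set mu := ((n : ℝ) - 4) / 2
  have k4 : 0 < lam ^ 2 * (w (T + 1) - v (T + 1)) := mul_pos (by positivity) (by linarith)
  have k5 : 0 ≤ lam ^ 2 * (v₁ (T + 1) - w₁ (T + 1)) := mul_nonneg (by positivity) (by linarith)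
  refine (hv.reflect (2 * (T + 1))).not_separated (hw.reflect (2 * (T + 1))) (T + 1) ?_ ?_ ?_ ?_
  all_goals simp only [show 2 * (T + 1) - (T + 1) = T + 1 by ring]
  · exact k0.le
  · have := mul_nonneg hmu.le (sub_nonneg.2 k0.le)
    change 0 ≤ -w₁ (T + 1) - -v₁ (T + 1) + mu * (w (T + 1) - v (T + 1))
    linarith
  · change 0 ≤ w₂ (T + 1) - v₂ (T + 1) - mu ^ 2 * (w (T + 1) - v (T + 1))
    linarith
  · change 0 < -w₃ (T + 1) - -v₃ (T + 1) - mu ^ 2 * (-w₁ (T + 1) - -v₁ (T + 1))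
      + lam * (w₂ (T + 1) - v₂ (T + 1) - mu ^ 2 * (w (T + 1) - v (T + 1)))
    have : 0 < lam * (w₂ (T + 1) - v₂ (T + 1) - mu ^ 2 * (w (T + 1) - v (T + 1))) :=
      mul_pos hlam (by linarith)
    linarith

lemma not_tendsto_of_f_pos (hv : Profile n v v₁ v₂ v₃) {ε : ℝ} (hε : 0 < ε)
    (h : ∀ᶠ t in atTop, ε ≤ f n (v t)) : False := by
  have hA : 0 ≤ A n := by rw [A_eq]; positivity
  have g1 := tendsto_atTop_of_deriv_ge (fun t =>
    ((hv.deriv₃ t).sub ((hv.deriv₁ t).const_mul (A n))).congr_deriv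
      (show _ = f n (v t) by ring)) hε h
  have g2 := tendsto_atTop_of_deriv_ge (fun t => (hv.deriv₂ t).sub ((hv.deriv₀ t).const_mul (A n)))
    one_pos (g1.eventually_ge_atTop 1)
  have g3 := tendsto_atTop_of_deriv_ge hv.deriv₁ one_pos (by
    filter_upwards [g2.eventually_ge_atTop 1] with t ht
    have := mul_nonneg hA (hv.pos t).le
    simp only [Pi.sub_apply] at ht
    linarith)
  have g4 := tendsto_atTop_of_deriv_ge hv.deriv₀ one_pos (g3.eventually_ge_atTop 1)
  obtain ⟨M, hM⟩ := hv.bdd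
  obtain ⟨t, ht⟩ := (g4.eventually_gt_atTop M).exists
  exact ht.not_ge (hM t)

lemma not_tendsto_of_f_neg (hv : Profile n v v₁ v₂ v₃) {ε : ℝ} (hε : 0 < ε)
    (h : ∀ᶠ t in atTop, ε ≤ -f n (v t)) : False := by
  have hA : 0 ≤ A n := by rw [A_eq]; positivity
  obtain ⟨M, hM⟩ := hv.bdd
  have g1 := tendsto_atTop_of_deriv_ge (fun t =>
    ((hv.deriv₃ t).sub ((hv.deriv₁ t).const_mul (A n))).neg.congr_deriv
      (show _ = -f n (v t) by ring)) hε h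
  have g2 := tendsto_atTop_of_deriv_ge
    (fun t => ((hv.deriv₂ t).sub ((hv.deriv₀ t).const_mul (A n))).neg)
    one_pos (g1.eventually_ge_atTop 1)
  have g3 := tendsto_atTop_of_deriv_ge (fun t => (hv.deriv₁ t).neg) one_pos (by
    filter_upwards [g2.eventually_ge_atTop (1 + A n * M)] with t ht
    have := mul_le_mul_of_nonneg_left (hM t) hA
    simp only [Pi.neg_apply, Pi.sub_apply] at ht
    linarith)
  have g4 := tendsto_atTop_of_deriv_ge (fun t => (hv.deriv₀ t).neg) one_pos
    (g3.eventually_ge_atTop 1)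
  obtain ⟨t, ht⟩ := (g4.eventually_gt_atTop 0).exists
  simp only [Pi.neg_apply] at ht
  linarith [hv.pos t]

lemma f_eq_zero_of_tendsto (hv : Profile n v v₁ v₂ v₃) {l : ℝ} (h : Tendsto v atTop (𝓝 l)) :
    f n l = 0 := by
  have hf := ((continuous_f hv.five_le).tendsto l).comp h
  rcases lt_trichotomy (f n l) 0 with hl | hl | hl
  · refine (hv.not_tendsto_of_f_neg (show 0 < -f n l / 2 by linarith) ?_).elim
    filter_upwards [hf.neg.eventually (eventually_ge_nhds (show -f n l / 2 < -f n l by linarith))]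
      with t ht using ht
  · exact hl
  · refine (hv.not_tendsto_of_f_pos (show 0 < f n l / 2 by linarith) ?_).elim
    filter_upwards [hf.eventually (eventually_ge_nhds (show f n l / 2 < f n l by linarith))]
      with t ht using ht

lemma eq_zero_or_of_tendsto (hv : Profile n v v₁ v₂ v₃) {l : ℝ} (h : Tendsto v atTop (𝓝 l)) :
    l = 0 ∨ l = a₀ n := by
  have h0 : 0 ≤ l := ge_of_tendsto' h fun t => (hv.pos t).le
  have hf := hv.f_eq_zero_of_tendsto h
  rcases h0.eq_or_lt with h1 | h1
  · exact Or.inl h1.symm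
  · rcases lt_trichotomy l (a₀ n) with h2 | h2 | h2
    · exact absurd hf (f_neg hv.five_le h1 h2).ne
    · exact Or.inr h2
    · exact absurd hf (f_pos hv.five_le h2).ne'

lemma tendsto_zero (hv : Profile n v v₁ v₂ v₃) {T : ℝ} (hT : ∀ t, T < t → v₁ t ≠ 0) :
    Tendsto v atTop (𝓝 0) ∧ ∀ t, T < t → v₁ t < 0 := by
  have hn := hv.five_le
  obtain ⟨M, hM⟩ := hv.bdd
  have hcont : ContinuousOn v (Ioi T) := fun t _ => (hv.deriv₀ t).continuousAt.continuousWithinAt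
  have hc := Profile.const hn
  rcases hasDerivWithinAt_forall_lt_or_forall_gt_of_forall_ne (convex_Ioi T)
    (fun t _ => (hv.deriv₀ t).hasDerivWithinAt) (m := 0) hT with hs | hs
  · have hanti : StrictAntiOn v (Ioi T) := strictAntiOn_of_deriv_neg (convex_Ioi T) hcont
      fun t ht => by
        rw [interior_Ioi] at ht
        rw [(hv.deriv₀ t).deriv]
        exact hs t ht
    have hlim : ∃ l, Tendsto v atTop (𝓝 l) ∧ ∀ t, T < t → l ≤ v t := by
      have ha : Antitone (fun t => v (max t (T + 1))) := fun s t hst =>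
        hanti.antitoneOn (lt_max_of_lt_right (by linarith : T < T + 1))
          (lt_max_of_lt_right (by linarith : T < T + 1)) (max_le_max_right _ hst)
      have hl := tendsto_atTop_ciInf ha ⟨0, by rintro _ ⟨t, rfl⟩; exact (hv.pos _).le⟩
      have hl' : Tendsto v atTop (𝓝 (⨅ t, v (max t (T + 1)))) := by
        refine hl.congr' ?_
        filter_upwards [eventually_ge_atTop (T + 1)] with t ht
        rw [max_eq_left ht]
      refine ⟨_, hl', fun t ht => le_of_tendsto hl' ?_⟩
      filter_upwards [eventually_ge_atTop t] with s hs
      exact hanti.antitoneOn ht (ht.trans_le hs) hs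
    obtain ⟨l, hl, hle⟩ := hlim
    rcases hv.eq_zero_or_of_tendsto hl with rfl | rfl
    · exact ⟨hl, hs⟩
    · have hlt : ∀ t, T < t → a₀ n < v t := fun t ht =>
        (hle (t + 1) (by linarith)).trans_lt
          (hanti ht (show T < t + 1 by linarith) (by linarith))
      refine (hc.not_asymptotic hv hlt (fun t ht => (hs t ht).le) (fun t ht => ?_) ?_).elim
      · rw [f_a₀ hn]
        exact (f_pos hn (hlt t ht)).le
      · simpa using hl.sub_const (a₀ n)
  · have hmono : StrictMonoOn v (Ioi T) := strictMonoOn_of_deriv_pos (convex_Ioi T) hcont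
      fun t ht => by
        rw [interior_Ioi] at ht
        rw [(hv.deriv₀ t).deriv]
        exact hs t ht
    have hlim : ∃ l, Tendsto v atTop (𝓝 l) ∧ ∀ t, T < t → v t ≤ l := by
      have ha : Monotone (fun t => v (max t (T + 1))) := fun s t hst =>
        hmono.monotoneOn (lt_max_of_lt_right (by linarith : T < T + 1))
          (lt_max_of_lt_right (by linarith : T < T + 1)) (max_le_max_right _ hst)
      have hl := tendsto_atTop_ciSup ha ⟨M, by rintro _ ⟨t, rfl⟩; exact hM _⟩
      have hl' : Tendsto v atTop (𝓝 (⨆ t, v (max t (T + 1)))) := by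
        refine hl.congr' ?_
        filter_upwards [eventually_ge_atTop (T + 1)] with t ht
        rw [max_eq_left ht]
      refine ⟨_, hl', fun t ht => ge_of_tendsto hl' ?_⟩
      filter_upwards [eventually_ge_atTop t] with s hs
      exact hmono.monotoneOn ht (ht.trans_le hs) hs
    obtain ⟨l, hl, hle⟩ := hlim
    rcases hv.eq_zero_or_of_tendsto hl with rfl | rfl
    · exact absurd (hle (T + 1) (by linarith)) (hv.pos _).not_ge
    · have hlt : ∀ t, T < t → v t < a₀ n := fun t ht =>
        (hmono ht (show T < t + 1 by linarith) (by linarith)).trans_le (hle (t + 1) (by linarith))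
      refine (hv.not_asymptotic hc hlt (fun t ht => (hs t ht).le) (fun t ht => ?_) ?_).elim
      · rw [f_a₀ hn]
        exact (f_neg hn (hv.pos t) (hlt t ht)).le
      · simpa using hl.const_sub (a₀ n)

end Profile

lemma not_tendsto_second_order {g g₁ g₂ : ℝ → ℝ} (h₀ : ∀ t, HasDerivAt g (g₁ t) t)
    (h₁ : ∀ t, HasDerivAt g₁ (g₂ t) t) {M : ℝ} (hM : ∀ t, |g t| ≤ M) (c₁ c₀ : ℝ) :
    ¬ Tendsto (fun t => g₂ t + c₁ * g₁ t + c₀ * g t) atTop atTop := by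
  intro h
  have hb : ∀ (k : ℝ) t, k * g t ≤ |k| * M := fun k t => by
    calc k * g t ≤ |k| * |g t| := by rw [← abs_mul]; exact le_abs_self _
      _ ≤ _ := by gcongr; exact hM t
  have e1 : Tendsto (fun t => g₁ t + c₁ * g t) atTop atTop := by
    refine tendsto_atTop_of_deriv_ge (fun t => (h₁ t).add ((h₀ t).const_mul c₁)) one_pos ?_
    filter_upwards [h.eventually_ge_atTop (1 + |c₀| * M)] with t ht
    linarith [hb c₀ t]
  have e2 : Tendsto g atTop atTop := by
    refine tendsto_atTop_of_deriv_ge h₀ one_pos ?_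
    filter_upwards [e1.eventually_ge_atTop (1 + |c₁| * M)] with t ht
    linarith [hb c₁ t]
  obtain ⟨t, ht⟩ := (e2.eventually_gt_atTop M).exists
  exact ht.not_ge ((le_abs_self _).trans (hM t))

lemma not_tendsto_third_order {g g₁ g₂ g₃ : ℝ → ℝ} (h₀ : ∀ t, HasDerivAt g (g₁ t) t)
    (h₁ : ∀ t, HasDerivAt g₁ (g₂ t) t) (h₂ : ∀ t, HasDerivAt g₂ (g₃ t) t) {M : ℝ}
    (hM : ∀ t, |g t| ≤ M) (c₂ c₁ c₀ : ℝ) :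
    ¬ Tendsto (fun t => g₃ t + c₂ * g₂ t + c₁ * g₁ t + c₀ * g t) atTop atTop := by
  intro h
  refine not_tendsto_second_order h₀ h₁ hM c₂ c₁ ?_
  refine tendsto_atTop_of_deriv_ge (fun t => ((h₂ t).add ((h₁ t).const_mul c₂)).add
    ((h₀ t).const_mul c₁)) one_pos ?_
  filter_upwards [h.eventually_ge_atTop (1 + |c₀| * M)] with t ht
  have : c₀ * g t ≤ |c₀| * M := by
    calc c₀ * g t ≤ |c₀| * |g t| := by rw [← abs_mul]; exact le_abs_self _
      _ ≤ _ := by gcongr; exact hM t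
  linarith

lemma tendsto_atTop_of_deriv_ge_mul {y y' : ℝ → ℝ} (hy : ∀ t, HasDerivAt y (y' t) t) {k T : ℝ}
    (hk : 0 < k) (h : ∀ t, T < t → k * y t ≤ y' t) {a : ℝ} (ha : T ≤ a) (hpos : 0 < y a) :
    Tendsto y atTop atTop := by
  have h1 : ∀ t, a ≤ t → rexp (k * (t - a)) * y a ≤ y t := fun t ht => by
    have := exp_mul_le_of_deriv_add_nonneg hy (-k) (a := a) (b := t) (fun s hs => by
      have := h s (ha.trans_lt hs.1)
      linarith) ⟨ht, le_rfl⟩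
    rwa [neg_neg] at this
  refine tendsto_atTop_mono' _ ((eventually_ge_atTop a).mono h1) ?_
  refine Tendsto.atTop_mul_const hpos (Real.tendsto_exp_atTop.comp ?_)
  exact (tendsto_atTop_add_const_right _ (-a) tendsto_id).const_mul_atTop hk

/-- Decay at the slower rate for a second order inequality with well-separated rates. -/
lemma exists_decay_second_order {g g₁ g₂ : ℝ → ℝ} (h₀ : ∀ t, HasDerivAt g (g₁ t) t)
    (h₁ : ∀ t, HasDerivAt g₁ (g₂ t) t) {l m b C : ℝ} (hmb : m < b) (hbl : b < l) (hC : 0 ≤ C)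
    (h : ∀ᶠ t in atTop, g₂ t + (l + m) * g₁ t + l * m * g t ≤ C * rexp (-b * t)) :
    ∃ K, ∀ᶠ t in atTop, g t ≤ K * rexp (-m * t) := by
  obtain ⟨T, hT⟩ := eventually_atTop.1 h
  have he : ∀ t : ℝ, HasDerivAt (fun t => rexp (-b * t)) (rexp (-b * t) * -b) t := fun t => by
    simpa using ((hasDerivAt_id t).const_mul (-b)).exp
  have hlb : 0 < l - b := sub_pos.2 hbl
  have hbm : 0 < b - m := sub_pos.2 hmb
  set X : ℝ → ℝ := fun t => C / (l - b) * rexp (-b * t) - (g₁ t + m * g t) with hX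
  have dX : ∀ t, HasDerivAt X (C / (l - b) * (rexp (-b * t) * -b) - (g₂ t + m * g₁ t)) t :=
    fun t => ((he t).const_mul _).sub ((h₁ t).add ((h₀ t).const_mul m))
  set C₂ := C / (l - b) + |X T| * rexp (b * T) with hC₂
  have hC₂0 : 0 ≤ C₂ := by positivity
  have e1 : ∀ t, T ≤ t → g₁ t + m * g t ≤ C₂ * rexp (-b * t) := by
    intro t ht
    have h2 := exp_mul_le_of_deriv_add_nonneg dX l (a := T) (b := t) (fun s hs => by
      have h3 := hT s hs.1.le
      have h4 : C / (l - b) * (rexp (-b * s) * -b) + l * (C / (l - b) * rexp (-b * s))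
          = C * rexp (-b * s) := by
        field_simp
        ring
      simp only [hX]
      linarith) ⟨ht, le_rfl⟩
    have h5 : -(|X T| * rexp (b * T) * rexp (-b * t)) ≤ rexp (-l * (t - T)) * X T := by
      rw [mul_assoc, ← Real.exp_add]
      have h6 : rexp (-l * (t - T)) ≤ rexp (b * T + -b * t) := by
        gcongr
        nlinarith
      have h7 : rexp (-l * (t - T)) * |X T| ≤ rexp (b * T + -b * t) * |X T| := by gcongr
      have h8 : rexp (-l * (t - T)) * -|X T| ≤ rexp (-l * (t - T)) * X T := by
        gcongr
        exact neg_abs_le _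
      linarith
    have h9 : X t = C / (l - b) * rexp (-b * t) - (g₁ t + m * g t) := rfl
    rw [hC₂, add_mul]
    linarith
  set Y : ℝ → ℝ := fun t => -(g t + C₂ / (b - m) * rexp (-b * t)) with hY
  have dY : ∀ t, HasDerivAt Y (-(g₁ t + C₂ / (b - m) * (rexp (-b * t) * -b))) t :=
    fun t => ((h₀ t).add ((he t).const_mul _)).neg
  refine ⟨-Y T * rexp (m * T), ?_⟩
  filter_upwards [eventually_ge_atTop T] with t ht
  have h2 := exp_mul_le_of_deriv_add_nonneg dY m (a := T) (b := t) (fun s hs => by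
    have h3 := e1 s hs.1.le
    have h4 : C₂ / (b - m) * (rexp (-b * s) * -b) + m * (C₂ / (b - m) * rexp (-b * s))
        = -(C₂ * rexp (-b * s)) := by
      field_simp
      ring
    simp only [hY]
    linarith) ⟨ht, le_rfl⟩
  have h5 : rexp (-m * (t - T)) = rexp (m * T) * rexp (-m * t) := by
    rw [← Real.exp_add]
    congr 1
    ring
  rw [h5] at h2
  have h6 : 0 ≤ C₂ / (b - m) * rexp (-b * t) := by positivity
  have h7 : Y t = -(g t + C₂ / (b - m) * rexp (-b * t)) := rfl
  linarith

namespace Profile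

variable {n : ℕ} {v v₁ v₂ v₃ : ℝ → ℝ}

lemma second_order_le (hv : Profile n v v₁ v₂ v₃) {T : ℝ} (hT : ∀ t, T < t → v₁ t < 0) {t : ℝ}
    (ht : T < t) :
    v₂ t + ((n : ℝ) / 2 + ((n : ℝ) - 4) / 2) * v₁ t + (n : ℝ) / 2 * (((n : ℝ) - 4) / 2) * v t
      ≤ v t ^ p n / ((n : ℝ) / 2 * (((n : ℝ) - 4) / 2)) := by
  have hn := exponent_sub_pos hv.five_le
  have hp := one_lt_p hv.five_le
  have hA := A_eq (n := n)
  have hB := B_eq (n := n)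
  have hlam0 : 0 < (n : ℝ) / 2 := by linarith
  have hmu0 : 0 < ((n : ℝ) - 4) / 2 := by linarith
  set lam := (n : ℝ) / 2
  set mu := ((n : ℝ) - 4) / 2
  obtain ⟨M, hM⟩ := hv.bdd
  have hMabs : ∀ t, |v t| ≤ M := fun t => by rw [abs_of_pos (hv.pos t)]; exact hM t
  have dp : ∀ t, HasDerivAt (fun t => v t ^ p n) (v₁ t * p n * v t ^ (p n - 1)) t := fun t =>
    (hv.deriv₀ t).rpow_const (Or.inl (hv.pos t).ne')
  have dp0 : ∀ t, T < t → v₁ t * p n * v t ^ (p n - 1) ≤ 0 := fun t ht =>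
    mul_nonpos_of_nonpos_of_nonneg (mul_nonpos_of_nonpos_of_nonneg (hT t ht).le (by linarith))
      (Real.rpow_nonneg (hv.pos t).le _)
  set ψ : ℝ → ℝ := fun t => v₃ t + lam * v₂ t - mu ^ 2 * v₁ t - lam * mu ^ 2 * v t with hψ
  have dψ : ∀ t, HasDerivAt ψ (lam * ψ t + v t ^ p n) t := fun t =>
    ((((hv.deriv₃ t).add ((hv.deriv₂ t).const_mul lam)).sub
      ((hv.deriv₁ t).const_mul (mu ^ 2))).sub ((hv.deriv₀ t).const_mul (lam * mu ^ 2))).congr_deriv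
      (by
        rw [f_of_pos (hv.pos t), hA, hB, hψ]
        ring)
  have hψle : ∀ t, T < t → -ψ t ≤ v t ^ p n / lam := by
    intro t ht
    by_contra! hlt
    have h1 := tendsto_atTop_of_deriv_ge_mul (y := fun t => -ψ t - v t ^ p n / lam)
      (fun t => (dψ t).neg.sub ((dp t).div_const lam)) hlam0 (T := T) (fun s hs => by
        have h2 := div_nonpos_of_nonpos_of_nonneg (dp0 s hs) hlam0.le
        have h3 : lam * (v s ^ p n / lam) = v s ^ p n := by field_simp
        linarith) ht.le (sub_pos.2 hlt)
    refine not_tendsto_third_order (fun t => (hv.deriv₀ t).neg) (fun t => (hv.deriv₁ t).neg)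
      (fun t => (hv.deriv₂ t).neg) (M := M) (fun t => by simpa using hMabs t)
      lam (-mu ^ 2) (-(lam * mu ^ 2)) (tendsto_atTop_mono (fun t => ?_) h1)
    have h4 : 0 ≤ v t ^ p n / lam := div_nonneg (Real.rpow_nonneg (hv.pos t).le _) hlam0.le
    simp only [hψ, Pi.neg_apply]
    linarith
  set P : ℝ → ℝ := fun t => v₂ t + (lam + mu) * v₁ t + lam * mu * v t with hP
  have dP : ∀ t, HasDerivAt P (mu * P t + ψ t) t := fun t =>
    (((hv.deriv₂ t).add ((hv.deriv₁ t).const_mul (lam + mu))).add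
      ((hv.deriv₀ t).const_mul (lam * mu))).congr_deriv (by
        simp only [hP, hψ]
        ring)
  change P t ≤ _
  by_contra! hlt
  have h1 := tendsto_atTop_of_deriv_ge_mul (y := fun t => P t - v t ^ p n / (lam * mu))
    (fun t => (dP t).sub ((dp t).div_const (lam * mu))) hmu0 (T := T) (fun s hs => by
      have h2 := div_nonpos_of_nonpos_of_nonneg (dp0 s hs) (mul_pos hlam0 hmu0).le
      have h3 : mu * (v s ^ p n / (lam * mu)) = v s ^ p n / lam := by field_simp
      have h4 := hψle s hs
      linarith) ht.le (sub_pos.2 hlt)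
  refine not_tendsto_second_order hv.deriv₀ hv.deriv₁ hMabs (lam + mu) (lam * mu)
    (tendsto_atTop_mono (fun t => ?_) h1)
  have h4 : 0 ≤ v t ^ p n / (lam * mu) :=
    div_nonneg (Real.rpow_nonneg (hv.pos t).le _) (mul_pos hlam0 hmu0).le
  simp only [hP]
  linarith

lemma exists_decay (hv : Profile n v v₁ v₂ v₃) {T : ℝ} (hT : ∀ t, T < t → v₁ t ≠ 0) :
    ∃ K, ∀ t, v t ≤ K * rexp (-(((n : ℝ) - 4) / 2) * t) := by
  have hn := exponent_sub_pos hv.five_le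
  have hp := one_lt_p hv.five_le
  obtain ⟨hlim, hneg⟩ := hv.tendsto_zero hT
  have hP := fun t ht => hv.second_order_le hneg (t := t) ht
  have hlam : (n : ℝ) / 2 = ((n : ℝ) - 4) / 2 + 2 := by ring
  have hmu0 : 0 < ((n : ℝ) - 4) / 2 := by linarith
  have hpmu : ∀ x, x / (((n : ℝ) - 4) / 2 + 4) * p n = x / (((n : ℝ) - 4) / 2) := fun x => by
    have h1 : (n : ℝ) + 4 ≠ 0 := by linarith
    have h2 : (n : ℝ) - 4 ≠ 0 := by linarith
    rw [p, show ((n : ℝ) - 4) / 2 + 4 = ((n : ℝ) + 4) / 2 by ring]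
    field_simp
  rw [hlam] at hP
  set mu := ((n : ℝ) - 4) / 2
  obtain ⟨M, hM⟩ := hv.bdd
  set D := (mu + 2) * mu with hD
  have hD0 : 0 < D := by positivity
  -- a preliminary rate below the optimal one
  set m := mu * (mu + 1) / (mu + 4) with hm
  have hm0 : 0 < m := by positivity
  have hmmu : m < mu := by
    rw [hm, div_lt_iff₀ (by linarith)]
    nlinarith
  have hε : 0 < (mu + 2 - m) * (mu - m) := mul_pos (by linarith) (by linarith)
  obtain ⟨K, hK⟩ : ∃ K, ∀ᶠ t in atTop, v t ≤ K * rexp (-m * t) := by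
    refine exists_decay_second_order hv.deriv₀ hv.deriv₁ (l := mu + 2 + mu - m) (m := m) (b := mu)
      hmmu (by linarith) le_rfl ?_
    have hsmall : ∀ᶠ t in atTop, v t ^ (p n - 1) ≤ D * ((mu + 2 - m) * (mu - m)) := by
      have h1 := hlim.rpow_const (p := p n - 1) (Or.inr (by linarith))
      rw [Real.zero_rpow (by linarith)] at h1
      exact h1.eventually (eventually_le_nhds (mul_pos hD0 hε))
    filter_upwards [hsmall, eventually_gt_atTop T] with t ht htT
    have h2 := hP t htT
    have h3 : v t ^ p n / D ≤ (mu + 2 - m) * (mu - m) * v t := by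
      rw [div_le_iff₀ hD0, show p n = p n - 1 + 1 by ring, Real.rpow_add_one (hv.pos t).ne']
      have := mul_le_mul_of_nonneg_right ht (hv.pos t).le
      linarith
    linarith
  obtain ⟨K₂, hK₂⟩ : ∃ K, ∀ᶠ t in atTop, v t ≤ K * rexp (-mu * t) := by
    refine exists_decay_second_order hv.deriv₀ hv.deriv₁ (l := mu + 2) (b := mu + 1)
      (C := |K| ^ p n / D) (by linarith) (by linarith) (by positivity) ?_
    filter_upwards [hK, eventually_gt_atTop T] with t ht htT
    refine (hP t htT).trans ?_
    rw [div_mul_eq_mul_div]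
    gcongr
    have h1 : v t ≤ |K| * rexp (-m * t) := ht.trans (by gcongr; exact le_abs_self K)
    refine (Real.rpow_le_rpow (hv.pos t).le h1 (by linarith)).trans ?_
    rw [Real.mul_rpow (abs_nonneg _) (exp_pos _).le, ← Real.exp_mul]
    have h2 : m * p n = mu + 1 := by
      rw [hm, hpmu]
      field_simp
    rw [show -m * t * p n = -(m * p n) * t by ring, h2]
  obtain ⟨S, hS⟩ := eventually_atTop.1 hK₂
  refine ⟨max K₂ (M * rexp (mu * S)), fun t => ?_⟩
  rcases le_total S t with h | h
  · refine (hS t h).trans ?_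
    gcongr
    exact le_max_left _ _
  · have hM0 : 0 ≤ M := (hv.pos 0).le.trans (hM 0)
    calc v t ≤ M * 1 := by rw [mul_one]; exact hM t
      _ ≤ M * (rexp (mu * S) * rexp (-mu * t)) := by
        gcongr
        rw [← Real.exp_add]
        refine Real.one_le_exp ?_
        nlinarith
      _ = M * rexp (mu * S) * rexp (-mu * t) := by ring
      _ ≤ _ := by gcongr; exact le_max_right _ _

/-- Bounded positive profiles are constant, periodic, or homoclinic to zero. -/
theorem classification (hv : Profile n v v₁ v₂ v₃) :
    (v = (fun _ => a₀ n) ∨ ((∃ L, 0 < L ∧ Function.Periodic v L) ∧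
      ∃ a ∈ Ioo 0 (a₀ n), (∀ t, a ≤ v t) ∧ ∃ t, v t = a)) ∨
    ((∃ K, ∀ t, v t ≤ K * rexp (-(((n : ℝ) - 4) / 2) * t)) ∧
      ∃ K, ∀ t, v t ≤ K * rexp (((n : ℝ) - 4) / 2 * t)) := by
  by_cases h : ∃ a b, a < b ∧ v₁ a = 0 ∧ v₁ b = 0
  · obtain ⟨a, b, hab, ha, hb⟩ := h
    have hL : 0 < 2 * (b - a) := by linarith
    have hper := hv.periodic ha hb
    exact Or.inl ((hv.classification_of_periodic hL hper).imp id fun h => ⟨⟨_, hL, hper⟩, h⟩)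
  · push Not at h
    have hT : ∃ T, (∀ t, T < t → v₁ t ≠ 0) ∧ ∀ t, t < T → v₁ t ≠ 0 := by
      by_cases h0 : ∃ a, v₁ a = 0
      · obtain ⟨a, ha⟩ := h0
        exact ⟨a, fun t ht => h a t ht ha, fun t ht hte => h t a ht hte ha⟩
      · push Not at h0
        exact ⟨0, fun t _ => h0 t, fun t _ => h0 t⟩
    obtain ⟨T, h1, h2⟩ := hT
    refine Or.inr ⟨hv.exists_decay h1, ?_⟩
    obtain ⟨K, hK⟩ := (hv.reflect 0).exists_decay (T := -T) fun t ht => by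
      simpa using h2 (-t) (by linarith)
    exact ⟨K, fun t => by simpa using hK (-t)⟩

end Profile

open EuclideanGeometry

lemma kelvin_eq_of_norm_lt {n : ℕ} {r : ℝ} {w : Rn n → ℝ} (hr : 0 < r)
    (h : ∀ y, r < ‖y‖ → kelvin r w y = w y) {y : Rn n} (hy : y ≠ 0) (hyr : ‖y‖ < r) :
    kelvin r w y = w y := by
  have hy0 : 0 < ‖y‖ := norm_pos_iff.2 hy
  have h1 : r < ‖inversion 0 r y‖ := by
    rw [norm_inversion, lt_div_iff₀ hy0]
    nlinarith
  have h2 := h _ h1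
  rw [kelvin, inversion_inversion _ hr.ne', norm_inversion] at h2
  rw [kelvin, ← h2, ← mul_assoc, ← Real.mul_rpow (by positivity) (by positivity)]
  have h3 : r / ‖y‖ * (r / (r ^ 2 / ‖y‖)) = 1 := by field_simp
  rw [h3, Real.one_rpow, one_mul]

/-- A positive solution on the whole space decaying like the fundamental solution along a ray
coincides with one of its Kelvin transforms. -/
lemma RepSolution.exists_kelvin_eq {n : ℕ} {c C : ℝ} {w : Rn n → ℝ}
    (hw : RepSolution n c ∅ w) {e : Rn n} (he : e ≠ 0)
    (hdecay : ∀ t > 0, t ^ ((n : ℝ) - 4) * w (t • e) ≤ C) :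
    ∃ r, 0 < r ∧ ∀ y, r < ‖y‖ → kelvin r w y = w y := by
  by_contra! h
  have hα : 0 < (n : ℝ) - 4 := one_pos.trans_le (exponent_sub_pos hw.five_le)
  have he0 : 0 < ‖e‖ := norm_pos_iff.2 he
  have hle : ∀ l : ℝ, 1 < l → l ^ ((n : ℝ) - 4) * w e ≤ C := fun l hl => by
    have hl0 : 0 < l := one_pos.trans hl
    have h2 : ‖l ^ 2 • e‖ = l ^ 2 * ‖e‖ := norm_smul_pos (by positivity) e
    rcases hw.moving_spheres (Λ := l * ‖e‖) (by simp) with ⟨r, hr, heq⟩ | hk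
    · obtain ⟨y, hy, hne⟩ := h r hr.1
      exact absurd (heq y (by simp) hy) hne
    · have h1 := hk (l * ‖e‖) ⟨by positivity, le_rfl⟩ (l ^ 2 • e) (by simp) (by
        rw [h2]
        nlinarith [mul_pos he0 (mul_pos hl0 (sub_pos.2 hl))])
      have h3 : l * ‖e‖ / (l ^ 2 * ‖e‖) = l⁻¹ := by field_simp
      rw [kelvin, inversion_zero_eq, h2, h3, smul_smul, ← mul_pow, inv_mul_cancel₀ hl0.ne',
        one_pow, one_smul] at h1
      have h4 := hdecay (l ^ 2) (by positivity)
      calc l ^ ((n : ℝ) - 4) * w e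
          = (l ^ 2) ^ ((n : ℝ) - 4) * (l⁻¹ ^ ((n : ℝ) - 4) * w e) := by
            rw [← mul_assoc, ← Real.mul_rpow (by positivity) (by positivity)]
            congr 2
            field_simp
        _ ≤ (l ^ 2) ^ ((n : ℝ) - 4) * w (l ^ 2 • e) := by gcongr
        _ ≤ C := h4
  have ht := (tendsto_rpow_atTop hα).atTop_mul_const (hw.pos e (by simp))
  obtain ⟨l, h1, h2⟩ := ((ht.eventually_gt_atTop C).and (eventually_gt_atTop 1)).exists
  exact (hle l h2).not_gt h1

namespace PuncturedSolution

variable {n : ℕ} {u : Rn n → ℝ}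

lemma exists_continuous_extension (hu : PuncturedSolution n u) (hrem : ¬ Removable n u) {M : ℝ}
    (hM : ∀ x, x ≠ 0 → u x ≤ M) :
    ∃ U : Rn n → ℝ, Continuous U ∧ (∀ x, 0 < U x) ∧ ∀ x, x ≠ 0 → U x = u x := by
  classical
  have := hu.nontrivial
  obtain ⟨e, he⟩ := exists_ne (0 : Rn n)
  obtain ⟨s, hs⟩ := Real.exists_isLUB (s := u '' {x | x ≠ 0}) ⟨u e, e, he, rfl⟩
    ⟨M, by rintro _ ⟨x, hx, rfl⟩; exact hM x hx⟩
  refine ⟨Function.update u 0 s, continuous_iff_continuousAt.2 fun x => ?_, fun x => ?_,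
    fun x hx => Function.update_of_ne hx _ _⟩
  · rcases eq_or_ne x 0 with rfl | hx
    · refine continuousAt_update_same.2 (tendsto_order.2 ⟨fun a ha => ?_, fun a ha => ?_⟩)
      · obtain ⟨_, ⟨x, hx, rfl⟩, hax, -⟩ := hs.exists_between ha
        filter_upwards [self_mem_nhdsWithin, nhdsWithin_le_nhds
          (Metric.ball_mem_nhds 0 (norm_pos_iff.2 hx))] with y hy hyx
        exact hax.trans_le (hu.le_of_norm_le hrem hy (mem_ball_zero_iff.1 hyx).le)
      · filter_upwards [self_mem_nhdsWithin] with y hy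
        exact (hs.1 ⟨y, hy, rfl⟩).trans_lt ha
    · exact (continuousAt_update_of_ne hx).2 (hu.contDiffAt hx).continuousAt
  · rcases eq_or_ne x 0 with rfl | hx
    · rw [Function.update_self]
      exact (hu.pos e he).trans_le (hs.1 ⟨e, he, rfl⟩)
    · rw [Function.update_of_ne hx]
      exact hu.pos x hx

/-- A sphere on which a continuous extension is invariant passes through the singularity. -/
lemma eq_norm_of_kelvin_eq (hu : PuncturedSolution n u) (hrem : ¬ Removable n u)
    {U : Rn n → ℝ} (hU : ∀ x, x ≠ 0 → U x = u x) {x : Rn n} (hx : x ≠ 0) {r : ℝ} (hr : 0 < r)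
    (h : ∀ y, r < ‖y‖ → kelvin r (fun z => U (x + z)) y = U (x + y)) : r = ‖x‖ := by
  by_contra hrx
  have hx0 : 0 < ‖x‖ := norm_pos_iff.2 hx
  have h0 : (0 : Rn n) - x ≠ 0 := by simpa using hx
  have hsub : ContinuousAt (fun y : Rn n => y - x) 0 :=
    (continuous_id.sub continuous_const).continuousAt
  have hinv : ContinuousAt (fun y : Rn n => ‖inversion 0 r (y - x)‖) 0 := by
    simp_rw [norm_inversion]
    exact continuousAt_const.div hsub.norm (by simpa using hx)
  have hev1 : ∀ᶠ y : Rn n in 𝓝 0, ‖inversion 0 r (y - x)‖ ≠ ‖x‖ := by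
    refine hinv.eventually_ne ?_
    rw [norm_inversion, zero_sub, norm_neg, ne_eq, div_eq_iff hx0.ne', ← sq]
    exact fun h1 => hrx ((pow_left_inj₀ hr.le hx0.le two_ne_zero).1 h1)
  have hev2 : ∀ᶠ y : Rn n in 𝓝 0, ‖y - x‖ ≠ r := by
    refine hsub.norm.eventually_ne ?_
    rw [zero_sub, norm_neg]
    exact Ne.symm hrx
  refine hrem (hu.removable_of_eq_kelvin hr hx hrx ?_)
  filter_upwards [self_mem_nhdsWithin, nhdsWithin_le_nhds hev1, nhdsWithin_le_nhds hev2,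
    nhdsWithin_le_nhds (hsub.eventually_ne h0)] with y hy h1 h2 h3
  have h4 : kelvin r (fun z => U (x + z)) (y - x) = U (x + (y - x)) := by
    rcases h2.lt_or_gt with h2 | h2
    · exact kelvin_eq_of_norm_lt (w := fun z => U (x + z)) hr h h3 h2
    · exact h _ h2
  have h5 : x + inversion 0 r (y - x) ≠ 0 := fun h5 => h1 (by
    rw [← neg_eq_of_add_eq_zero_right h5, norm_neg])
  rw [add_sub_cancel, hU y hy, kelvin, hU _ h5] at h4
  exact h4.symm

/-- A bounded solution decaying like the fundamental solution has a removable singularity. -/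
lemma removable_of_bounded (hu : PuncturedSolution n u) {M C : ℝ} (hM : ∀ x, x ≠ 0 → u x ≤ M)
    (hC : ∀ x, x ≠ 0 → ‖x‖ ^ ((n : ℝ) - 4) * u x ≤ C) : Removable n u := by
  by_contra hrem
  have := hu.nontrivial
  have hα : 0 < (n : ℝ) - 4 := one_pos.trans_le (exponent_sub_pos hu.five_le)
  obtain ⟨U, hUc, hUpos, hU⟩ := hu.exists_continuous_extension hrem hM
  obtain ⟨c, hc, hrep⟩ := hu.exists_representation
  have hUu : U =ᵐ[volume] u := by
    filter_upwards [hu.ae_ne] with y hy using hU y hy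
  have hsol : ∀ x, RepSolution n c ∅ (fun z => U (x + z)) := fun x => by
    simpa using hu.repSolution_translate hc hrep hUu subsingleton_empty hUc.continuousOn
      (fun y _ => hUpos y) x
  have hsphere : ∀ x : Rn n, x ≠ 0 →
      ∀ y, ‖x‖ < ‖y‖ → kelvin ‖x‖ (fun z => U (x + z)) y = U (x + y) := fun x hx => by
    have hx0 : 0 < ‖x‖ := norm_pos_iff.2 hx
    obtain ⟨r, hr, h⟩ := (hsol x).exists_kelvin_eq hx (C := C / ‖x‖ ^ ((n : ℝ) - 4))
      fun t ht => by
        have h1 : x + t • x = (1 + t) • x := by rw [add_smul, one_smul]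
        have h2 : (1 + t) • x ≠ 0 := smul_ne_zero (by positivity) hx
        have h3 := hC _ h2
        rw [norm_smul_pos (by positivity), Real.mul_rpow (by positivity) (by positivity)] at h3
        have h4 := hu.pos _ h2
        have h5 : t ^ ((n : ℝ) - 4) ≤ (1 + t) ^ ((n : ℝ) - 4) := by
          gcongr
          linarith
        rw [h1, hU _ h2, le_div_iff₀ (by positivity)]
        refine le_trans ?_ h3
        nlinarith [mul_le_mul_of_nonneg_right h5
          (mul_pos h4 (Real.rpow_pos_of_pos hx0 ((n : ℝ) - 4))).le]
    rwa [← hu.eq_norm_of_kelvin_eq hrem hU hx hr h]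
  obtain ⟨e, he⟩ := exists_norm_eq (Rn n) zero_le_one
  set G : ℝ → ℝ := fun s => s ^ ((n : ℝ) - 4) * U (s • e) with hG
  have hGc : Continuous G :=
    (Real.continuous_rpow_const hα.le).mul (hUc.comp (continuous_id.smul continuous_const))
  have hGlim : ∀ a, 0 < a → Tendsto G atTop (𝓝 (G a)) := fun a ha => by
    have hae : ‖a • e‖ = a := by rw [norm_smul_pos ha, he, mul_one]
    have h1 : Tendsto (fun s : ℝ => a + a ^ 2 / (s - a)) atTop (𝓝 a) := by
      simpa [sub_eq_add_neg] using (tendsto_const_nhds (x := a)).add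
        ((tendsto_const_nhds (x := a ^ 2)).div_atTop (tendsto_atTop_add_const_right _ (-a)
          tendsto_id))
    refine ((hGc.tendsto a).comp h1).congr' ?_
    filter_upwards [eventually_gt_atTop (2 * a)] with s hs
    have hsa : 0 < s - a := by linarith
    have hs0 : 0 < s := by linarith
    have hse : ‖(s - a) • e‖ = s - a := by rw [norm_smul_pos hsa, he, mul_one]
    have h2 := hsphere (a • e) (norm_pos_iff.1 (ha.trans_eq hae.symm)) ((s - a) • e) (by
      rw [hae, hse]
      linarith)
    have h3 : a • e + (a / (s - a)) ^ 2 • (s - a) • e = (a + a ^ 2 / (s - a)) • e := by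
      rw [smul_smul, ← add_smul]
      congr 2
      field_simp
    rw [kelvin, inversion_zero_eq, hae, hse, h3, ← add_smul, add_sub_cancel] at h2
    simp only [hG, Function.comp_apply]
    rw [← h2, ← mul_assoc, ← Real.mul_rpow hs0.le (by positivity)]
    congr 2
    field_simp
    ring
  have h0 : Tendsto G (𝓝[>] 0) (𝓝 (G 0)) := (hGc.tendsto 0).mono_left nhdsWithin_le_nhds
  have h1 : G 1 = G 0 := by
    refine tendsto_nhds_unique (tendsto_const_nhds.congr' ?_) h0
    filter_upwards [self_mem_nhdsWithin] with a ha
    exact tendsto_nhds_unique (hGlim 1 one_pos) (hGlim a ha)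
  simp only [hG, Real.one_rpow, one_mul, Real.zero_rpow hα.ne', zero_mul] at h1
  exact (hUpos _).ne' h1

theorem classification (hu : PuncturedSolution n u) (hrem : ¬ Removable n u) :
    ∃ (L : ℝ) (v : ℝ → ℝ), ContDiff ℝ 4 v ∧
      (∀ t : ℝ, iteratedDeriv 4 v t - A n * iteratedDeriv 2 v t - f n (v t) = 0) ∧
      ((v = fun _ => a₀ n) ∨
        ((∃ Lp : ℝ, 0 < Lp ∧ Function.Periodic v Lp) ∧
          ∃ a ∈ Set.Ioo 0 (a₀ n), (∀ t : ℝ, a ≤ v t) ∧ ∃ t : ℝ, v t = a)) ∧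
      ∀ x : Rn n, x ≠ 0 → u x = ‖x‖ ^ (-(((n : ℝ) - 4) / 2)) * v (Real.log ‖x‖ + L) := by
  obtain ⟨v, hvc, hv, huv⟩ := hu.exists_profile hrem
  refine ⟨0, v, hvc, fun t => ?_, ?_, fun x hx => by rw [add_zero, huv x hx]⟩
  · rw [iteratedDeriv_succ, (hv.deriv₃ t).deriv]
    ring
  · refine hv.classification.resolve_right ?_
    rintro ⟨⟨K, hK⟩, K', hK'⟩
    refine hrem (hu.removable_of_bounded (M := K') (C := K) (fun x hx => ?_) fun x hx => ?_)
    all_goals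
      have hx0 : 0 < ‖x‖ := norm_pos_iff.2 hx
      have hexp : ∀ s : ℝ, rexp (s * log ‖x‖) = ‖x‖ ^ s := fun s => by
        rw [Real.rpow_def_of_pos hx0, mul_comm]
      rw [huv x hx]
    · refine (mul_le_mul_of_nonneg_left (hK' (log ‖x‖)) (by positivity)).trans_eq ?_
      rw [hexp, mul_left_comm, ← Real.rpow_add hx0, neg_add_cancel, Real.rpow_zero, mul_one]
    · rw [← mul_assoc, ← Real.rpow_add hx0]
      refine (mul_le_mul_of_nonneg_left (hK (log ‖x‖)) (by positivity)).trans_eq ?_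
      rw [hexp, mul_left_comm, ← Real.rpow_add hx0]
      ring_nf
      simp

end PuncturedSolution

end BiharmonicCritical

/-- **Theorem 2 (classification of singular solutions).** If `u` is a positive `C⁴` solution of
`Δ²u = u^((n+4)/(n-4))` on `ℝⁿ \ {0}` whose singularity at the origin is non-removable, then
`u(x) = |x|^(-(n-4)/2) v(ln|x| + L)` for some `L ∈ ℝ` and a solution `v` of the ODE which is
either the constant `a₀` or periodic with minimal value in `(0, a₀)`. -/
theorem classification_singular_solutions (n : ℕ) (hn : 5 ≤ n)
    (u : EuclideanSpace ℝ (Fin n) → ℝ)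
    (hreg : ContDiffOn ℝ 4 u {x | x ≠ 0})
    (hpos : ∀ x : EuclideanSpace ℝ (Fin n), x ≠ 0 → 0 < u x)
    (heq : ∀ x : EuclideanSpace ℝ (Fin n), x ≠ 0 →
      Paper.biLap n u x = u x ^ (((n : ℝ) + 4) / ((n : ℝ) - 4)))
    (hnonrem : ¬ ∃ U : EuclideanSpace ℝ (Fin n) → ℝ, ContDiff ℝ 4 U ∧
      (∀ x : EuclideanSpace ℝ (Fin n), 0 < U x) ∧
      (∀ x : EuclideanSpace ℝ (Fin n),
        Paper.biLap n U x = U x ^ (((n : ℝ) + 4) / ((n : ℝ) - 4))) ∧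
      (∀ x : EuclideanSpace ℝ (Fin n), x ≠ 0 → U x = u x)) :
    ∃ (L : ℝ) (v : ℝ → ℝ), ContDiff ℝ 4 v ∧
      (∀ t : ℝ, iteratedDeriv 4 v t - Paper.A n * iteratedDeriv 2 v t
        - Paper.f n (v t) = 0) ∧
      ((v = fun _ => Paper.a₀ n) ∨
        ((∃ Lp : ℝ, 0 < Lp ∧ Function.Periodic v Lp) ∧
          ∃ a ∈ Set.Ioo 0 (Paper.a₀ n), (∀ t : ℝ, a ≤ v t) ∧ ∃ t : ℝ, v t = a)) ∧
      ∀ x : EuclideanSpace ℝ (Fin n), x ≠ 0 →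
        u x = ‖x‖ ^ (-(((n : ℝ) - 4) / 2)) * v (Real.log ‖x‖ + L) := by
  have hu : BiharmonicCritical.PuncturedSolution n u := ⟨hn, hreg, hpos, heq⟩
  exact hu.classification hnonrem
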